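/- There exist constants C > 0 and p > 0 with the following property (Masser's conjecture for ternary forms, proved by Dietmann): if F and G are nonsingular integral quadratic forms in 3 variables that are integrally equivalent, i.e., there exists a matrix A ∈ GL_3(ℤ) with F(AX) = G(X), then there exists such a matrix A ∈ GL_3(ℤ) with F(AX) = G(X) and max_{i,j} |A_{ij}| ≤ C · (|F| + |G|)^p. -/

import Mathlib

set_option linter.unusedVariables false
namespace Masser
open QuaternionAlgebra (imI_add imI_mul imI_one imI_smul imI_star imI_sub imI_zero imJ_add imJ_mul imJ_one imJ_smul imJ_star imJ_sub imJ_zero imK_add imK_mul imK_one imK_smul imK_star imK_sub imK_zero re_add re_mul re_one re_smul re_star re_sub re_zero)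
abbrev HA (R : Type*) [CommRing R] (α β : R) := QuaternionAlgebra R α 0 β
section basic
variable {R : Type*} [CommRing R] {α β : R}
def nrd (x : HA R α β) : R := x.re^2 - α*x.imI^2 - β*x.imJ^2 + α*β*x.imK^2
theorem nrd_mul (x y : HA R α β) : nrd (x*y) = nrd x * nrd y := by
  simp only [nrd, re_mul, imI_mul, imJ_mul, imK_mul]
  ring
theorem nrd_star (x : HA R α β) : nrd (star x) = nrd x := by
  simp only [nrd, re_star, imI_star, imJ_star, imK_star]
  ring
theorem mul_star' (x : HA R α β) : x * star x = nrd x • (1 : HA R α β) := by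
  ext <;> simp [nrd] <;> ring
theorem star_mul' (x : HA R α β) : star x * x = nrd x • (1 : HA R α β) := by
  ext <;> simp [nrd] <;> ring
theorem nrd_smul (r : R) (x : HA R α β) : nrd (r • x) = r^2 * nrd x := by
  simp [nrd]; ring
theorem nrd_one : nrd (1 : HA R α β) = 1 := by simp [nrd]
theorem nrd_zero : nrd (0 : HA R α β) = 0 := by simp [nrd]
end basic
section order
variable {R : Type*} [CommRing R] [LinearOrder R] [IsStrictOrderedRing R] {α β : R}
def bd (x : HA R α β) (M : R) : Prop := |x.re| ≤ M ∧ |x.imI| ≤ M ∧ |x.imJ| ≤ M ∧ |x.imK| ≤ M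
theorem bd.mono {x : HA R α β} {M M' : R} (h : bd x M) (hM : M ≤ M') : bd x M' :=
  ⟨h.1.trans hM, h.2.1.trans hM, h.2.2.1.trans hM, h.2.2.2.trans hM⟩
theorem bd.nonneg {x : HA R α β} {M : R} (h : bd x M) : 0 ≤ M := (abs_nonneg _).trans h.1
theorem bd.star {x : HA R α β} {M : R} (h : bd x M) : bd (star x) M := by
  obtain ⟨h1, h2, h3, h4⟩ := h
  refine ⟨?_, ?_, ?_, ?_⟩ <;> simpa
theorem abs_mul3_le {c a b C M M' : R} (hc : |c| ≤ C) (ha : |a| ≤ M) (hb : |b| ≤ M') :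
    |c*a*b| ≤ C*M*M' := by
  rw [abs_mul, abs_mul]
  have := (abs_nonneg c).trans hc
  have := (abs_nonneg a).trans ha
  gcongr
theorem bd.mul {x y : HA R α β} {M M' B : R} (hB : 1 ≤ B) (hα : |α| ≤ B) (hβ : |β| ≤ B)
    (hx : bd x M) (hy : bd y M') : bd (x*y) (4*B^2*M*M') := by
  obtain ⟨h1, h2, h3, h4⟩ := hx
  obtain ⟨k1, k2, k3, k4⟩ := hy
  have hB2 : B ≤ B^2 := by nlinarith
  have c1 : |(1:R)| ≤ B^2 := by rw [abs_one]; nlinarith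
  have c2 : |α| ≤ B^2 := hα.trans hB2
  have c3 : |β| ≤ B^2 := hβ.trans hB2
  have c4 : |α*β| ≤ B^2 := by
    rw [abs_mul, sq]; exact mul_le_mul hα hβ (abs_nonneg _) (by linarith)
  refine ⟨?_, ?_, ?_, ?_⟩
  · have e1 := abs_mul3_le c1 h1 k1
    have e2 := abs_mul3_le c2 h2 k2
    have e3 := abs_mul3_le c3 h3 k3
    have e4 := abs_mul3_le c4 h4 k4
    rw [abs_le] at *
    simp only [re_mul]
    constructor <;> linarith
  · have e1 := abs_mul3_le c1 h1 k2
    have e2 := abs_mul3_le c1 h2 k1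
    have e3 := abs_mul3_le c3 h3 k4
    have e4 := abs_mul3_le c3 h4 k3
    rw [abs_le] at *
    simp only [imI_mul]
    constructor <;> linarith
  · have e1 := abs_mul3_le c1 h1 k3
    have e2 := abs_mul3_le c2 h2 k4
    have e3 := abs_mul3_le c1 h3 k1
    have e4 := abs_mul3_le c2 h4 k2
    rw [abs_le] at *
    simp only [imJ_mul]
    constructor <;> linarith
  · have e1 := abs_mul3_le c1 h1 k4
    have e2 := abs_mul3_le c1 h2 k3
    have e3 := abs_mul3_le c1 h3 k2
    have e4 := abs_mul3_le c1 h4 k1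
    rw [abs_le] at *
    simp only [imK_mul]
    constructor <;> linarith
theorem bd.nrd {x : HA R α β} {M B : R} (hB : 1 ≤ B) (hα : |α| ≤ B) (hβ : |β| ≤ B)
    (hx : bd x M) : |nrd x| ≤ 4*B^2*M^2 := by
  have h := (bd.mul hB hα hβ hx hx.star).1
  rw [mul_star'] at h
  simp only [re_smul, re_one, smul_eq_mul, mul_one] at h
  linarith [h, (by ring : 4*B^2*M^2 = 4*B^2*M*M)]
theorem bd.add {x y : HA R α β} {M M' : R} (hx : bd x M) (hy : bd y M') : bd (x+y) (M+M') := by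
  obtain ⟨h1, h2, h3, h4⟩ := hx
  obtain ⟨k1, k2, k3, k4⟩ := hy
  refine ⟨?_, ?_, ?_, ?_⟩ <;> simp only [re_add, imI_add, imJ_add, imK_add] <;>
  exact (abs_add_le _ _).trans (by linarith)
theorem bd.neg {x : HA R α β} {M : R} (hx : bd x M) : bd (-x) M := by
  obtain ⟨h1, h2, h3, h4⟩ := hx
  refine ⟨?_, ?_, ?_, ?_⟩ <;> simpa
theorem bd.sub {x y : HA R α β} {M M' : R} (hx : bd x M) (hy : bd y M') : bd (x-y) (M+M') := by
  rw [sub_eq_add_neg]; exact hx.add hy.neg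
theorem bd.smul {x : HA R α β} {M r C : R} (hx : bd x M) (hr : |r| ≤ C) : bd (r • x) (C*M) := by
  obtain ⟨h1, h2, h3, h4⟩ := hx
  have := (abs_nonneg r).trans hr
  refine ⟨?_, ?_, ?_, ?_⟩ <;> simp only [re_smul, imI_smul, imJ_smul, imK_smul, smul_eq_mul, abs_mul] <;> gcongr
end order
section int
variable {α β : ℤ}
def dv (n : ℤ) (x : HA ℤ α β) : Prop := ∃ y : HA ℤ α β, x = n • y
theorem dv_iff {n : ℤ} {x : HA ℤ α β} : dv n x ↔ n ∣ x.re ∧ n ∣ x.imI ∧ n ∣ x.imJ ∧ n ∣ x.imK := by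
  constructor
  · rintro ⟨y, rfl⟩
    simp
  · rintro ⟨⟨a, ha⟩, ⟨b, hb⟩, ⟨c, hc⟩, ⟨d, hd⟩⟩
    exact ⟨⟨a,b,c,d⟩, by ext <;> simp [ha,hb,hc,hd]⟩
theorem dv.mul_left {n : ℤ} {x : HA ℤ α β} (h : dv n x) (y : HA ℤ α β) : dv n (y*x) := by
  obtain ⟨z, rfl⟩ := h; exact ⟨y*z, by rw [mul_smul_comm]⟩
theorem dv.mul_right {n : ℤ} {x : HA ℤ α β} (h : dv n x) (y : HA ℤ α β) : dv n (x*y) := by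
  obtain ⟨z, rfl⟩ := h; exact ⟨z*y, by rw [smul_mul_assoc]⟩
theorem dv.add {n : ℤ} {x y : HA ℤ α β} (h : dv n x) (h' : dv n y) : dv n (x+y) := by
  obtain ⟨z, rfl⟩ := h; obtain ⟨z', rfl⟩ := h'; exact ⟨z+z', by rw [smul_add]⟩
theorem dv.sub {n : ℤ} {x y : HA ℤ α β} (h : dv n x) (h' : dv n y) : dv n (x-y) := by
  obtain ⟨z, rfl⟩ := h; obtain ⟨z', rfl⟩ := h'; exact ⟨z-z', by rw [smul_sub]⟩
theorem dv.smul {n : ℤ} {x : HA ℤ α β} (h : dv n x) (r : ℤ) : dv n (r • x) := by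
  obtain ⟨z, rfl⟩ := h; exact ⟨r•z, by rw [smul_comm]⟩
theorem dv.of_dvd {n m : ℤ} {x : HA ℤ α β} (h : dv n x) (hm : m ∣ n) : dv m x := by
  obtain ⟨z, rfl⟩ := h; obtain ⟨k, rfl⟩ := hm; exact ⟨k•z, by rw [mul_smul]⟩
theorem dv.of_coprime_smul {n r : ℤ} {x : HA ℤ α β} (h : dv n (r • x)) (hr : IsCoprime n r) : dv n x := by
  rw [dv_iff] at *
  simp only [re_smul, imI_smul, imJ_smul, imK_smul, smul_eq_mul] at h
  exact ⟨hr.dvd_of_dvd_mul_left h.1, hr.dvd_of_dvd_mul_left h.2.1, hr.dvd_of_dvd_mul_left h.2.2.1, hr.dvd_of_dvd_mul_left h.2.2.2⟩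
theorem smul_inj {n : ℤ} (hn : n ≠ 0) {x y : HA ℤ α β} (h : n • x = n • y) : x = y := by
  have h1 := congrArg QuaternionAlgebra.re h
  have h2 := congrArg QuaternionAlgebra.imI h
  have h3 := congrArg QuaternionAlgebra.imJ h
  have h4 := congrArg QuaternionAlgebra.imK h
  simp only [re_smul, imI_smul, imJ_smul, imK_smul, smul_eq_mul] at h1 h2 h3 h4
  ext
  · exact mul_left_cancel₀ hn h1
  · exact mul_left_cancel₀ hn h2
  · exact mul_left_cancel₀ hn h3
  · exact mul_left_cancel₀ hn h4
theorem bd_of_smul {n : ℤ} (hn : n ≠ 0) {x : HA ℤ α β} {M : ℤ} (h : bd (n • x) M) : bd x M := by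
  have hn' : 1 ≤ |n| := Int.one_le_abs hn
  obtain ⟨h1, h2, h3, h4⟩ := h
  simp only [re_smul, imI_smul, imJ_smul, imK_smul, smul_eq_mul, abs_mul] at h1 h2 h3 h4
  refine ⟨?_, ?_, ?_, ?_⟩
  · nlinarith [abs_nonneg x.re]
  · nlinarith [abs_nonneg x.imI]
  · nlinarith [abs_nonneg x.imJ]
  · nlinarith [abs_nonneg x.imK]
def Gam (α β Q : ℤ) (x : HA ℤ α β) : Prop := nrd x = 1 ∧ Q ∣ x.imI ∧ Q ∣ x.imJ ∧ Q ∣ x.imK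
theorem gam_iff {Q : ℤ} {x : HA ℤ α β} : Gam α β Q x ↔ nrd x = 1 ∧ ∃ (r : ℤ) (y : HA ℤ α β), x = r • 1 + Q • y := by
  constructor
  · rintro ⟨h, ⟨b, hb⟩, ⟨c, hc⟩, ⟨d, hd⟩⟩
    exact ⟨h, x.re, ⟨0,b,c,d⟩, by ext <;> simp [hb,hc,hd]⟩
  · rintro ⟨h, r, y, rfl⟩
    exact ⟨h, by simp, by simp, by simp⟩
theorem Gam.one (Q : ℤ) : Gam α β Q 1 := by
  refine ⟨nrd_one, ?_, ?_, ?_⟩ <;> simp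
theorem Gam.mul {Q : ℤ} {x y : HA ℤ α β} (hx : Gam α β Q x) (hy : Gam α β Q y) : Gam α β Q (x*y) := by
  refine ⟨by rw [nrd_mul, hx.1, hy.1, one_mul], ?_⟩
  obtain ⟨-, ⟨a,ha⟩, ⟨b,hb⟩, ⟨c,hc⟩⟩ := hx
  obtain ⟨-, ⟨a',ha'⟩, ⟨b',hb'⟩, ⟨c',hc'⟩⟩ := hy
  simp only [imI_mul, imJ_mul, imK_mul, ha,hb,hc,ha',hb',hc']
  refine ⟨?_, ?_, ?_⟩
  · exact ⟨x.re*a' + a*y.re + 0 - β*b*Q*c' + β*Q*c*b', by ring⟩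
  · exact ⟨x.re*b' + α*Q*a*c' + b*y.re - α*c*Q*a', by ring⟩
  · exact ⟨x.re*c' + Q*a*b' - Q*b*a' + c*y.re, by ring⟩
theorem Gam.star {Q : ℤ} {x : HA ℤ α β} (hx : Gam α β Q x) : Gam α β Q (star x) := by
  obtain ⟨h1, h2, h3, h4⟩ := hx
  refine ⟨by rw [nrd_star, h1], ?_, ?_, ?_⟩ <;> simpa
theorem Gam.of_dvd {Q Q' : ℤ} {x : HA ℤ α β} (hx : Gam α β Q x) (h : Q' ∣ Q) : Gam α β Q' x :=
  ⟨hx.1, h.trans hx.2.1, h.trans hx.2.2.1, h.trans hx.2.2.2⟩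
end int
open MeasureTheory in
theorem linear_forms {n : ℕ} (M : Matrix (Fin n) (Fin n) ℝ) (c : Fin n → ℝ) (hM : M.det ≠ 0)
    (hc : ∀ i, 0 < c i) (h : |M.det| < ∏ i, c i) :
    ∃ z : Fin n → ℤ, z ≠ 0 ∧ ∀ i, |M.mulVec (fun j => (z j : ℝ)) i| ≤ c i := by
  set s : Set (Fin n → ℝ) := (Matrix.toLin' M) ⁻¹' (Set.Icc (-c) c) with hs
  have fund := ZSpan.isAddFundamentalDomain' (Pi.basisFun ℝ (Fin n)) volume
  have hdet : LinearMap.det (Matrix.toLin' M) ≠ 0 := by rwa [LinearMap.det_toLin']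
  have hlt : volume (ZSpan.fundamentalDomain (Pi.basisFun ℝ (Fin n))) * 2 ^ Module.finrank ℝ (Fin n → ℝ) < volume s := by
    rw [hs, Measure.addHaar_preimage_linearMap _ hdet, LinearMap.det_toLin', Real.volume_Icc_pi,
      ZSpan.fundamentalDomain_pi_basisFun, volume_pi, Measure.pi_pi]
    simp only [Real.volume_Ico, sub_zero, ENNReal.ofReal_one, Finset.prod_const_one, one_mul, Module.finrank_fin_fun, Pi.neg_apply]
    rw [← ENNReal.ofReal_prod_of_nonneg (fun i _ => by linarith [hc i]), ← ENNReal.ofReal_mul (abs_nonneg _),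
      show (2:ENNReal)^n = ENNReal.ofReal (2^n) by rw [ENNReal.ofReal_pow (by norm_num)]; simp]
    have e : ∏ i, (c i - - c i) = 2^n * ∏ i, c i := by
      rw [show (2:ℝ)^n = ∏ i : Fin n, (2:ℝ) by simp, ← Finset.prod_mul_distrib]
      exact Finset.prod_congr rfl (fun i _ => by ring)
    have hd : 0 < |M.det| := abs_pos.mpr hM
    rw [ENNReal.ofReal_lt_ofReal_iff_of_nonneg (by positivity), e, abs_inv, inv_mul_eq_div, lt_div_iff₀ hd]
    exact mul_lt_mul_of_pos_left h (by positivity)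
  have hsymm : ∀ x ∈ s, -x ∈ s := by
    intro x hx
    simp only [hs, Set.mem_preimage, map_neg, Set.mem_Icc] at hx ⊢
    exact ⟨neg_le_neg hx.2, neg_le.mp hx.1⟩
  have hconv : Convex ℝ s := (convex_Icc _ _).linear_preimage _
  haveI : Countable (Submodule.span ℤ (Set.range (Pi.basisFun ℝ (Fin n)))).toAddSubgroup :=
    inferInstanceAs (Countable (Submodule.span ℤ (Set.range (Pi.basisFun ℝ (Fin n)))))
  obtain ⟨x, hx0, hxs⟩ := exists_ne_zero_mem_lattice_of_measure_mul_two_pow_lt_measure fund hsymm hconv hlt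
  have hm := (Module.Basis.mem_span_iff_repr_mem (R := ℤ) (Pi.basisFun ℝ (Fin n)) (x : Fin n → ℝ)).1 x.2
  choose z hz using hm
  have hz' : (fun j => (z j : ℝ)) = (x : Fin n → ℝ) := by
    funext j; simpa using hz j
  refine ⟨z, ?_, fun i => ?_⟩
  · rintro rfl
    apply hx0
    ext1
    rw [← hz']; funext j; simp
  · rw [hz']
    simp only [hs, Set.mem_preimage, Matrix.toLin'_apply, Set.mem_Icc] at hxs
    exact abs_le.mpr ⟨hxs.1 i, hxs.2 i⟩
section
open Matrix
def cst {n : ℕ} (z : Fin n → ℤ) : Fin n → ℝ := fun j => (z j : ℝ)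
theorem bl_bound {n : ℕ} (q : Matrix (Fin n) (Fin n) ℝ) {B X Y : ℝ} (hq : ∀ i j, |q i j| ≤ B)
    (x y : Fin n → ℝ) (hx : ∀ i, |x i| ≤ X) (hy : ∀ i, |y i| ≤ Y) :
    |x ⬝ᵥ q *ᵥ y| ≤ n^2 * (B * X * Y) := by
  simp only [dotProduct, mulVec, Finset.mul_sum]
  calc |∑ i, ∑ j, x i * (q i j * y j)| ≤ ∑ i : Fin n, ∑ j : Fin n, (B * X * Y) := by
        refine (Finset.abs_sum_le_sum_abs _ _).trans (Finset.sum_le_sum fun i _ => ?_)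
        refine (Finset.abs_sum_le_sum_abs _ _).trans (Finset.sum_le_sum fun j _ => ?_)
        have h1 := (abs_nonneg _).trans (hq i j)
        have h2 := (abs_nonneg _).trans (hx i)
        rw [show x i * (q i j * y j) = q i j * x i * y j by ring, abs_mul, abs_mul]
        have := hq i j; have := hx i; have := hy j
        gcongr
    _ = _ := by simp; ring
theorem cassels_step {n : ℕ} (hn : 1 ≤ n) (F : Matrix (Fin n) (Fin n) ℤ) (L q : Matrix (Fin n) (Fin n) ℝ) {B : ℝ}
    (hB : 1 ≤ B) (hq : ∀ i j, |q i j| ≤ B) (hqs : q.IsSymm) (hL : L.det ≠ 0) (hL1 : |L.det| ≤ 1)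
    (hF : ∀ z w : Fin n → ℤ, ((z ⬝ᵥ F *ᵥ w : ℤ) : ℝ) = (L *ᵥ cst z) ⬝ᵥ q *ᵥ (L *ᵥ cst w))
    (v : Fin n → ℤ) (hv : v ≠ 0) (hv0 : v ⬝ᵥ F *ᵥ v = 0) {V : ℝ} (hV : ∀ i, |(L *ᵥ cst v) i| ≤ V) :
    ∃ w : Fin n → ℤ, w ≠ 0 ∧ w ⬝ᵥ F *ᵥ w = 0 ∧ ((∀ i, |(L *ᵥ cst w) i| ≤ V/2) ∨
      (∀ i, |(L *ᵥ cst w) i| ≤ 2 * (3*n*B)^(n-1) + 1)) := by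
  have hcv : cst v ≠ 0 := by
    intro h; apply hv; funext j; have := congrFun h j; simpa [cst] using this
  have hLv : L *ᵥ cst v ≠ 0 := by
    intro h; apply hcv
    exact Matrix.eq_zero_of_mulVec_eq_zero hL h
  haveI : Nonempty (Fin n) := ⟨⟨0, hn⟩⟩
  obtain ⟨i0, -, hi0⟩ := Finset.exists_max_image Finset.univ (fun i => |(L *ᵥ cst v) i|) Finset.univ_nonempty
  set V' := (L *ᵥ cst v) i0 with hV'
  have hV'0 : V' ≠ 0 := by
    intro h; apply hLv; funext i
    have := hi0 i (Finset.mem_univ _)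
    rw [h, abs_zero] at this
    exact abs_nonpos_iff.mp this
  set τ : Fin n → ℝ := fun i => (L *ᵥ cst v) i / V' with hτ
  have hτ1 : ∀ i, |τ i| ≤ 1 := by
    intro i
    rw [hτ]; simp only [abs_div]
    exact (div_le_one (abs_pos.mpr hV'0)).mpr (hi0 i (Finset.mem_univ _))
  have hτ0 : τ i0 = 1 := by simp only [hτ]; exact div_self hV'0
  have hLvτ : L *ᵥ cst v = V' • τ := by
    funext i; simp only [hτ, Pi.smul_apply, smul_eq_mul]; field_simp
  have hn' : (1:ℝ) ≤ n := by exact_mod_cast hn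
  set ε : ℝ := 1/(3*n*B) with hε
  have h3 : 1 ≤ 3*n*B := by nlinarith
  have hε0 : 0 < ε := by positivity
  have hε1 : ε ≤ 1 := by rw [hε]; exact (div_le_one (by linarith)).mpr h3
  set T : ℝ := 2*(3*n*B)^(n-1) with hT
  set M : Matrix (Fin n) (Fin n) ℝ := fun i j => if i = i0 then L i j else L i j - τ i * L i0 j with hM
  have hMdet : M.det = L.det := by
    have := Matrix.det_eq_of_forall_row_eq_smul_add_const (A := L) (B := M) (fun i => if i = i0 then 0 else τ i) i0 (by simp) (by
      intro i j; simp only [hM]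
      split_ifs with h
      · ring
      · ring)
    exact this.symm
  obtain ⟨b, hb0, hb⟩ := linear_forms M (fun i => if i = i0 then T else ε) (by rw [hMdet]; exact hL)
    (by intro i; split_ifs <;> positivity) (by
      rw [hMdet]
      refine hL1.trans_lt ?_
      rw [← Finset.mul_prod_erase Finset.univ _ (Finset.mem_univ i0)]
      rw [if_pos rfl, Finset.prod_congr rfl (g := fun _ => ε) (by intro x hx; rw [if_neg (Finset.ne_of_mem_erase hx)])]
      rw [Finset.prod_const, Finset.card_erase_of_mem (Finset.mem_univ _), Finset.card_univ, Fintype.card_fin, hT, mul_assoc, ← mul_pow]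
      have : 3*n*B*ε = 1 := by rw [hε]; field_simp
      rw [this]; simp)
  set t := (L *ᵥ cst b) i0 with ht
  have hMb : ∀ i, i ≠ i0 → (M *ᵥ cst b) i = (L *ᵥ cst b) i - t * τ i := by
    intro i hi
    simp only [ht, mulVec, dotProduct, hM, if_neg hi, sub_mul, Finset.sum_sub_distrib, Finset.sum_mul]
    congr 1
    exact Finset.sum_congr rfl fun j _ => by ring
  have htT : |t| ≤ T := by
    have := hb i0
    simp only [mulVec, dotProduct, hM, if_true] at this
    exact this
  set β : Fin n → ℝ := L *ᵥ cst b - t • τ with hβ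
  have hβ0 : β i0 = 0 := by simp [hβ, hτ0, ht]
  have hβε : ∀ i, |β i| ≤ ε := by
    intro i
    by_cases hi : i = i0
    · rw [hi, hβ0, abs_zero]; exact hε0.le
    · have := hb i
      rw [if_neg hi] at this
      have e := hMb i hi
      simp only [hβ, Pi.sub_apply, Pi.smul_apply, smul_eq_mul]
      rw [← e]; exact this
  have hLb : L *ᵥ cst b = t • τ + β := by rw [hβ]; abel
  have hsym : ∀ x y : Fin n → ℝ, x ⬝ᵥ q *ᵥ y = y ⬝ᵥ q *ᵥ x := by
    intro x y
    rw [Matrix.dotProduct_mulVec, ← Matrix.mulVec_transpose, hqs.eq, dotProduct_comm]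
  have hqτ : τ ⬝ᵥ q *ᵥ τ = 0 := by
    have := hF v v
    rw [hv0, hLvτ] at this
    simp only [mulVec_smul, dotProduct_smul, smul_dotProduct, smul_eq_mul, Int.cast_zero] at this
    have h2 : V' * (V' * (τ ⬝ᵥ q *ᵥ τ)) = 0 := this.symm
    simpa [hV'0] using h2
  set A := τ ⬝ᵥ q *ᵥ β with hA
  set E := β ⬝ᵥ q *ᵥ β with hE
  have hbb : ((b ⬝ᵥ F *ᵥ b : ℤ) : ℝ) = 2*t*A + E := by
    rw [hF, hLb]
    simp only [mulVec_add, mulVec_smul, dotProduct_add, add_dotProduct, dotProduct_smul, smul_dotProduct, smul_eq_mul, hqτ]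
    rw [hsym β τ, ← hA, ← hE]; ring
  have hvb : ((v ⬝ᵥ F *ᵥ b : ℤ) : ℝ) = V' * A := by
    rw [hF, hLb, hLvτ]
    simp only [mulVec_add, mulVec_smul, dotProduct_add, dotProduct_smul, smul_dotProduct, smul_eq_mul, hqτ]
    rw [← hA]; ring
  have hbv : b ⬝ᵥ F *ᵥ v = v ⬝ᵥ F *ᵥ b := by
    have : ((b ⬝ᵥ F *ᵥ v : ℤ) : ℝ) = ((v ⬝ᵥ F *ᵥ b : ℤ):ℝ) := by rw [hF, hF, hsym]
    exact_mod_cast this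
  set a : Fin n → ℤ := (b ⬝ᵥ F *ᵥ b) • v - (2 * (v ⬝ᵥ F *ᵥ b)) • b with ha
  have hLa : L *ᵥ cst a = V' • (E • τ - (2*A) • β) := by
    have : cst a = ((b ⬝ᵥ F *ᵥ b : ℤ):ℝ) • cst v - ((2 * (v ⬝ᵥ F *ᵥ b : ℤ)):ℝ) • cst b := by
      funext j; simp [cst, ha]
    rw [this, mulVec_sub, mulVec_smul, mulVec_smul, hbb, hvb, hLvτ, hLb]
    funext j
    simp only [Pi.sub_apply, Pi.add_apply, Pi.smul_apply, smul_eq_mul]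
    ring
  by_cases ha0 : a = 0
  · refine ⟨b, hb0, ?_, Or.inr fun i => ?_⟩
    · have h0 : V' • (E • τ - (2*A) • β) = 0 := by
        rw [← hLa, ha0]
        have : cst (0 : Fin n → ℤ) = 0 := by funext j; simp [cst]
        rw [this, mulVec_zero]
      have h1 : E • τ - (2*A) • β = 0 := by
        rcases smul_eq_zero.mp h0 with h | h
        · exact absurd h hV'0
        · exact h
      have hE0 : E = 0 := by
        have := congrFun h1 i0
        simpa [hτ0, hβ0] using this
      rw [hE0, zero_smul, zero_sub, neg_eq_zero, smul_eq_zero] at h1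
      have hA0 : A = 0 := by
        rcases h1 with h | h
        · linarith
        · rw [hA, h]; simp
      have : ((b ⬝ᵥ F *ᵥ b : ℤ) : ℝ) = 0 := by rw [hbb, hE0, hA0]; ring
      exact_mod_cast this
    · rw [hLb]
      simp only [Pi.add_apply, Pi.smul_apply, smul_eq_mul]
      refine (abs_add_le _ _).trans ?_
      rw [abs_mul]
      have h1 := hτ1 i; have h2 := hβε i
      have : |t| * |τ i| ≤ T * 1 := mul_le_mul htT h1 (abs_nonneg _) (by positivity)
      linarith
  · refine ⟨a, ha0, ?_, Or.inl fun i => ?_⟩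
    · simp only [ha, mulVec_sub, mulVec_smul, dotProduct_sub, sub_dotProduct, dotProduct_smul, smul_dotProduct, smul_eq_mul, hbv, hv0]
      ring
    · have hE' := bl_bound q hq β β hβε hβε
      have hA' := bl_bound q hq τ β hτ1 hβε
      rw [← hE] at hE'; rw [← hA] at hA'
      rw [hLa]
      simp only [Pi.sub_apply, Pi.smul_apply, smul_eq_mul]
      have k1 : |E * τ i - 2*A*β i| ≤ 1/2 := by
        have u1 : |E * τ i| ≤ n^2*(B*ε*ε) * 1 := by
          rw [abs_mul]; exact mul_le_mul hE' (hτ1 i) (abs_nonneg _) (by positivity)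
        have u2 : |2*A*β i| ≤ 2*(n^2*(B*1*ε)) * ε := by
          rw [abs_mul, abs_mul, abs_two]
          have := hβε i
          gcongr
        have u3 : n^2*(B*ε*ε) ≤ 1/9 := by
          have : n^2*(B*ε*ε) = 1/(9*B) := by rw [hε]; field_simp; norm_num
          rw [this]; exact one_div_le_one_div_of_le (by norm_num) (by linarith)
        refine (abs_sub _ _).trans ?_
        linarith [u1,u2,u3]
      rw [abs_mul]
      have : |V'| ≤ V := hV i0
      have := abs_nonneg V'
      calc |V'| * |E * τ i - 2*A*β i| ≤ V * (1/2) := by gcongr; linarith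
        _ = V/2 := by ring
theorem cassels {n : ℕ} (hn : 1 ≤ n) (F : Matrix (Fin n) (Fin n) ℤ) (L q : Matrix (Fin n) (Fin n) ℝ) {B : ℝ}
    (hB : 1 ≤ B) (hq : ∀ i j, |q i j| ≤ B) (hqs : q.IsSymm) (hL : L.det ≠ 0) (hL1 : |L.det| ≤ 1)
    (hF : ∀ z w : Fin n → ℤ, ((z ⬝ᵥ F *ᵥ w : ℤ) : ℝ) = (L *ᵥ cst z) ⬝ᵥ q *ᵥ (L *ᵥ cst w))
    (v : Fin n → ℤ) (hv : v ≠ 0) (hv0 : v ⬝ᵥ F *ᵥ v = 0) :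
    ∃ w : Fin n → ℤ, w ≠ 0 ∧ w ⬝ᵥ F *ᵥ w = 0 ∧
      (∀ i, |(L *ᵥ cst w) i| ≤ 2 * (3*n*B)^(n-1) + 1) := by
  have key : ∀ k : ℕ, ∀ v : Fin n → ℤ, v ≠ 0 → v ⬝ᵥ F *ᵥ v = 0 → (∀ i, |(L *ᵥ cst v) i| ≤ 2^k) →
      ∃ w : Fin n → ℤ, w ≠ 0 ∧ w ⬝ᵥ F *ᵥ w = 0 ∧
      (∀ i, |(L *ᵥ cst w) i| ≤ 2 * (3*n*B)^(n-1) + 1) := by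
    intro k
    induction k with
    | zero =>
      intro v h1 h2 h3
      refine ⟨v, h1, h2, fun i => (h3 i).trans ?_⟩
      have : 0 ≤ (3*n*B)^(n-1) := by positivity
      simp; linarith
    | succ k ih =>
      intro v h1 h2 h3
      obtain ⟨w, w1, w2, w3⟩ := cassels_step hn F L q hB hq hqs hL hL1 hF v h1 h2 h3
      rcases w3 with w3 | w3
      · exact ih w w1 w2 (fun i => (w3 i).trans (by rw [pow_succ]; linarith))
      · exact ⟨w, w1, w2, w3⟩
  set S := ∑ i, |(L *ᵥ cst v) i| with hS
  obtain ⟨k, hk⟩ := pow_unbounded_of_one_lt S (by norm_num : (1:ℝ) < 2)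
  refine key k v hv hv0 fun i => ?_
  exact (Finset.single_le_sum (f := fun i => |(L *ᵥ cst v) i|) (fun i _ => abs_nonneg _) (Finset.mem_univ i)).trans hk.le
end
section
open Matrix
theorem aux_b {b y Y : ℝ} (h0 : 0 ≤ b) (h1 : b ≤ 1) (hy : |y| ≤ Y) : |b*y| ≤ Y := by
  rw [abs_mul, abs_of_nonneg h0]; nlinarith [abs_nonneg y]
theorem aux_u {u y Y : ℝ} (h1 : 1 ≤ u) (hy : |u*y| ≤ Y) : |y| ≤ Y := by
  rw [abs_mul, abs_of_nonneg (by linarith)] at hy; nlinarith [abs_nonneg y]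
theorem xcount_one {α β : ℤ} {B : ℤ} (hα1 : 1 ≤ α) (hβ1 : 1 ≤ β) (hα : α ≤ B) (hβ : β ≤ B)
    {T b : ℝ} (hT : 1 ≤ T) (hb0 : 0 ≤ b) (hb1 : b ≤ 1) :
    ∃ x : HA ℤ α β, x ≠ 0 ∧ |nrd x| ≤ 8*B^2 ∧
      |(x.re:ℝ)| ≤ 3*B*T ∧ |(x.imI:ℝ)| ≤ 3*B*T ∧ |(x.imJ:ℝ)| ≤ 3*B*T ∧ |(x.imK:ℝ)| ≤ 3*B*T ∧
      ∃ p q r s : ℝ, p = x.re + √α * x.imI ∧ s = x.re - √α*x.imI ∧ q = √β*x.imJ+√α*√β*x.imK ∧ r = √β*x.imJ-√α*√β*x.imK ∧ ((nrd x : ℤ) : ℝ) = p*s-q*r ∧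
        |q+b*p| ≤ 2*B/T ∧ |s+b*r| ≤ 2*B/T := by
  set u := √(α:ℝ) with hu
  set w := √(β:ℝ) with hw
  have hα1' : (1:ℝ) ≤ α := by exact_mod_cast hα1
  have hβ1' : (1:ℝ) ≤ β := by exact_mod_cast hβ1
  have hα' : (α:ℝ) ≤ B := by exact_mod_cast hα
  have hβ' : (β:ℝ) ≤ B := by exact_mod_cast hβ
  have hu2 : u^2 = α := Real.sq_sqrt (by linarith)
  have hw2 : w^2 = β := Real.sq_sqrt (by linarith)
  have hu1 : 1 ≤ u := Real.one_le_sqrt.mpr hα1'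
  have hw1 : 1 ≤ w := Real.one_le_sqrt.mpr hβ1'
  have hB1 : (1:ℝ) ≤ B := by linarith
  set M : Matrix (Fin 4) (Fin 4) ℝ := !![1, u, 0, 0; 0, 0, w, -(u*w); b, b*u, w, u*w; 1, -u, b*w, -(b*(u*w))] with hM
  have hdet : M.det = -(4*α*β) := by
    rw [hM]
    simp [Matrix.det_succ_row_zero, Fin.sum_univ_succ, Fin.succAbove]
    rw [← hu2, ← hw2]; ring
  obtain ⟨z, hz0, hz⟩ := linear_forms M ![2*B*T, 2*B*T, 2*B/T, 2*B/T] (by rw [hdet]; nlinarith) (by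
    intro i; fin_cases i <;> simp <;> positivity) (by
    rw [hdet, abs_neg, abs_of_nonneg (by positivity)]
    simp [Fin.prod_univ_succ]
    have : 2*B*T*(2*B*T*(2*B/T*(2*B/T))) = 16*(B:ℝ)^4 := by field_simp; norm_num
    rw [this]
    have h1 : (α:ℝ)*β ≤ B*B := mul_le_mul hα' hβ' (by linarith) (by linarith)
    nlinarith [mul_self_nonneg ((B:ℝ)*B-1)])
  have k1 : |(z 0 : ℝ) + u * z 1| ≤ 2*B*T := by
    have := hz 0
    simpa [hM, mulVec, dotProduct, Fin.sum_univ_succ] using this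
  have k2 : |w * z 2 - u*w*z 3| ≤ 2*B*T := by
    have := hz 1
    simp [hM, mulVec, dotProduct, Fin.sum_univ_succ] at this
    convert this using 2
    ring
  have k3 : |(w * z 2 + u*w*z 3) + b*((z 0 : ℝ) + u * z 1)| ≤ 2*B/T := by
    have := hz 2
    simp [hM, mulVec, dotProduct, Fin.sum_univ_succ] at this
    convert this using 2
    ring
  have k4 : |((z 0 : ℝ) - u * z 1) + b*(w * z 2 - u*w*z 3)| ≤ 2*B/T := by
    have := hz 3
    simp [hM, mulVec, dotProduct, Fin.sum_univ_succ] at this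
    convert this using 2
    ring
  clear_value u w
  clear hz
  have hnr : ((nrd (⟨z 0, z 1, z 2, z 3⟩ : HA ℤ α β) : ℤ) : ℝ) = ((z 0 : ℝ) + u * z 1)*((z 0 : ℝ) - u * z 1) - (w * z 2 + u*w*z 3)*(w * z 2 - u*w*z 3) := by
    simp only [nrd]; push_cast; rw [← hu2, ← hw2]; ring
  have hT2 : 2*B/T ≤ 2*B := div_le_self (by positivity) hT
  have hBT : (B:ℝ) ≤ B*T := by nlinarith
  refine ⟨⟨z 0, z 1, z 2, z 3⟩, ?_, ?_, ?_, ?_, ?_, ?_, _, _, _, _, rfl, rfl, rfl, rfl, hnr, k3, k4⟩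
  · intro h
    apply hz0
    have h1 := congrArg QuaternionAlgebra.re h
    have h2 := congrArg QuaternionAlgebra.imI h
    have h3 := congrArg QuaternionAlgebra.imJ h
    have h4 := congrArg QuaternionAlgebra.imK h
    funext i; fin_cases i <;> simpa
  · have : |((nrd (⟨z 0, z 1, z 2, z 3⟩ : HA ℤ α β) : ℤ) : ℝ)| ≤ 8*B^2 := by
      rw [hnr]
      have e : ((z 0 : ℝ) + u * z 1)*((z 0 : ℝ) - u * z 1) - (w * z 2 + u*w*z 3)*(w * z 2 - u*w*z 3)
        = ((z 0 : ℝ) + u * z 1)*(((z 0 : ℝ) - u * z 1) + b*(w * z 2 - u*w*z 3)) - ((w * z 2 + u*w*z 3) + b*((z 0 : ℝ) + u * z 1))*(w * z 2 - u*w*z 3) := by ring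
      rw [e]
      refine (abs_sub _ _).trans ?_
      rw [abs_mul, abs_mul]
      have e1 := mul_le_mul k1 k4 (abs_nonneg _) (by positivity)
      have e2 := mul_le_mul k3 k2 (abs_nonneg _) (by positivity)
      have e3 : 2*B*T*(2*B/T) = 4*(B:ℝ)^2 := by field_simp; norm_num
      have e4 : 2*B/T*(2*B*T) = 4*(B:ℝ)^2 := by field_simp; norm_num
      rw [e3] at e1; rw [e4] at e2
      linarith
    exact_mod_cast this
  all_goals simp only
  · have a1 : |b*(w * z 2 - u*w*z 3)| ≤ 2*B*T := aux_b hb0 hb1 k2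
    rw [abs_le] at *
    constructor <;> linarith
  · have a1 : |b*(w * z 2 - u*w*z 3)| ≤ 2*B*T := aux_b hb0 hb1 k2
    have : |u * z 1| ≤ 3*B*T := by
      rw [abs_le] at *
      constructor <;> linarith
    exact aux_u hu1 this
  · have a1 : |b*((z 0 : ℝ) + u * z 1)| ≤ 2*B*T := aux_b hb0 hb1 k1
    have : |w * z 2| ≤ 3*B*T := by
      rw [abs_le] at *
      constructor <;> linarith
    exact aux_u hw1 this
  · have a1 : |b*((z 0 : ℝ) + u * z 1)| ≤ 2*B*T := aux_b hb0 hb1 k1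
    have : |u*w * z 3| ≤ 3*B*T := by
      rw [abs_le] at *
      constructor <;> linarith
    exact aux_u (one_le_mul_of_one_le_of_one_le hu1 hw1) this
theorem aux_B1 {B : ℤ} (hB : 2 ≤ B) : 8*B^2+1 - -(8*B^2) ≤ B^7 := by
  nlinarith [mul_le_mul_of_nonneg_right (pow_le_pow_left₀ (by norm_num) hB 5) (sq_nonneg B)]
theorem aux_B2 {B : ℤ} (hB : 2 ≤ B) : 8*B^3-0 ≤ B^6 := by
  nlinarith [mul_le_mul_of_nonneg_right (pow_le_pow_left₀ (by norm_num) hB 3) (pow_pos (by omega : 0 < B) 3).le]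
theorem aux_B3 {B : ℤ} (hB : 2 ≤ B) : 20*B^2 ≤ B^7 := by
  nlinarith [mul_le_mul_of_nonneg_right (pow_le_pow_left₀ (by norm_num) hB 5) (sq_nonneg B)]
def Aniso (α β : ℤ) : Prop := ∀ x : HA ℤ α β, nrd x = 0 → x = 0
set_option maxHeartbeats 1000000 in
open Classical in
theorem xcount {α β : ℤ} {B Q : ℤ} (hB : 2 ≤ B) (hα1 : 1 ≤ α) (hβ1 : 1 ≤ β) (hα : α ≤ B) (hβ : β ≤ B)
    (hQ1 : 1 ≤ Q) (hQ : Q ≤ B) (han : Aniso α β) {T : ℤ} (hT : 1 ≤ T) :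
    ∃ (X : Finset (HA ℤ α β)) (n0 : ℤ), n0 ≠ 0 ∧ |n0| ≤ 8*B^2 ∧ (∀ x ∈ X, nrd x = n0 ∧ bd x (3*B*T)) ∧
      (∀ x ∈ X, ∀ y ∈ X, dv (n0*Q) (x-y)) ∧ T^2 ≤ B^38 * (X.card : ℤ) := by
  have hT' : (1:ℝ) ≤ T := by exact_mod_cast hT
  set J : ℕ := (T^2/(20*B^2)).toNat with hJ
  have hJT : 20*B^2*(J:ℤ) ≤ T^2 := by
    rw [hJ, Int.toNat_of_nonneg (by positivity)]
    exact Int.mul_ediv_self_le (by positivity)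
  have hJT2 : T^2 < 20*B^2*((J:ℤ)+1) := by
    rw [hJ, Int.toNat_of_nonneg (by positivity), mul_comm]
    exact Int.lt_ediv_add_one_mul_self _ (by positivity)
  have hb : ∀ j : Fin (J+1), (20*(B:ℝ)^2*(j:ℕ)/(T:ℝ)^2) ≤ 1 := by
    intro j
    rw [div_le_one (by positivity)]
    have h1 : ((j:ℕ):ℝ) ≤ J := by exact_mod_cast Nat.lt_succ_iff.mp j.2
    have h2 : 20*(B:ℝ)^2*J ≤ (T:ℝ)^2 := by exact_mod_cast hJT
    nlinarith [sq_nonneg (B:ℝ)]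
  choose x hx0 hxn hx1 hx2 hx3 hx4 p q r s hp hs hq hr hn hqp hsr using fun j : Fin (J+1) =>
    xcount_one (B := B) hα1 hβ1 hα hβ hT' (b := 20*(B:ℝ)^2*(j:ℕ)/(T:ℝ)^2) (by positivity) (hb j)
  have hinj : Function.Injective x := by
    intro i j hij
    by_contra hne
    have hne' : (i:ℕ) ≠ (j:ℕ) := fun h => hne (Fin.ext h)
    set bi := 20*(B:ℝ)^2*(i:ℕ)/(T:ℝ)^2 with hbi
    set bj := 20*(B:ℝ)^2*(j:ℕ)/(T:ℝ)^2 with hbj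
    have hdiff : 20*(B:ℝ)^2/(T:ℝ)^2 ≤ |bi-bj| := by
      have : bi - bj = 20*(B:ℝ)^2/(T:ℝ)^2 * (((i:ℕ):ℝ)-((j:ℕ):ℝ)) := by rw [hbi, hbj]; ring
      rw [this, abs_mul, abs_of_nonneg (by positivity : 0 ≤ 20*(B:ℝ)^2/(T:ℝ)^2)]
      have h1 : (1:ℝ) ≤ |((i:ℕ):ℝ)-((j:ℕ):ℝ)| := by
        have : (1:ℤ) ≤ |((i:ℕ):ℤ)-((j:ℕ):ℤ)| := Int.one_le_abs (by omega)
        exact_mod_cast this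
      have : 0 ≤ 20*(B:ℝ)^2/(T:ℝ)^2 := by positivity
      nlinarith
    have ep : p j = p i := by rw [hp, hp, hij]
    have es : s j = s i := by rw [hs, hs, hij]
    have eq : q j = q i := by rw [hq, hq, hij]
    have er : r j = r i := by rw [hr, hr, hij]
    have a1 := hqp i; have a2 := hqp j; have a3 := hsr i; have a4 := hsr j
    rw [ep, eq] at a2; rw [es, er] at a4
    have gen : ∀ y z : ℝ, |y + bi*z| ≤ 2*B/T → |y+bj*z| ≤ 2*B/T → |z| ≤ T/(5*B) := by
      intro y z h1 h2
      have h3 : |bi-bj| * |z| ≤ 4*B/T := by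
        rw [← abs_mul]
        have : (bi-bj)*z = (y+bi*z)-(y+bj*z) := by ring
        rw [this]
        refine (abs_sub _ _).trans ((add_le_add h1 h2).trans (le_of_eq (by ring)))
      have h4 : 20*(B:ℝ)^2/(T:ℝ)^2 * |z| ≤ 4*B/T := le_trans (by gcongr) h3
      rw [le_div_iff₀ (by positivity)]
      rw [div_mul_eq_mul_div, div_le_div_iff₀ (by positivity) (by positivity)] at h4
      have h5 : 4*B*T*(|z| * (5*B)) ≤ 4*B*T*T := by nlinarith
      exact le_of_mul_le_mul_left h5 (by positivity)
    have b1 := gen _ _ a1 a2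
    have b2 := gen _ _ a3 a4
    have h1 := hn i
    have h2 : |((nrd (x i) : ℤ) : ℝ)| ≤ 4/5 := by
      rw [h1]
      have : p i * s i - q i * r i = p i * (s i + bi * r i) - (q i + bi * p i) * r i := by ring
      rw [this]
      refine (abs_sub _ _).trans ?_
      rw [abs_mul, abs_mul]
      have e1 := mul_le_mul b1 a3 (abs_nonneg _) (by positivity)
      have e2 := mul_le_mul a1 b2 (abs_nonneg _) (by positivity)
      have e3 : T/(5*B)*(2*B/T) = (2/5:ℝ) := by field_simp
      have e4 : 2*B/T*(T/(5*B)) = (2/5:ℝ) := by field_simp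
      rw [e3] at e1; rw [e4] at e2
      linarith
    have h3 : (1:ℝ) ≤ |((nrd (x i) : ℤ) : ℝ)| := by
      have : 1 ≤ |nrd (x i)| := Int.one_le_abs fun h => hx0 i (han _ h)
      exact_mod_cast this
    linarith
  set X0 : Finset (HA ℤ α β) := Finset.univ.image x with hX0
  have hX0c : X0.card = J+1 := by
    rw [hX0, Finset.card_image_of_injective _ hinj]; simp
  set K := Finset.Ico (0:ℤ) (8*B^3) with hK
  set t : Finset (ℤ×ℤ×ℤ×ℤ×ℤ) := Finset.Icc (-(8*B^2)) (8*B^2) ×ˢ K ×ˢ K ×ˢ K ×ˢ K with ht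
  set φ : HA ℤ α β → ℤ×ℤ×ℤ×ℤ×ℤ := fun x => (nrd x, x.re % (nrd x * Q), x.imI % (nrd x * Q), x.imJ % (nrd x*Q), x.imK % (nrd x*Q)) with hφ
  have hφt : ∀ y ∈ X0, φ y ∈ t := by
    intro y hy
    obtain ⟨j, -, rfl⟩ := Finset.mem_image.mp hy
    have hne : nrd (x j) ≠ 0 := fun h => hx0 j (han _ h)
    have hne2 : nrd (x j) * Q ≠ 0 := mul_ne_zero hne (by omega)
    have hle : |nrd (x j) * Q| ≤ 8*B^3 := by
      rw [abs_mul, abs_of_pos (by omega : 0 < Q)]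
      nlinarith [hxn j, abs_nonneg (nrd (x j))]
    have hmod : ∀ a : ℤ, a % (nrd (x j) * Q) ∈ K := by
      intro a
      rw [hK, Finset.mem_Ico]
      exact ⟨Int.emod_nonneg _ hne2, (Int.emod_lt_abs _ hne2).trans_le hle⟩
    simp only [ht, hφ, Finset.mem_product, Finset.mem_Icc]
    exact ⟨abs_le.mp (hxn j), hmod _, hmod _, hmod _, hmod _⟩
  have htc : (t.card : ℤ) ≤ B^31 := by
    rw [ht]
    simp only [Finset.card_product, hK, Int.card_Icc, Int.card_Ico, Nat.cast_mul]
    rw [Int.toNat_of_nonneg (by linarith [sq_nonneg B]), Int.toNat_of_nonneg (by rw [sub_zero]; positivity)]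
    have h1 : 8*B^2+1 - -(8*B^2) ≤ B^7 := aux_B1 hB
    have h2 : 8*B^3-0 ≤ B^6 := aux_B2 hB
    have h0 : 0 ≤ 8*B^3-0 := by rw [sub_zero]; positivity
    calc _ ≤ B^7 * (B^6*(B^6*(B^6*B^6))) := by gcongr
      _ = B^31 := by ring
  have htn : t.Nonempty := ⟨φ (x 0), hφt _ (Finset.mem_image_of_mem _ (Finset.mem_univ _))⟩
  obtain ⟨y, hy, hyc⟩ := Finset.exists_le_card_fiber_of_nsmul_le_card_of_maps_to (M := ℚ) hφt htn
    (b := (X0.card:ℚ)/t.card) (by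
      rw [nsmul_eq_mul]
      have : (t.card:ℚ) ≠ 0 := by exact_mod_cast htn.card_pos.ne'
      field_simp; exact le_rfl)
  have htpos : (0:ℚ) < t.card := by exact_mod_cast htn.card_pos
  rw [div_le_iff₀ htpos] at hyc
  set X := X0.filter (fun x => φ x = y) with hX
  have hyc' : (X0.card : ℤ) ≤ X.card * t.card := by exact_mod_cast hyc
  have hXpos : ∃ x0, x0 ∈ X := by
    by_contra h
    have : X = ∅ := Finset.eq_empty_of_forall_notMem (by simpa using h)
    rw [this, hX0c] at hyc'
    simp at hyc'; omega
  obtain ⟨x0, hx0X⟩ := hXpos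
  have hmem : ∀ x' ∈ X, ∃ j, x j = x' := by
    intro x' h
    obtain ⟨j, -, hj⟩ := Finset.mem_image.mp (Finset.mem_filter.mp h).1
    exact ⟨j, hj⟩
  have hyy : ∀ x' ∈ X, φ x' = y := fun x' h => (Finset.mem_filter.mp h).2
  have hnn : ∀ x' ∈ X, nrd x' = y.1 := fun x' h => by rw [← hyy x' h]
  refine ⟨X, y.1, ?_, ?_, ?_, ?_, ?_⟩
  · rw [← hnn x0 hx0X]
    obtain ⟨j, rfl⟩ := hmem x0 hx0X
    exact fun h => hx0 j (han _ h)
  · rw [← hnn x0 hx0X]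
    obtain ⟨j, rfl⟩ := hmem x0 hx0X
    exact hxn j
  · intro x' hx'
    refine ⟨hnn x' hx', ?_⟩
    obtain ⟨j, rfl⟩ := hmem x' hx'
    exact ⟨by exact_mod_cast hx1 j, by exact_mod_cast hx2 j, by exact_mod_cast hx3 j, by exact_mod_cast hx4 j⟩
  · intro a ha b hb
    have h1 := (hyy a ha).trans (hyy b hb).symm
    simp only [hφ, Prod.mk.injEq] at h1
    rw [hnn a ha, hnn b hb] at h1
    obtain ⟨-, h2, h3, h4, h5⟩ := h1
    rw [dv_iff]
    exact ⟨Int.ModEq.dvd h2.symm, Int.ModEq.dvd h3.symm, Int.ModEq.dvd h4.symm, Int.ModEq.dvd h5.symm⟩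
  · rw [hX0c] at hyc'
    push_cast at hyc'
    have h1 : 20*B^2 ≤ B^7 := aux_B3 hB
    have h2 : (J:ℤ)+1 ≤ X.card * B^31 := hyc'.trans (by gcongr)
    calc T^2 ≤ 20*B^2*((J:ℤ)+1) := hJT2.le
      _ ≤ B^7 * (X.card * B^31) := by gcongr
      _ = _ := by ring
end
theorem collin {a b c x y z x1 y1 z1 x2 y2 z2 r s κ : ℤ} (han : ∀ x y z : ℤ, a*x^2+b*y^2+c*z^2 = 0 → x = 0 ∧ y = 0 ∧ z = 0)
    (h0 : a*x^2+b*y^2+c*z^2 = κ) (h1 : a*(x+x1)^2+b*(y+y1)^2+c*(z+z1)^2 = κ) (h2 : a*(x+x2)^2+b*(y+y2)^2+c*(z+z2)^2 = κ)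
    (hr : r ≠ 0) (hs : s ≠ 0) (e1 : r*x1 = s*x2) (e2 : r*y1 = s*y2) (e3 : r*z1 = s*z2)
    (hne : ¬ (x1 = 0 ∧ y1 = 0 ∧ z1 = 0)) : x1 = x2 ∧ y1 = y2 ∧ z1 = z2 := by
  have hq : a*x1^2+b*y1^2+c*z1^2 ≠ 0 := fun h => hne (han _ _ _ h)
  have k1 : (a*x1^2+b*y1^2+c*z1^2) + 2*(a*x*x1+b*y*y1+c*z*z1) = 0 := by linear_combination h1 - h0
  have k2 : s^2*((a*x2^2+b*y2^2+c*z2^2) + 2*(a*x*x2+b*y*y2+c*z*z2)) = 0 := by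
    linear_combination s^2*(h2 - h0)
  have k3 : r*(r-s)*(a*x1^2+b*y1^2+c*z1^2) = 0 := by
    linear_combination k2 - r*s*k1 + (a*(r*x1+s*x2)+2*s*a*x)*e1 + (b*(r*y1+s*y2)+2*s*b*y)*e2+ (c*(r*z1+s*z2)+2*s*c*z)*e3
  have k4 : r = s := by
    rcases mul_eq_zero.mp k3 with h | h
    · rcases mul_eq_zero.mp h with h | h
      · exact absurd h hr
      · linarith
    · exact absurd h hq
  subst k4
  exact ⟨mul_left_cancel₀ hr e1, mul_left_cancel₀ hr e2, mul_left_cancel₀ hr e3⟩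
theorem abs_q_le {a b c A D x y z : ℤ} (ha : |a| ≤ A) (hb : |b| ≤ A) (hc : |c| ≤ A) (hx : |x| ≤ D) (hy : |y| ≤ D) (hz : |z| ≤ D) :
    |a*x^2+b*y^2+c*z^2| ≤ 3*(A*D^2) := by
  have gen : ∀ u v : ℤ, |u| ≤ A → |v| ≤ D → |u*v^2| ≤ A*D^2 := by
    intro u v hu hv
    rw [abs_mul, abs_pow]
    have := (abs_nonneg u).trans hu
    gcongr
  have h1 := gen a x ha hx
  have h2 := gen b y hb hy
  have h3 := gen c z hc hz
  rw [abs_le] at *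
  constructor <;> linarith
theorem cramer_bd {u v w A D x1 y1 z1 x2 y2 z2 x3 y3 z3 : ℤ}
    (h1 : |u*x1+v*y1+w*z1| ≤ A) (h2 : |u*x2+v*y2+w*z2| ≤ A) (h3 : |u*x3+v*y3+w*z3| ≤ A)
    (b1 : |y1| ≤ D ∧ |z1| ≤ D) (b2 : |y2| ≤ D ∧ |z2| ≤ D) (b3 : |y3| ≤ D ∧ |z3| ≤ D)
    (hdet : x1*(y2*z3-y3*z2)+x2*(y3*z1-y1*z3)+x3*(y1*z2-y2*z1) ≠ 0) : |u| ≤ 6*(A*D^2) := by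
  have gen : ∀ s t s' t' : ℤ, |s| ≤ D ∧ |t| ≤ D → |s'| ≤ D ∧ |t'| ≤ D → |s*t'-s'*t| ≤ 2*D^2 := by
    intro s t s' t' h h'
    have hD := (abs_nonneg s).trans h.1
    have e1 : |s*t'| ≤ D*D := by rw [abs_mul]; exact mul_le_mul h.1 h'.2 (abs_nonneg _) hD
    have e2 : |s'*t| ≤ D*D := by rw [abs_mul]; exact mul_le_mul h'.1 h.2 (abs_nonneg _) hD
    refine (abs_sub _ _).trans ?_
    nlinarith
  have g1 := gen _ _ _ _ b2 b3
  have g2 := gen _ _ _ _ b3 b1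
  have g3 := gen _ _ _ _ b1 b2
  have hA := (abs_nonneg _).trans h1
  have m1 : |(u*x1+v*y1+w*z1)*(y2*z3-y3*z2)| ≤ A*(2*D^2) := by
    rw [abs_mul]; exact mul_le_mul h1 g1 (abs_nonneg _) hA
  have m2 : |(u*x2+v*y2+w*z2)*(y3*z1-y1*z3)| ≤ A*(2*D^2) := by
    rw [abs_mul]; exact mul_le_mul h2 g2 (abs_nonneg _) hA
  have m3 : |(u*x3+v*y3+w*z3)*(y1*z2-y2*z1)| ≤ A*(2*D^2) := by
    rw [abs_mul]; exact mul_le_mul h3 g3 (abs_nonneg _) hA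
  have e : (x1*(y2*z3-y3*z2)+x2*(y3*z1-y1*z3)+x3*(y1*z2-y2*z1))*u = (u*x1+v*y1+w*z1)*(y2*z3-y3*z2) + (u*x2+v*y2+w*z2)*(y3*z1-y1*z3) + (u*x3+v*y3+w*z3)*(y1*z2-y2*z1) := by ring
  have : |(x1*(y2*z3-y3*z2)+x2*(y3*z1-y1*z3)+x3*(y1*z2-y2*z1))*u| ≤ 6*(A*D^2) := by
    rw [e]; rw [abs_le] at *; constructor <;> linarith
  rw [abs_mul] at this
  have h5 := Int.one_le_abs hdet
  nlinarith [abs_nonneg u]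
theorem dependent {a b c x y z x1 y1 z1 x2 y2 z2 x3 y3 z3 A D κ : ℤ}
    (ha : |a| ≤ A) (hb : |b| ≤ A) (hc : |c| ≤ A) (ha0 : a ≠ 0) (hb0 : b ≠ 0) (hc0 : c ≠ 0)
    (h0 : a*x^2+b*y^2+c*z^2 = κ) (h1 : a*(x+x1)^2+b*(y+y1)^2+c*(z+z1)^2 = κ) (h2 : a*(x+x2)^2+b*(y+y2)^2+c*(z+z2)^2 = κ)
    (h3 : a*(x+x3)^2+b*(y+y3)^2+c*(z+z3)^2 = κ)
    (b1 : |x1| ≤ D ∧ |y1| ≤ D ∧ |z1| ≤ D) (b2 : |x2| ≤ D ∧ |y2| ≤ D ∧ |z2| ≤ D) (b3 : |x3| ≤ D ∧ |y3| ≤ D ∧ |z3| ≤ D)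
    (hκ : 243*A^2*D^8 < |κ|) :
    x1*(y2*z3-y3*z2)+x2*(y3*z1-y1*z3)+x3*(y1*z2-y2*z1) = 0 := by
  by_contra hdet
  have gen : ∀ x1 y1 z1 : ℤ, a*(x+x1)^2+b*(y+y1)^2+c*(z+z1)^2 = κ → |x1| ≤ D ∧ |y1| ≤ D ∧ |z1| ≤ D →
     |2*a*x*x1+2*b*y*y1+2*c*z*z1| ≤ 3*(A*D^2) := by
    intro x1 y1 z1 h b
    have := abs_q_le ha hb hc b.1 b.2.1 b.2.2
    rw [← abs_neg] at this
    convert this using 2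
    linear_combination h - h0
  have g1 := gen _ _ _ h1 b1
  have g2 := gen _ _ _ h2 b2
  have g3 := gen _ _ _ h3 b3
  have w1 := cramer_bd g1 g2 g3 b1.2 b2.2 b3.2 hdet
  have w2 := cramer_bd (u := 2*b*y) (v := 2*c*z) (w := 2*a*x) (x1 := y1) (y1 := z1) (z1 := x1) (x2 := y2) (y2 := z2) (z2 := x2) (x3 := y3) (y3 := z3) (z3 := x3)
    (by convert g1 using 2; ring) (by convert g2 using 2; ring) (by convert g3 using 2; ring) ⟨b1.2.2, b1.1⟩ ⟨b2.2.2, b2.1⟩ ⟨b3.2.2, b3.1⟩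
    (by intro h; apply hdet; linear_combination h)
  have w3 := cramer_bd (u := 2*c*z) (v := 2*a*x) (w := 2*b*y) (x1 := z1) (y1 := x1) (z1 := y1) (x2 := z2) (y2 := x2) (z2 := y2) (x3 := z3) (y3 := x3) (z3 := y3)
    (by convert g1 using 2; ring) (by convert g2 using 2; ring) (by convert g3 using 2; ring) ⟨b1.1, b1.2.1⟩ ⟨b2.1, b2.2.1⟩ ⟨b3.1, b3.2.1⟩
    (by intro h; apply hdet; linear_combination h)
  have gen2 : ∀ u t : ℤ, u ≠ 0 → |2*u*t| ≤ 6*(3*(A*D^2)*D^2) → |u*t^2| ≤ 81*A^2*D^8 := by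
    intro u t hu h
    have h4 : |u*t| ≤ 9*(A*D^4) := by
      rw [mul_assoc, abs_mul, abs_two] at h
      linarith [h, (by ring : 6*(3*(A*D^2)*D^2) = 2*(9*(A*D^4)))]
    have h5 : |u*t|^2 ≤ (9*(A*D^4))^2 := pow_le_pow_left₀ (abs_nonneg _) h4 2
    have h6 : |u*t^2| ≤ |u*t|^2 := by
      rw [abs_mul, abs_mul, mul_pow, abs_pow]
      have := Int.one_le_abs hu
      exact mul_le_mul_of_nonneg_right (by nlinarith) (by positivity)
    calc _ ≤ _ := h6
      _ ≤ _ := h5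
      _ = _ := by ring
  have v1 := gen2 a x ha0 w1
  have v2 := gen2 b y hb0 w2
  have v3 := gen2 c z hc0 w3
  have : |κ| ≤ 243*A^2*D^8 := by
    rw [← h0]; rw [abs_le] at *; constructor <;> linarith
  linarith
open Classical in
theorem cellcount {a b c A D κ : ℤ} (han : ∀ x y z : ℤ, a*x^2+b*y^2+c*z^2 = 0 → x = 0 ∧ y = 0 ∧ z = 0)
    (ha : |a| ≤ A) (hb : |b| ≤ A) (hc : |c| ≤ A) (ha0 : a ≠ 0) (hb0 : b ≠ 0) (hc0 : c ≠ 0) (hD : 0 ≤ D)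
    (hκ : 243*A^2*D^8 < |κ|) (S : Finset (ℤ×ℤ×ℤ)) (hS : ∀ p ∈ S, a*p.1^2+b*p.2.1^2+c*p.2.2^2 = κ)
    (hSD : ∀ p ∈ S, ∀ p' ∈ S, |p.1-p'.1| ≤ D ∧ |p.2.1-p'.2.1| ≤ D ∧ |p.2.2-p'.2.2| ≤ D) :
    (S.card : ℤ) ≤ 2*(2*D+1) := by
  rcases S.eq_empty_or_nonempty with rfl | ⟨p0, hp0⟩
  · simp; linarith
  have hS' : ∀ p ∈ S, a*(p0.1+(p.1-p0.1))^2+b*(p0.2.1+(p.2.1-p0.2.1))^2+c*(p0.2.2+(p.2.2-p0.2.2))^2 = κ := by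
    intro p hp; convert hS p hp using 1; ring
  obtain ⟨n1, n2, n3, hn0, hn⟩ : ∃ n1 n2 n3 : ℤ, ¬ (n1 = 0 ∧ n2 = 0 ∧ n3 = 0) ∧
      ∀ p ∈ S, n1*(p.1-p0.1)+n2*(p.2.1-p0.2.1)+n3*(p.2.2-p0.2.2) = 0 := by
    by_cases h : ∃ p ∈ S, ∃ p' ∈ S, ¬ ((p.2.1-p0.2.1)*(p'.2.2-p0.2.2)-(p'.2.1-p0.2.1)*(p.2.2-p0.2.2) = 0 ∧
       (p'.1-p0.1)*(p.2.2-p0.2.2) - (p.1-p0.1)*(p'.2.2-p0.2.2) = 0 ∧ (p.1-p0.1)*(p'.2.1-p0.2.1) - (p'.1-p0.1)*(p.2.1-p0.2.1) = 0)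
    · obtain ⟨p, hp, p', hp', hne⟩ := h
      refine ⟨_, _, _, hne, fun p'' hp'' => ?_⟩
      have := dependent ha hb hc ha0 hb0 hc0 (hS p0 hp0) (hS' p hp) (hS' p' hp') (hS' p'' hp'') (hSD p hp p0 hp0) (hSD p' hp' p0 hp0) (hSD p'' hp'' p0 hp0) hκ
      linear_combination this
    · push Not at h
      by_cases h1 : ∃ p ∈ S, p ≠ p0
      · obtain ⟨p, hp, hpne⟩ := h1
        by_cases hx : p.2.1-p0.2.1 = 0 ∧ p.2.2-p0.2.2 = 0
        · refine ⟨0, 1, 0, by simp, fun p' hp' => ?_⟩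
          have hx1 : p.1-p0.1 ≠ 0 := by
            intro hx1
            apply hpne
            refine Prod.ext (by linarith) (Prod.ext (by linarith [hx.1]) (by linarith [hx.2]))
          obtain ⟨-, -, k3⟩ := h p hp p' hp'
          rw [hx.1, mul_zero, sub_zero] at k3
          have := (mul_eq_zero.mp k3).resolve_left hx1
          linarith
        · refine ⟨0, p.2.2-p0.2.2, -(p.2.1-p0.2.1), by
            intro hh; apply hx; exact ⟨by linarith [hh.2.2], hh.2.1⟩, fun p' hp' => ?_⟩
          obtain ⟨k1, -, -⟩ := h p hp p' hp'
          linear_combination -k1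
      · push Not at h1
        refine ⟨1, 0, 0, by simp, fun p' hp' => ?_⟩
        rw [h1 p' hp']; ring
  have hn' : ∀ p ∈ S, ∀ p' ∈ S, n1*(p'.1-p.1)+n2*(p'.2.1-p.2.1)+n3*(p'.2.2-p.2.2) = 0 := by
    intro p hp p' hp'
    linear_combination hn p' hp' - hn p hp
  have hSS : ∀ p ∈ S, ∀ p' ∈ S, a*(p.1+(p'.1-p.1))^2+b*(p.2.1+(p'.2.1-p.2.1))^2+c*(p.2.2+(p'.2.2-p.2.2))^2 = κ := by
    intro p hp p' hp'; convert hS p' hp' using 1; ring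
  have fib : ∀ f : ℤ×ℤ×ℤ → ℤ, (∀ p ∈ S, |f p - f p0| ≤ D) →
      (∀ p ∈ S, ∀ p' ∈ S, ∀ p'' ∈ S, p' ≠ p → p'' ≠ p → p'' ≠ p' → f p' = f p → f p'' = f p → False) → (S.card:ℤ) ≤ 2*(2*D+1) := by
    intro f hf h3
    have h4 : S.card ≤ 2 * (S.image f).card := by
      refine Finset.card_le_mul_card_image S 2 fun v hv => ?_
      by_contra hlt
      push Not at hlt
      rw [Finset.two_lt_card] at hlt
      obtain ⟨p, hp, p', hp', p'', hp'', n1, n2, n3⟩ := hlt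
      rw [Finset.mem_filter] at hp hp' hp''
      exact h3 p hp.1 p' hp'.1 p'' hp''.1 n1.symm n2.symm n3.symm (by rw [hp'.2, hp.2]) (by rw [hp''.2, hp.2])
    have h5 : (S.image f) ⊆ Finset.Icc (f p0 - D) (f p0 + D) := by
      intro v hv
      obtain ⟨p, hp, rfl⟩ := Finset.mem_image.mp hv
      have := abs_le.mp (hf p hp)
      rw [Finset.mem_Icc]; constructor <;> linarith
    have h6 := Finset.card_le_card h5
    rw [Int.card_Icc] at h6
    have h7 : ((S.image f).card : ℤ) ≤ 2*D+1 := by omega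
    have : (S.card:ℤ) ≤ 2 * (S.image f).card := by exact_mod_cast h4
    linarith
  have ne3 : ∀ p p' : ℤ×ℤ×ℤ, p' ≠ p → ¬ (p'.1-p.1 = 0 ∧ p'.2.1-p.2.1 = 0 ∧ p'.2.2-p.2.2=0) := by
    intro p p' h hh
    exact h (Prod.ext (by linarith) (Prod.ext (by linarith) (by linarith)))
  have fin : ∀ p ∈ S, ∀ p' ∈ S, ∀ p'' ∈ S, p' ≠ p → p'' ≠ p' → ∀ r s : ℤ, r ≠ 0 → s ≠ 0 → r*(p'.1-p.1) = s*(p''.1-p.1) →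
     r*(p'.2.1-p.2.1) = s*(p''.2.1-p.2.1) → r*(p'.2.2-p.2.2) = s*(p''.2.2-p.2.2) → False := by
    intro p hp p' hp' p'' hp'' h1 h3 r s hr hs e1 e2 e3
    obtain ⟨f1, f2, f3⟩ := collin han (hS p hp) (hSS p hp p' hp') (hSS p hp p'' hp'') hr hs e1 e2 e3 (ne3 p p' h1)
    exact h3 (Prod.ext (by linarith) (Prod.ext (by linarith) (by linarith)))
  by_cases hn1 : n1 = 0
  · by_cases hn3 : n3 = 0
    · have hn2 : n2 ≠ 0 := fun h => hn0 ⟨hn1, h, hn3⟩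
      have hy : ∀ p ∈ S, ∀ p' ∈ S, p'.2.1 - p.2.1 = 0 := by
        intro p hp p' hp'
        have := hn' p hp p' hp'
        rw [hn1, hn3] at this
        have h2 : n2*(p'.2.1-p.2.1) = 0 := by linarith
        exact (mul_eq_zero.mp h2).resolve_left hn2
      refine fib (fun p => p.1) (fun p hp => (hSD p hp p0 hp0).1) fun p hp p' hp' p'' hp'' h1 h2 h3 e1 e2 => ?_
      have y1 := hy p hp p' hp'
      have y2 := hy p hp p'' hp''
      refine fin p hp p' hp' p'' hp'' h1 h3 (p''.2.2-p.2.2) (p'.2.2-p.2.2) ?_ ?_ (by rw [e1, e2]; ring) (by rw [y1, y2]; ring) (by ring)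
      · exact fun h => ne3 p p'' h2 ⟨by linarith, y2, h⟩
      · exact fun h => ne3 p p' h1 ⟨by linarith, y1, h⟩
    · refine fib (fun p => p.2.1) (fun p hp => (hSD p hp p0 hp0).2.1) fun p hp p' hp' p'' hp'' h1 h2 h3 e1 e2 => ?_
      have hz : ∀ p ∈ S, ∀ p' ∈ S, p'.2.1 = p.2.1 → p'.2.2 - p.2.2 = 0 := by
        intro p hp p' hp' e
        have := hn' p hp p' hp'
        rw [hn1, e] at this
        have h2 : n3*(p'.2.2-p.2.2) = 0 := by linarith
        exact (mul_eq_zero.mp h2).resolve_left hn3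
      have y1 := hz p hp p' hp' e1
      have y2 := hz p hp p'' hp'' e2
      refine fin p hp p' hp' p'' hp'' h1 h3 (p''.1-p.1) (p'.1-p.1) ?_ ?_ (by ring) (by rw [e1, e2]; ring) (by rw [y1, y2]; ring)
      · exact fun h => ne3 p p'' h2 ⟨h, by linarith, y2⟩
      · exact fun h => ne3 p p' h1 ⟨h, by linarith, y1⟩
  · refine fib (fun p => p.2.1) (fun p hp => (hSD p hp p0 hp0).2.1) fun p hp p' hp' p'' hp'' h1 h2 h3 e1 e2 => ?_
    have k1 := hn' p hp p' hp'
    have k2 := hn' p hp p'' hp''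
    have hz : ∀ p ∈ S, ∀ p' ∈ S, p' ≠ p → p'.2.1 = p.2.1 → p'.2.2 - p.2.2 ≠ 0 := by
      intro p hp p' hp' hne e hz
      have := hn' p hp p' hp'
      rw [e, hz] at this
      have h2 : n1*(p'.1-p.1) = 0 := by linarith
      exact ne3 p p' hne ⟨(mul_eq_zero.mp h2).resolve_left hn1, by linarith, hz⟩
    refine fin p hp p' hp' p'' hp'' h1 h3 (p''.2.2-p.2.2) (p'.2.2-p.2.2) (hz p hp p'' hp'' h2 e2) (hz p hp p' hp' h1 e1) ?_ (by rw [e1, e2]; ring) (by ring)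
    apply mul_left_cancel₀ hn1
    rw [e1] at k1; rw [e2] at k2
    linear_combination (p''.2.2-p.2.2)*k1 - (p'.2.2-p.2.2)*k2
theorem dom_bd {a b x y A : ℤ} (ha0 : a ≠ 0) (hb : |b| ≤ A) (h : |b| * y^2 ≤ |a| * x^2) (hx : 0 < x) : |b*y| ≤ A*(|a| * x) := by
  have hA : 0 ≤ A := (abs_nonneg _).trans hb
  have h1 := Int.one_le_abs ha0
  by_cases hb0 : b = 0
  · rw [hb0]; simp; positivity
  have hA1 : 1 ≤ A := (Int.one_le_abs hb0).trans hb
  apply abs_le_of_sq_le_sq _ (by positivity)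
  have e1 : (b*y)^2 = |b| * (|b| * y^2) := by rw [← mul_assoc, ← sq, sq_abs]; ring
  rw [e1]
  calc |b| * (|b| * y^2) ≤ A*(|a| * x^2) := by gcongr
    _ ≤ (A*A)*((|a| * |a|)*x^2) := by
      have : A ≤ A*A := by nlinarith
      have : |a| ≤ |a| * |a| := by nlinarith
      gcongr
    _ = _ := by ring
set_option maxHeartbeats 1000000 in
open Classical in
theorem partcount {a b c A L W κ : ℤ} (han : ∀ x y z : ℤ, a*x^2+b*y^2+c*z^2 = 0 → x = 0 ∧ y = 0 ∧ z = 0)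
    (ha : |a| ≤ A) (hb : |b| ≤ A) (hc : |c| ≤ A) (ha0 : a ≠ 0) (hb0 : b ≠ 0) (hc0 : c ≠ 0) (hL : 1 ≤ L) (hW : 0 ≤ W)
    (hκ : 243*A^2*(2*A*L)^8 < |κ|) (S : Finset (ℤ×ℤ×ℤ)) (hS : ∀ p ∈ S, a*p.1^2+b*p.2.1^2+c*p.2.2^2 = κ)
    (hSW : ∀ p ∈ S, |p.2.1| ≤ W ∧ |p.2.2| ≤ W)
    (hdom : ∀ p ∈ S, 0 < p.1 ∧ |b| * p.2.1^2 ≤ |a| * p.1^2 ∧ |c| * p.2.2^2 ≤ |a| * p.1^2) :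
    (S.card : ℤ) ≤ 40*A*L*(W/L+1)^2 := by
  have hA1 : 1 ≤ A := (Int.one_le_abs ha0).trans ha
  set f : ℤ×ℤ×ℤ → ℤ×ℤ := fun p => (p.2.1/L, p.2.2/L) with hf
  have hfl : ∀ y y' : ℤ, y/L = y'/L → |y-y'| ≤ L := by
    intro y y' h
    have h1 := Int.emod_add_mul_ediv y L
    have h2 := Int.emod_add_mul_ediv y' L
    have h3 := Int.emod_nonneg y (by omega : L ≠ 0)
    have h4 := Int.emod_lt_of_pos y (by omega : 0 < L)
    have h5 := Int.emod_nonneg y' (by omega : L ≠ 0)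
    have h6 := Int.emod_lt_of_pos y' (by omega : 0 < L)
    rw [h] at h1
    rw [abs_le]; constructor <;> linarith
  have h1 : S.card ≤ (2*(2*(2*A*L)+1)).toNat * (S.image f).card := by
    refine Finset.card_le_mul_card_image S _ fun v hv => ?_
    rw [← Int.ofNat_le, Int.toNat_of_nonneg (by positivity)]
    refine cellcount han ha hb hc ha0 hb0 hc0 (by positivity) hκ _ (fun p hp => hS p (Finset.mem_filter.mp hp).1) fun p hp p' hp' => ?_
    rw [Finset.mem_filter] at hp hp'
    have e := hp.2.trans hp'.2.symm
    simp only [hf, Prod.mk.injEq] at e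
    have d1 := hfl _ _ e.1
    have d2 := hfl _ _ e.2
    have hLL : L ≤ 2*A*L := by nlinarith
    refine ⟨?_, d1.trans hLL, d2.trans hLL⟩
    obtain ⟨x1, y1, z1⟩ := hdom p hp.1
    obtain ⟨x2, y2, z2⟩ := hdom p' hp'.1
    have m1 := dom_bd ha0 hb y1 x1
    have m2 := dom_bd ha0 hc z1 x1
    have m3 := dom_bd ha0 hb y2 x2
    have m4 := dom_bd ha0 hc z2 x2
    have key : a*((p.1-p'.1)*(p.1+p'.1)) = -((p.2.1-p'.2.1)*(b*p.2.1+b*p'.2.1) + (p.2.2-p'.2.2)*(c*p.2.2+c*p'.2.2)) := by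
      linear_combination hS p hp.1 - hS p' hp'.1
    have key2 : |a| * (|p.1-p'.1| * (p.1+p'.1)) ≤ L*(A*(|a| * p.1)+A*(|a| * p'.1)) + L*(A*(|a| * p.1)+A*(|a| * p'.1)) := by
      have : |a| * (|p.1-p'.1| * (p.1+p'.1)) = |a*((p.1-p'.1)*(p.1+p'.1))| := by
        rw [abs_mul, abs_mul, abs_of_pos (by linarith : 0 < p.1+p'.1)]
      rw [this, key, abs_neg]
      refine (abs_add_le _ _).trans (add_le_add ?_ ?_) <;> rw [abs_mul]
      · exact mul_le_mul d1 ((abs_add_le _ _).trans (add_le_add m1 m3)) (abs_nonneg _) (by omega)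
      · exact mul_le_mul d2 ((abs_add_le _ _).trans (add_le_add m2 m4)) (abs_nonneg _) (by omega)
    have key3 : (|a| * (p.1+p'.1)) * |p.1-p'.1| ≤ (|a| * (p.1+p'.1)) * (2*A*L) := by
      linarith
    exact le_of_mul_le_mul_left key3 (mul_pos (abs_pos.mpr ha0) (by linarith))
  have h2 : S.image f ⊆ Finset.Icc (-(W/L)-1) (W/L) ×ˢ Finset.Icc (-(W/L)-1) (W/L) := by
    intro v hv
    obtain ⟨p, hp, rfl⟩ := Finset.mem_image.mp hv
    have gen : ∀ y : ℤ, |y| ≤ W → y/L ∈ Finset.Icc (-(W/L)-1) (W/L) := by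
      intro y hy
      rw [abs_le] at hy
      rw [Finset.mem_Icc]
      refine ⟨?_, Int.ediv_le_ediv (by omega) hy.2⟩
      rw [Int.le_ediv_iff_mul_le (by omega)]
      have := Int.lt_ediv_add_one_mul_self W (by omega : 0 < L)
      linarith
    rw [Finset.mem_product]
    exact ⟨gen _ (hSW p hp).1, gen _ (hSW p hp).2⟩
  have h3 := Finset.card_le_card h2
  have hWL : 0 ≤ W/L := Int.ediv_nonneg hW (by omega)
  have h4 : ((S.image f).card : ℤ) ≤ (2*(W/L+1))*(2*(W/L+1)) := by
    refine (Int.ofNat_le.mpr h3).trans (le_of_eq ?_)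
    rw [Finset.card_product, Int.card_Icc, Nat.cast_mul, Int.toNat_of_nonneg (by linarith)]
    ring
  have h5 : (S.card:ℤ) ≤ (2*(2*(2*A*L)+1)) * (S.image f).card := by
    have := Int.ofNat_le.mpr h1
    rwa [Nat.cast_mul, Int.toNat_of_nonneg (by positivity)] at this
  have h6 : 2*(2*(2*A*L)+1) ≤ 10*(A*L) := by nlinarith
  calc (S.card:ℤ) ≤ _ := h5
    _ ≤ (10*(A*L)) * ((2*(W/L+1))*(2*(W/L+1))) := mul_le_mul h6 h4 (Int.natCast_nonneg _) (by positivity)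
    _ = _ := by ring
set_option maxHeartbeats 1000000 in
open Classical in
theorem tcount {a b c A L W κ : ℤ} (han : ∀ x y z : ℤ, a*x^2+b*y^2+c*z^2 = 0 → x = 0 ∧ y = 0 ∧ z = 0)
    (ha : |a| ≤ A) (hb : |b| ≤ A) (hc : |c| ≤ A) (ha0 : a ≠ 0) (hb0 : b ≠ 0) (hc0 : c ≠ 0) (hL : 1 ≤ L) (hW : 0 ≤ W)
    (hκ : 243*A^2*(2*A*L)^8 < |κ|) (S : Finset (ℤ×ℤ×ℤ)) (hS : ∀ p ∈ S, a*p.1^2+b*p.2.1^2+c*p.2.2^2 = κ)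
    (hSW : ∀ p ∈ S, |p.1| ≤ W ∧ |p.2.1| ≤ W ∧ |p.2.2| ≤ W) :
    (S.card : ℤ) ≤ 240*A*L*(W/L+1)^2 := by
  set D1 : ℤ×ℤ×ℤ → Prop := fun p => |b| * p.2.1^2 ≤ |a| * p.1^2 ∧ |c| * p.2.2^2 ≤ |a| * p.1^2 with hD1
  set D2 : ℤ×ℤ×ℤ → Prop := fun p => |a| * p.1^2 ≤ |b| * p.2.1^2 ∧ |c| * p.2.2^2 ≤ |b| * p.2.1^2 with hD2
  set D3 : ℤ×ℤ×ℤ → Prop := fun p => |a| * p.1^2 ≤ |c| * p.2.2^2 ∧ |b| * p.2.1^2 ≤ |c| * p.2.2^2 with hD3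
  have hκ0 : κ ≠ 0 := by
    intro h; rw [h, abs_zero] at hκ
    have : 0 ≤ A := (abs_nonneg _).trans ha
    have : 0 ≤ 243*A^2*(2*A*L)^8 := by positivity
    linarith
  have piece : ∀ (u v w : ℤ) (g : ℤ×ℤ×ℤ → ℤ×ℤ×ℤ) (P : ℤ×ℤ×ℤ → Prop), Function.Injective g →
      (∀ x y z : ℤ, u*x^2+v*y^2+w*z^2 = 0 → x = 0 ∧ y = 0 ∧ z = 0) → |u| ≤ A → |v| ≤ A → |w| ≤ A → u ≠ 0 → v ≠ 0 → w ≠ 0 →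
      (∀ p ∈ S, P p → u*(g p).1^2+v*(g p).2.1^2+w*(g p).2.2^2 = κ ∧ |(g p).2.1| ≤ W ∧ |(g p).2.2| ≤ W ∧
        0 < (g p).1 ∧ |v| * (g p).2.1^2 ≤ |u| * (g p).1^2 ∧ |w| * (g p).2.2^2 ≤ |u| * (g p).1^2) →
      ∃ T : Finset (ℤ×ℤ×ℤ), (∀ p ∈ S, P p → p ∈ T) ∧ (T.card : ℤ) ≤ 40*A*L*(W/L+1)^2 := by
    intro u v w g P hg han' h1 h2 h3 h4 h5 h6 hall
    refine ⟨S.filter P, fun p hp h => Finset.mem_filter.mpr ⟨hp, h⟩, ?_⟩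
    rw [← Finset.card_image_of_injective _ hg]
    refine partcount han' h1 h2 h3 h4 h5 h6 hL hW hκ _ ?_ ?_ ?_ <;> intro q hq <;>
      obtain ⟨p, hp, rfl⟩ := Finset.mem_image.mp hq <;> rw [Finset.mem_filter] at hp <;>
      obtain ⟨k1, k2, k3, k4⟩ := hall p hp.1 hp.2
    · exact k1
    · exact ⟨k2, k3⟩
    · exact k4
  have han2 : ∀ x y z : ℤ, b*x^2+a*y^2+c*z^2 = 0 → x = 0 ∧ y = 0 ∧ z = 0 := by
    intro x y z h
    obtain ⟨h1, h2, h3⟩ := han y x z (by linarith)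
    exact ⟨h2, h1, h3⟩
  have han3 : ∀ x y z : ℤ, c*x^2+b*y^2+a*z^2 = 0 → x = 0 ∧ y = 0 ∧ z = 0 := by
    intro x y z h
    obtain ⟨h1, h2, h3⟩ := han z y x (by linarith)
    exact ⟨h3, h2, h1⟩
  obtain ⟨T1, m1, q1⟩ := piece a b c (fun p => p) (fun p => D1 p ∧ 0 < p.1) (fun _ _ h => h) han ha hb hc ha0 hb0 hc0
    (fun p hp h => ⟨hS p hp, (hSW p hp).2.1, (hSW p hp).2.2, h.2, h.1.1, h.1.2⟩)
  obtain ⟨T2, m2, q2⟩ := piece a b c (fun p => (-p.1, p.2)) (fun p => D1 p ∧ p.1 < 0) (fun p p' h => by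
      simp only [Prod.mk.injEq, neg_inj] at h; exact Prod.ext h.1 h.2) han ha hb hc ha0 hb0 hc0
    (fun p hp h => ⟨by simp only [neg_sq]; exact hS p hp, (hSW p hp).2.1, (hSW p hp).2.2, by simpa using h.2, by simpa using h.1.1, by simpa using h.1.2⟩)
  obtain ⟨T3, m3, q3⟩ := piece b a c (fun p => (p.2.1, p.1, p.2.2)) (fun p => D2 p ∧ 0 < p.2.1) (fun p p' h => by
      simp only [Prod.mk.injEq] at h; exact Prod.ext h.2.1 (Prod.ext h.1 h.2.2)) han2 hb ha hc hb0 ha0 hc0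
    (fun p hp h => ⟨by simp only; linarith [hS p hp], (hSW p hp).1, (hSW p hp).2.2, h.2, h.1.1, h.1.2⟩)
  obtain ⟨T4, m4, q4⟩ := piece b a c (fun p => (-p.2.1, p.1, p.2.2)) (fun p => D2 p ∧ p.2.1 < 0) (fun p p' h => by
      simp only [Prod.mk.injEq, neg_inj] at h; exact Prod.ext h.2.1 (Prod.ext h.1 h.2.2)) han2 hb ha hc hb0 ha0 hc0
    (fun p hp h => ⟨by simp only [neg_sq]; linarith [hS p hp], (hSW p hp).1, (hSW p hp).2.2, by simpa using h.2, by simpa using h.1.1, by simpa using h.1.2⟩)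
  obtain ⟨T5, m5, q5⟩ := piece c b a (fun p => (p.2.2, p.2.1, p.1)) (fun p => D3 p ∧ 0 < p.2.2) (fun p p' h => by
      simp only [Prod.mk.injEq] at h; exact Prod.ext h.2.2 (Prod.ext h.2.1 h.1)) han3 hc hb ha hc0 hb0 ha0
    (fun p hp h => ⟨by simp only; linarith [hS p hp], (hSW p hp).2.1, (hSW p hp).1, h.2, h.1.2, h.1.1⟩)
  obtain ⟨T6, m6, q6⟩ := piece c b a (fun p => (-p.2.2, p.2.1, p.1)) (fun p => D3 p ∧ p.2.2 < 0) (fun p p' h => by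
      simp only [Prod.mk.injEq, neg_inj] at h; exact Prod.ext h.2.2 (Prod.ext h.2.1 h.1)) han3 hc hb ha hc0 hb0 ha0
    (fun p hp h => ⟨by simp only [neg_sq]; linarith [hS p hp], (hSW p hp).2.1, (hSW p hp).1, by simpa using h.2, by simpa using h.1.2, by simpa using h.1.1⟩)
  have hcov : S ⊆ T1 ∪ (T2 ∪ (T3 ∪ (T4 ∪ (T5 ∪ T6)))) := by
    intro p hp
    simp only [Finset.mem_union]
    have hz : ∀ u : ℤ, u = 0 → ∀ e y : ℤ, e ≠ 0 → |e| * y^2 ≤ |u| → y = 0 := by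
      intro u hu e y he h
      rw [hu, abs_zero] at h
      have := abs_pos.mpr he
      by_contra hy
      have : 0 < |e| * y^2 := by positivity
      linarith
    have hne : ¬ (p.1 = 0 ∧ p.2.1 = 0 ∧ p.2.2 = 0) := by
      rintro ⟨h1, h2, h3⟩
      have := hS p hp
      rw [h1, h2, h3] at this
      apply hκ0; rw [← this]; ring
    have main : D1 p ∨ D2 p ∨ D3 p := by
      simp only [hD1, hD2, hD3]
      rcases le_total (|a| * p.1^2) (|b| * p.2.1^2) with h | h <;>
      rcases le_total (|a| * p.1^2) (|c| * p.2.2^2) with h' | h' <;>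
      rcases le_total (|c| * p.2.2^2) (|b| * p.2.1^2) with h'' | h'' <;>
      first
        | exact Or.inl ⟨by assumption, by assumption⟩
        | exact Or.inr (Or.inl ⟨by assumption, by assumption⟩)
        | exact Or.inr (Or.inr ⟨by assumption, by assumption⟩)
        | exact Or.inr (Or.inl ⟨by linarith, by linarith⟩)
        | exact Or.inl ⟨by linarith, by linarith⟩
    rcases main with h | h | h
    · rcases lt_trichotomy p.1 0 with h' | h' | h'
      · exact Or.inr (Or.inl (m2 p hp ⟨h, h'⟩))
      · exfalso
        simp only [hD1, h'] at h
        exact hne ⟨h', hz 0 rfl b _ hb0 (by simpa using h.1), hz 0 rfl c _ hc0 (by simpa using h.2)⟩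
      · exact Or.inl (m1 p hp ⟨h, h'⟩)
    · rcases lt_trichotomy p.2.1 0 with h' | h' | h'
      · exact Or.inr (Or.inr (Or.inr (Or.inl (m4 p hp ⟨h, h'⟩))))
      · exfalso
        simp only [hD2, h'] at h
        exact hne ⟨hz 0 rfl a _ ha0 (by simpa using h.1), h', hz 0 rfl c _ hc0 (by simpa using h.2)⟩
      · exact Or.inr (Or.inr (Or.inl (m3 p hp ⟨h, h'⟩)))
    · rcases lt_trichotomy p.2.2 0 with h' | h' | h'
      · exact Or.inr (Or.inr (Or.inr (Or.inr (Or.inr (m6 p hp ⟨h, h'⟩)))))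
      · exfalso
        simp only [hD3, h'] at h
        exact hne ⟨hz 0 rfl a _ ha0 (by simpa using h.1), hz 0 rfl b _ hb0 (by simpa using h.2), h'⟩
      · exact Or.inr (Or.inr (Or.inr (Or.inr (Or.inl (m5 p hp ⟨h, h'⟩)))))
  have hcard := (Finset.card_le_card hcov).trans ((Finset.card_union_le _ _).trans (Nat.add_le_add_left ((Finset.card_union_le _ _).trans (Nat.add_le_add_left ((Finset.card_union_le _ _).trans (Nat.add_le_add_left ((Finset.card_union_le _ _).trans (Nat.add_le_add_left (Finset.card_union_le _ _) _)) _)) _)) _))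
  have hcard' := Int.ofNat_le.mpr hcard
  push_cast at hcard'
  linarith
section Spectral
variable {G Ω ι : Type*} [Group G] [Fintype G] [Fintype Ω] [DecidableEq Ω] [MulAction G Ω] [Fintype ι]
theorem two_trans_identity (h2 : ∀ a b a' b' : Ω, a ≠ b → a' ≠ b' → ∃ g : G, g • a = a' ∧ g • b = b')
    (f h : Ω → ℝ) (hf : ∑ ω, f ω = 0) (hh : ∑ ω, h ω = 0) :
    ((Fintype.card Ω : ℝ) - 1) * ∑ g : G, (∑ ω, f (g • ω) * h ω)^2 = Fintype.card G * (∑ ω, f ω ^2) * ∑ ω, h ω ^2 := by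
  classical
  set Φ : Ω → Ω → ℝ := fun a b => ∑ g : G, f (g • a) * f (g • b) with hΦ
  have hinv : ∀ (g0 : G) a b, Φ (g0 • a) (g0 • b) = Φ a b := by
    intro g0 a b
    simp only [hΦ, ← mul_smul]
    exact Fintype.sum_equiv (Equiv.mulRight g0) _ _ (fun g => rfl)
  have hsumg : ∀ (g : G) (F : Ω → ℝ), ∑ ω, F (g • ω) = ∑ ω, F ω := fun g F =>
    Fintype.sum_equiv (MulAction.toPerm g) _ _ (fun ω => rfl)
  have hrow : ∀ a, ∑ b, Φ a b = 0 := by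
    intro a
    simp only [hΦ]
    rw [Finset.sum_comm]
    apply Finset.sum_eq_zero; intro g _
    rw [← Finset.mul_sum, hsumg g f, hf, mul_zero]
  have hdiag : ∑ a, Φ a a = Fintype.card G * ∑ ω, f ω^2 := by
    simp only [hΦ]
    rw [Finset.sum_comm]
    have : ∀ g : G, ∑ a, f (g • a) * f (g • a) = ∑ ω, f ω^2 := fun g => by
      rw [← hsumg g (fun ω => f ω^2)]; simp only [sq]
    simp [this]
  obtain ⟨c, hc⟩ : ∃ c, ∀ a b, a ≠ b → Φ a b = c := by
    by_cases hex : ∃ a b : Ω, a ≠ b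
    · obtain ⟨a, b, hab⟩ := hex
      refine ⟨Φ a b, fun a' b' h' => ?_⟩
      obtain ⟨g, rfl, rfl⟩ := h2 a b a' b' hab h'
      exact hinv g a b
    · exact ⟨0, fun a b h => absurd ⟨a, b, h⟩ hex⟩
  have hd : ∀ a, Φ a a = - ((Fintype.card Ω : ℝ) - 1) * c := by
    intro a
    have h1 := hrow a
    rw [← Finset.add_sum_erase _ _ (Finset.mem_univ a), Finset.sum_congr rfl (g := fun _ => c)
      (fun b hb => hc a b (Finset.ne_of_mem_erase hb).symm)] at h1
    rw [Finset.sum_const, Finset.card_erase_of_mem (Finset.mem_univ a), nsmul_eq_mul, Nat.cast_sub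
      (Finset.card_pos.mpr ⟨a, Finset.mem_univ a⟩), Finset.card_univ] at h1
    push_cast at h1; linarith
  have hexp : ∑ g : G, (∑ ω, f (g • ω) * h ω)^2 = ∑ a, ∑ b, h a * h b * Φ a b := by
    have : ∀ g : G, (∑ ω, f (g • ω) * h ω)^2 = ∑ a, ∑ b, h a * h b * (f (g • a) * f (g • b)) := by
      intro g
      rw [sq, Finset.sum_mul_sum]
      exact Finset.sum_congr rfl fun a _ => Finset.sum_congr rfl fun b _ => by ring
    simp only [this, hΦ, Finset.mul_sum]
    rw [Finset.sum_comm]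
    refine Finset.sum_congr rfl fun a _ => ?_
    rw [Finset.sum_comm]
  have hPhi : ∀ a b, Φ a b = c + (if a = b then -(Fintype.card Ω : ℝ) * c else 0) := by
    intro a b
    split_ifs with hab
    · subst hab; rw [hd]; ring
    · rw [hc a b hab]; ring
  have h3 : ∑ a, ∑ b, h a * h b * Φ a b = -(Fintype.card Ω : ℝ) * c * ∑ ω, h ω^2 := by
    have : ∀ a, ∑ b, h a * h b * Φ a b = -(Fintype.card Ω : ℝ) * c * h a ^2 := by
      intro a
      have : ∀ b, h a * h b * Φ a b = (h a * c) * h b + (if a = b then h a * h b * (-(Fintype.card Ω : ℝ) * c) else 0) := by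
        intro b; rw [hPhi]; split_ifs <;> ring
      simp only [this]
      rw [Finset.sum_add_distrib, ← Finset.mul_sum, hh, Finset.sum_ite_eq]
      simp; ring
    simp only [this, ← Finset.mul_sum]
  rw [hexp, h3]
  have h4 : Fintype.card G * ∑ ω, f ω^2 = (Fintype.card Ω : ℝ) * (- ((Fintype.card Ω : ℝ) - 1) * c) := by
    rw [← hdiag]; simp [hd]
  rw [h4]; ring
open Classical in
noncomputable def coin (γ : ι → G) : ℕ := (Finset.univ.filter fun p : ι × ι => γ p.1 = γ p.2).card
theorem op_bound (h2 : ∀ a b a' b' : Ω, a ≠ b → a' ≠ b' → ∃ g : G, g • a = a' ∧ g • b = b')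
    (hΩ : 2 ≤ Fintype.card Ω) (γ : ι → G) (f : Ω → ℝ) (hf : ∑ ω, f ω = 0) :
    ((Fintype.card Ω : ℝ) - 1) * ∑ ω, (∑ i, f (γ i • ω))^2 ≤ (coin γ * Fintype.card G : ℝ) * ∑ ω, f ω^2 := by
  classical
  have hΩ' : (1:ℝ) ≤ (Fintype.card Ω : ℝ) - 1 := by
    have : (2:ℝ) ≤ Fintype.card Ω := by exact_mod_cast hΩ
    linarith
  set h : Ω → ℝ := fun ω => ∑ i, f (γ i • ω) with hh
  have hsumg : ∀ (g : G) (F : Ω → ℝ), ∑ ω, F (g • ω) = ∑ ω, F ω := fun g F =>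
    Fintype.sum_equiv (MulAction.toPerm g) _ _ (fun ω => rfl)
  have hh0 : ∑ ω, h ω = 0 := by
    simp only [hh]; rw [Finset.sum_comm]; apply Finset.sum_eq_zero; intro i _; rw [hsumg, hf]
  have hid := two_trans_identity h2 f h hf hh0
  set m : G → ℝ := fun g => ∑ i, if γ i = g then 1 else 0 with hm
  have hfib : ∀ F : G → ℝ, ∑ g, m g * F g = ∑ i, F (γ i) := by
    intro F
    simp only [hm, Finset.sum_mul]
    rw [Finset.sum_comm]
    refine Finset.sum_congr rfl fun i _ => ?_
    simp [ite_mul]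
  have hm2 : ∑ g, m g^2 = coin γ := by
    simp only [sq]; rw [hfib m]
    simp only [hm, coin, Finset.card_filter, Fintype.sum_prod_type]
    push_cast
    exact Finset.sum_congr rfl fun i _ => Finset.sum_congr rfl fun j _ => by simp [eq_comm]
  have hn : ∑ ω, h ω^2 = ∑ g, m g * ∑ ω, f (g • ω) * h ω := by
    rw [hfib]
    rw [Finset.sum_comm]
    refine Finset.sum_congr rfl fun ω _ => ?_
    rw [sq, ← Finset.sum_mul]
  have hcs := Finset.sum_mul_sq_le_sq_mul_sq Finset.univ m (fun g => ∑ ω, f (g • ω) * h ω)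
  rw [← hn, hm2] at hcs
  rcases eq_or_lt_of_le (Finset.sum_nonneg fun ω (_ : ω ∈ Finset.univ) => sq_nonneg (h ω)) with h0 | h0
  · rw [← h0, mul_zero]
    have : 0 ≤ ∑ ω, f ω^2 := Finset.sum_nonneg fun ω _ => sq_nonneg _
    positivity
  · apply le_of_mul_le_mul_right _ h0
    calc _ = ((Fintype.card Ω : ℝ) - 1) * (∑ ω, h ω^2)^2 := by ring
      _ ≤ ((Fintype.card Ω : ℝ) - 1) * (coin γ * ∑ g : G, (∑ ω, f (g • ω) * h ω)^2) := by gcongr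
      _ = coin γ * (((Fintype.card Ω : ℝ) - 1) * ∑ g : G, (∑ ω, f (g • ω) * h ω)^2) := by ring
      _ = _ := by rw [hid]; ring
theorem expander (h2 : ∀ a b a' b' : Ω, a ≠ b → a' ≠ b' → ∃ g : G, g • a = a' ∧ g • b = b')
    (hΩ : 2 ≤ Fintype.card Ω) (γ : ι → G) (k : ℕ)
    (hk : ((coin γ * Fintype.card G : ℕ) : ℝ)^k * (Fintype.card Ω : ℝ)^2 < ((Fintype.card ι : ℝ)^2 * ((Fintype.card Ω : ℝ) - 1))^k)
    (c c' : Ω) : ∃ l : List ι, l.length = k ∧ (l.map γ).prod • c = c' := by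
  by_contra hno
  push Not at hno
  have hΩ' : (1:ℝ) ≤ (Fintype.card Ω : ℝ) - 1 := by
    have : (2:ℝ) ≤ Fintype.card Ω := by exact_mod_cast hΩ
    linarith
  set T : (Ω → ℝ) → Ω → ℝ := fun f ω => ∑ i, f (γ i • ω) with hT
  set e : Ω → ℝ := fun ω => (if ω = c' then 1 else 0) - 1/(Fintype.card Ω : ℝ) with he
  have he0 : ∑ ω, e ω = 0 := by
    simp only [he]; rw [Finset.sum_sub_distrib]; simp
    rw [mul_inv_cancel₀ (by linarith), sub_self]
  have hsumg : ∀ (g : G) (F : Ω → ℝ), ∑ ω, F (g • ω) = ∑ ω, F ω := fun g F =>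
    Fintype.sum_equiv (MulAction.toPerm g) _ _ (fun ω => rfl)
  have hit : ∀ n, ∑ ω, (T^[n] e) ω = 0 ∧ ((Fintype.card Ω : ℝ) - 1)^n * ∑ ω, (T^[n] e) ω^2 ≤ ((coin γ * Fintype.card G : ℕ) : ℝ)^n * ∑ ω, e ω^2 := by
    intro n
    induction n with
    | zero => simp [he0]
    | succ n ih =>
      rw [Function.iterate_succ_apply']
      refine ⟨?_, ?_⟩
      · simp only [hT]; rw [Finset.sum_comm]; apply Finset.sum_eq_zero; intro i _; rw [hsumg]; exact ih.1
      · have := op_bound h2 hΩ γ _ ih.1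
        calc _ = ((Fintype.card Ω : ℝ) - 1)^n * (((Fintype.card Ω : ℝ) - 1) * ∑ ω, (T (T^[n] e) ω)^2) := by ring
          _ ≤ ((Fintype.card Ω : ℝ) - 1)^n * ((coin γ * Fintype.card G : ℝ) * ∑ ω, (T^[n] e) ω^2) := by gcongr
          _ = (coin γ * Fintype.card G : ℝ) * (((Fintype.card Ω : ℝ) - 1)^n * ∑ ω, (T^[n] e) ω^2) := by ring
          _ ≤ (coin γ * Fintype.card G : ℝ) * (((coin γ * Fintype.card G : ℕ) : ℝ)^n * ∑ ω, e ω^2) := mul_le_mul_of_nonneg_left ih.2 (by positivity)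
          _ = _ := by push_cast; ring
  have hval : ∀ n (ω : Ω), (∀ l : List ι, l.length = n → (l.map γ).prod • ω ≠ c') → (T^[n] e) ω = - (Fintype.card ι : ℝ)^n / Fintype.card Ω := by
    intro n
    induction n with
    | zero =>
      intro ω h
      have : ω ≠ c' := by simpa using h [] rfl
      simp [he, this, neg_div]
    | succ n ih =>
      intro ω h
      rw [Function.iterate_succ_apply']
      have : ∀ i, (T^[n] e) (γ i • ω) = - (Fintype.card ι : ℝ)^n / Fintype.card Ω := by
        intro i
        apply ih
        intro l hl
        have := h (l ++ [i]) (by simp [hl])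
        simpa [mul_smul] using this
      show ∑ i, (T^[n] e) (γ i • ω) = _
      simp only [this]; simp; ring
  have hv := hval k c hno
  have hb := (hit k).2
  have he1 : ∑ ω, e ω^2 ≤ 1 := by
    have : ∀ ω, e ω^2 = (if ω = c' then 1 else 0) - 2/(Fintype.card Ω : ℝ) * (if ω = c' then 1 else 0) + 1/(Fintype.card Ω : ℝ)^2 := by
      intro ω; simp only [he]; split_ifs <;> field_simp <;> ring
    simp only [this]
    rw [Finset.sum_add_distrib, Finset.sum_sub_distrib, ← Finset.mul_sum]
    simp
    field_simp
    linarith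
  have h1 : (T^[k] e) c^2 ≤ ∑ ω, (T^[k] e) ω^2 := Finset.single_le_sum (f := fun ω => (T^[k] e) ω^2) (fun ω _ => sq_nonneg _) (Finset.mem_univ c)
  rw [hv] at h1
  have h2 : ((Fintype.card Ω : ℝ) - 1)^k * (- (Fintype.card ι : ℝ)^k / Fintype.card Ω)^2 ≤ ((coin γ * Fintype.card G : ℕ) : ℝ)^k * 1 := by
    calc _ ≤ ((Fintype.card Ω : ℝ) - 1)^k * ∑ ω, (T^[k] e) ω^2 := by gcongr
      _ ≤ _ := hb
      _ ≤ _ := by gcongr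
  have h3 := mul_le_mul_of_nonneg_right h2 (sq_nonneg (Fintype.card Ω : ℝ))
  have : ((Fintype.card Ω : ℝ) - 1)^k * (- (Fintype.card ι : ℝ)^k / Fintype.card Ω)^2 * (Fintype.card Ω : ℝ)^2 = ((Fintype.card ι : ℝ)^2 * ((Fintype.card Ω : ℝ) - 1))^k := by
    field_simp
    rw [mul_pow, ← pow_mul, ← pow_mul, mul_comm 2 k]
  rw [this] at h3
  linarith
end Spectral
section SL
open Matrix
variable {F : Type*} [Field F] [Fintype F] [DecidableEq F]
theorem card_SL2 : Fintype.card (SpecialLinearGroup (Fin 2) F) ≤ 2 * Fintype.card F ^ 3 := by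
  have : Function.Injective (fun g : SpecialLinearGroup (Fin 2) F => (g.1 1 0, g.1 0 1, (if g.1 0 0 = 0 then g.1 1 1 else g.1 0 0), decide (g.1 0 0 = 0))) := by
    intro g h e
    simp only [Prod.mk.injEq, decide_eq_decide] at e
    obtain ⟨e1, e2, e3, e4⟩ := e
    have dg := g.2; have dh := h.2
    rw [Matrix.det_fin_two] at dg dh
    apply Subtype.ext
    ext i j
    by_cases hg : g.1 0 0 = 0
    · have hh := e4.mp hg
      rw [if_pos hg, if_pos hh] at e3
      fin_cases i <;> fin_cases j <;> simp_all
    · have hh := fun t => hg (e4.mpr t)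
      rw [if_neg hg, if_neg hh] at e3
      have : g.1 1 1 = h.1 1 1 := by
        apply mul_left_cancel₀ hg
        rw [e1, e2, e3] at dg
        rw [e3]
        linear_combination dg - dh
      fin_cases i <;> fin_cases j <;> simp_all
  have := Fintype.card_le_of_injective _ this
  simp only [Fintype.card_prod, Fintype.card_bool] at this
  linarith [this, show Fintype.card F * (Fintype.card F * (Fintype.card F * 2)) = 2 * Fintype.card F^3 by ring]
open scoped LinearAlgebra.Projectivization in
theorem SL2_two_trans (a b a' b' : ℙ F (Fin 2 → F)) (h : a ≠ b) (h' : a' ≠ b') :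
    ∃ g : SpecialLinearGroup (Fin 2) F, g • a = a' ∧ g • b = b' := by
  have h2 := Projectivization.specialLinearGroup_is_two_pretransitive F (Fin 2 → F)
  rw [MulAction.is_two_pretransitive_iff] at h2
  obtain ⟨g, h1, h2⟩ := h2 h h'
  refine ⟨(Matrix.SpecialLinearGroup.toLin'_equiv (n := Fin 2) (R := F)).symm g, ?_, ?_⟩
  · rw [Projectivization.matrixSpecialLinearGroup_smul_def]; simpa using h1
  · rw [Projectivization.matrixSpecialLinearGroup_smul_def]; simpa using h2
open scoped LinearAlgebra.Projectivization in
theorem expander_SL2 {ι : Type*} [Fintype ι] (γ : ι → SpecialLinearGroup (Fin 2) F) (k : ℕ)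
    (hk : ((coin γ : ℝ) * (2 * (Fintype.card F : ℝ)^3))^k * ((Fintype.card F : ℝ)+1)^2 < ((Fintype.card ι : ℝ)^2 * (Fintype.card F : ℝ))^k)
    (c c' : Fin 2 → F) (hc : c ≠ 0) (hc' : c' ≠ 0) : ∃ l : List ι, l.length = k ∧ ∃ r : F, (l.map γ).prod.1 *ᵥ c = r • c' := by
  classical
  have hfin : Finite (ℙ F (Fin 2 → F)) := inferInstance
  have := Fintype.ofFinite (ℙ F (Fin 2 → F))
  have hcard : Fintype.card (ℙ F (Fin 2 → F)) = Fintype.card F + 1 := by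
    have := Projectivization.card_of_finrank_two F (Fin 2 → F) (by simp)
    rwa [Nat.card_eq_fintype_card, Nat.card_eq_fintype_card] at this
  have hF : 1 ≤ Fintype.card F := Fintype.card_pos
  obtain ⟨l, hl, h⟩ := expander (Ω := ℙ F (Fin 2 → F)) SL2_two_trans (by omega) γ k (by
    rw [hcard]; push_cast
    refine lt_of_le_of_lt ?_ (lt_of_lt_of_le hk (le_of_eq ?_))
    · have : (Fintype.card (SpecialLinearGroup (Fin 2) F) : ℝ) ≤ 2 * (Fintype.card F : ℝ)^3 := by exact_mod_cast card_SL2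
      gcongr
    · ring_nf) (Projectivization.mk F c hc) (Projectivization.mk F c' hc')
  refine ⟨l, hl, ?_⟩
  rw [Projectivization.smul_mk, Projectivization.mk_eq_mk_iff] at h
  obtain ⟨a, ha⟩ := h
  exact ⟨a, ha.symm⟩
end SL
section
open Matrix
section phi
variable {F : Type*} [Field F] {α β : ℤ}
def phi (p q : F) (x : HA ℤ α β) : Matrix (Fin 2) (Fin 2) F :=
  !![(x.re:F) + p*x.imJ + α*q*x.imK, α*x.imI - α*q*x.imJ - α*p*x.imK; x.imI + q*x.imJ + p*x.imK, x.re - p*x.imJ - α*q*x.imK]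
theorem phi_mul {p q : F} (h : p^2 - α*q^2 = β) (x y : HA ℤ α β) : phi p q (x*y) = phi p q x * phi p q y := by
  ext i j
  fin_cases i <;> fin_cases j <;>
    simp [phi, Matrix.mul_apply, Fin.sum_univ_two] <;> rw [← h] <;> ring
theorem phi_sub {p q : F} (x y : HA ℤ α β) : phi p q (x-y) = phi p q x - phi p q y := by
  ext i j
  fin_cases i <;> fin_cases j <;> simp [phi] <;> ring
theorem phi_one {p q : F} : phi p q (1 : HA ℤ α β) = 1 := by
  ext i j
  fin_cases i <;> fin_cases j <;> simp [phi]
theorem phi_smul {p q : F} (r : ℤ) (x : HA ℤ α β) : phi p q (r • x) = (r:F) • phi p q x := by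
  ext i j
  fin_cases i <;> fin_cases j <;> simp [phi] <;> ring
theorem phi_det {p q : F} (h : p^2 - α*q^2 = β) (x : HA ℤ α β) : (phi p q x).det = ((nrd x : ℤ) : F) := by
  simp only [phi, Matrix.det_fin_two_of, nrd]
  push_cast; rw [← h]; ring
theorem phi_eq_zero {p q : F} (h : p^2 - α*q^2 = β) (h2 : (2:F) ≠ 0) (hα : (α:F) ≠ 0) (hβ : (β:F) ≠ 0) (x : HA ℤ α β)
    (hx : phi p q x = 0) : (x.re:F) = 0 ∧ (x.imI:F) = 0 ∧ (x.imJ:F) = 0 ∧ (x.imK:F) = 0 := by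
  have h00 := congrFun (congrFun hx 0) 0
  have h01 := congrFun (congrFun hx 0) 1
  have h10 := congrFun (congrFun hx 1) 0
  have h11 := congrFun (congrFun hx 1) 1
  simp [phi] at h00 h01 h10 h11
  have e0 : (x.re:F) = 0 := mul_left_cancel₀ h2 (by linear_combination h00 + h11)
  have e1 : (x.imI:F) = 0 := by
    apply mul_left_cancel₀ (mul_ne_zero h2 hα)
    linear_combination h01 + α*h10
  rw [e0] at h00
  rw [e1] at h10
  refine ⟨e0, e1, ?_, ?_⟩
  · apply mul_left_cancel₀ hβ
    rw [← h]
    linear_combination p * h00 - α*q*h10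
  · apply mul_left_cancel₀ hβ
    rw [← h]
    linear_combination p * h10 - q * h00
end phi
theorem exists_pq {ℓ : ℕ} [Fact ℓ.Prime] (h2 : 2 < ℓ) (α β : ℤ) (hα : (α : ZMod ℓ) ≠ 0) : ∃ p q : ZMod ℓ, p^2 - α*q^2 = β := by
  have := FiniteField.exists_root_sum_quadratic (R := ZMod ℓ) (f := Polynomial.X^2) (g := Polynomial.C (-(α : ZMod ℓ)) * Polynomial.X^2 + Polynomial.C (-(β : ZMod ℓ)))
    (by rw [Polynomial.degree_X_pow]; norm_num) (by
      have : Polynomial.C (-(α : ZMod ℓ)) * Polynomial.X^2 + Polynomial.C (-(β : ZMod ℓ)) = Polynomial.C (-(α : ZMod ℓ)) * Polynomial.X^2 + Polynomial.C 0 * Polynomial.X + Polynomial.C (-(β : ZMod ℓ)) := by simp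
      rw [this]
      exact Polynomial.degree_quadratic (neg_ne_zero.mpr hα)) (by
      rw [ZMod.card]
      have := (Fact.out : ℓ.Prime).eq_two_or_odd
      omega)
  obtain ⟨a, b, h⟩ := this
  simp at h
  exact ⟨a, b, by linear_combination h⟩
set_option maxHeartbeats 1000000 in
open Classical in
theorem shift_count {α β B ℓ u n0 : ℤ} (hB : 2 ≤ B) (hα1 : 1 ≤ α) (hβ1 : 1 ≤ β) (hα : α ≤ B) (hβ : β ≤ B) (han : Aniso α β)
    (hu : B^5 ≤ u) (hℓ : u^24 ≤ ℓ) (hn0 : |n0| ≤ 8*B^2) (X : Finset (HA ℤ α β)) (hX : ∀ x ∈ X, nrd x = n0 ∧ bd x (3*B*(ℓ*u)))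
    (y : HA ℤ α β) (hy0 : y ≠ 0) (hy : bd y (6*B*u)) :
    ((X.filter fun x => x + ℓ • y ∈ X).card : ℤ) * u ≤ 240*145^2*B^10*ℓ^2 := by
  have hB5 : 2^5 ≤ B^5 := by gcongr
  have hu1 : 1 ≤ u := by linarith
  have hB5' : B ≤ B^5 := le_self_pow₀ (by omega) (by norm_num)
  have hBu : B ≤ u := hB5'.trans hu
  have hu24 : u ≤ u^24 := le_self_pow₀ hu1 (by norm_num)
  have hℓ0 : 0 < ℓ := by linarith
  have hBa : |α| ≤ B := by rw [abs_of_pos (by omega)]; exact hα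
  have hBb : |β| ≤ B := by rw [abs_of_pos (by omega)]; exact hβ
  set ny := nrd y with hny
  have hny0 : ny ≠ 0 := fun h => hy0 (han y h)
  set κ := ny*(4*n0-ℓ^2*ny) with hκ
  have hℓB : 64*B^2 ≤ ℓ^2 := by
    have h3 : 32*B ≤ ℓ := by
      have : u^6 ≤ u^24 := pow_le_pow_right₀ hu1 (by norm_num)
      have : B^6 ≤ u^6 := by gcongr
      have : B^6 = B^5*B := by ring
      have : 2^5*B ≤ B^5*B := by gcongr
      linarith
    nlinarith
  have hκl : ℓ^2 ≤ 2*|κ| := by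
    have h1 : 1 ≤ |ny| := Int.one_le_abs hny0
    have h2 : ℓ^2*|ny| - 32*B^2 ≤ |4*n0-ℓ^2*ny| := by
      have h3 := abs_sub_abs_le_abs_sub (ℓ^2*ny) (4*n0)
      rw [abs_mul, abs_mul, abs_of_nonneg (sq_nonneg ℓ), abs_sub_comm, show |(4:ℤ)| = 4 by norm_num] at h3
      linarith
    have h3 : ℓ^2 - 32*B^2 ≤ |4*n0-ℓ^2*ny| := by nlinarith [sq_nonneg ℓ]
    rw [hκ, abs_mul]
    nlinarith [abs_nonneg (4*n0-ℓ^2*ny)]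
  set S := (X.filter fun x => x + ℓ • y ∈ X) with hS
  set ξ : HA ℤ α β → HA ℤ α β := fun x => (x + (x + ℓ•y)) * star y with hξ
  set g : HA ℤ α β → ℤ×ℤ×ℤ := fun x => ((ξ x).imI, (ξ x).imJ, (ξ x).imK) with hg
  have hξS : ∀ x ∈ S, (ξ x).re = 0 ∧ nrd (ξ x) = κ ∧ bd (ξ x) (144*B^4*ℓ*u^2) := by
    intro x hx
    rw [hS, Finset.mem_filter] at hx
    have n1 := (hX x hx.1).1
    have n2 := (hX _ hx.2).1
    have b1 := (hX x hx.1).2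
    have b2 := (hX _ hx.2).2
    have hre : (ξ x).re = 0 := by
      have : ℓ * (ξ x).re = nrd (x + ℓ•y) - nrd x := by
        simp only [hξ, nrd]; simp; ring
      rw [n1, n2, sub_self] at this
      exact (mul_eq_zero.mp this).resolve_left hℓ0.ne'
    refine ⟨hre, ?_, ?_⟩
    · have h1 : nrd (x + (x + ℓ•y)) = 2*n0 + 2*n0 - ℓ^2*ny := by
        have : nrd (x + (x + ℓ•y)) = 2 * nrd x + 2 * nrd (x + ℓ•y) - ℓ^2 * nrd y := by
          simp only [nrd]; simp; ring
        rw [this, n1, n2]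
      simp only [hξ]
      rw [nrd_mul, nrd_star, h1, hκ]; ring
    · have := (b1.add b2).mul (by omega) hBa hBb hy.star
      refine this.mono (le_of_eq ?_); ring
  have hinj : Set.InjOn g S := by
    intro x hx x' hx' h
    simp only [hg, Prod.mk.injEq] at h
    have e : ξ x = ξ x' := by
      ext
      · rw [(hξS x hx).1, (hξS x' hx').1]
      · exact h.1
      · exact h.2.1
      · exact h.2.2
    simp only [hξ] at e
    have e2 := congrArg (· * y) e
    simp only [mul_assoc, star_mul', mul_smul_comm, mul_one] at e2
    have e3 := smul_inj hny0 e2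
    have e4 : (2:ℤ) • x = (2:ℤ) • x' := by
      rw [two_smul, two_smul]
      have : x + x + ℓ•y = x' + x' + ℓ•y := by rw [add_assoc, e3, add_assoc]
      exact add_right_cancel this
    exact smul_inj (by norm_num) e4
  rw [← Finset.card_image_of_injOn hinj]
  have hBB : B ≤ B^2 := by nlinarith
  have hab : α*β ≤ B^2 := by nlinarith
  have tc := tcount (a := -α) (b := -β) (c := α*β) (A := B^2) (L := u^5) (W := 144*B^4*ℓ*u^2) (κ := κ)
    (by
      intro a b c h
      have := han ⟨0,a,b,c⟩ (by simp only [nrd]; linarith)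
      have h1 := congrArg QuaternionAlgebra.imI this
      have h2 := congrArg QuaternionAlgebra.imJ this
      have h3 := congrArg QuaternionAlgebra.imK this
      exact ⟨h1, h2, h3⟩)
    (by rw [abs_neg]; linarith) (by rw [abs_neg]; linarith) (by rw [abs_of_pos (by positivity)]; exact hab)
    (by omega) (by omega) (by positivity) (one_le_pow₀ hu1) (by positivity)
    (by
      have h1 : (243:ℤ)*(B^2)^2*(2*B^2*u^5)^8 = 62208 * B^20 * u^40 := by ring
      have h2 : (u^24)^2 ≤ ℓ^2 := by gcongr
      have h3 : (2:ℤ)^20 ≤ B^20 := by gcongr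
      have h4 : (B^5)^8 ≤ u^8 := by gcongr
      have h6 : 2^20*B^20 ≤ B^20*B^20 := by gcongr
      have h7 : 2*(62208 * B^20) < u^8 := by linarith
      have h9 : 2*(62208 * B^20)*u^40 < u^8*u^40 := by gcongr
      rw [h1]; linarith)
    (S.image g) (by
      intro v hv
      obtain ⟨x, hx, rfl⟩ := Finset.mem_image.mp hv
      have := (hξS x hx).2.1
      rw [nrd, (hξS x hx).1] at this
      simp only [hg]; linarith)
    (by
      intro v hv
      obtain ⟨x, hx, rfl⟩ := Finset.mem_image.mp hv
      exact (hξS x hx).2.2.2)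
  set D := (144*B^4*ℓ*u^2)/u^5 + 1 with hD
  have hD1 : D*u^3 ≤ 145*B^4*ℓ := by
    have h1 : (144*B^4*ℓ*u^2)/u^5*u^5 ≤ 144*B^4*ℓ*u^2 := Int.ediv_mul_le _ (by positivity)
    have h2 : u^3 ≤ B^4*ℓ := by
      have : u^3 ≤ u^24 := pow_le_pow_right₀ hu1 (by norm_num)
      have : 1 ≤ B^4 := one_le_pow₀ (by omega)
      nlinarith
    have h3 : D*u^3*u^2 ≤ 145*B^4*ℓ*u^2 := by
      have h4 : D*u^3*u^2 = (144*B^4*ℓ*u^2)/u^5*u^5 + u^3*u^2 := by rw [hD]; ring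
      rw [h4]
      have h5 : u^3*u^2 ≤ B^4*ℓ*u^2 := by gcongr
      linarith
    exact le_of_mul_le_mul_right h3 (by positivity)
  calc ((S.image g).card:ℤ)*u ≤ (240*B^2*u^5*D^2)*u := by gcongr
    _ = 240*B^2*(D*u^3)^2 := by ring
    _ ≤ 240*B^2*(145*B^4*ℓ)^2 := by gcongr
    _ = _ := by ring
end
section
open Matrix
set_option maxHeartbeats 1000000 in
open Classical in
theorem energy {α β B ℓ u n0 : ℤ} (hB : 2 ≤ B) (hα1 : 1 ≤ α) (hβ1 : 1 ≤ β) (hα : α ≤ B) (hβ : β ≤ B) (han : Aniso α β)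
    (hu : B^5 ≤ u) (hℓ : u^24 ≤ ℓ) (hn0 : |n0| ≤ 8*B^2) (X : Finset (HA ℤ α β)) (hX : ∀ x ∈ X, nrd x = n0 ∧ bd x (3*B*(ℓ*u))) :
    (((X ×ˢ X).filter fun p => dv ℓ (p.2 - p.1)).card : ℤ) * u ≤ X.card * u + (13*B*u)^4*(240*145^2*B^10*ℓ^2) := by
  have hB0 : 0 < B := by omega
  have hB5 : 2^5 ≤ B^5 := by gcongr
  have hu1 : 1 ≤ u := by linarith
  have hu0 : 0 < u := by omega
  have hu24 : u ≤ u^24 := le_self_pow₀ hu1 (by norm_num)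
  have hℓ0 : 0 < ℓ := by linarith
  set I := Finset.Icc (-(6*B*u)) (6*B*u) with hI
  set Y : Finset (HA ℤ α β) := (I ×ˢ I ×ˢ I ×ˢ I).image fun p => ⟨p.1, p.2.1, p.2.2.1, p.2.2.2⟩ with hY
  have memY : ∀ y : HA ℤ α β, bd y (6*B*u) → y ∈ Y := by
    intro y hy
    rw [hY, Finset.mem_image]
    refine ⟨(y.re, y.imI, y.imJ, y.imK), ?_, rfl⟩
    simp only [Finset.mem_product, hI, Finset.mem_Icc, ← abs_le]
    exact hy
  have Ymem : ∀ y ∈ Y, bd y (6*B*u) := by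
    intro y hy
    rw [hY, Finset.mem_image] at hy
    obtain ⟨p, hp, rfl⟩ := hy
    simp only [Finset.mem_product, hI, Finset.mem_Icc, ← abs_le] at hp
    exact hp
  have hYc : (Y.card : ℤ) ≤ (13*B*u)^4 := by
    have h1 : Y.card ≤ _ := Finset.card_image_le
    have h2 : ((I.card : ℕ) : ℤ) ≤ 13*B*u := by
      rw [hI, Int.card_Icc, Int.toNat_of_nonneg (by nlinarith [mul_pos hB0 hu0])]
      nlinarith [mul_pos hB0 hu0]
    rw [Finset.card_product, Finset.card_product, Finset.card_product] at h1
    have h3 : (Y.card:ℤ) ≤ (I.card:ℤ)^4 := by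
      have : (Y.card:ℤ) ≤ ((I.card * (I.card * (I.card*I.card)) : ℕ):ℤ) := by exact_mod_cast h1
      refine this.trans (le_of_eq ?_); push_cast; ring
    exact h3.trans (by gcongr)
  have hsub : ((X ×ˢ X).filter fun p => dv ℓ (p.2 - p.1)) ⊆ Y.biUnion fun y => (X.filter fun x => x + ℓ • y ∈ X).image fun x => (x, x+ℓ•y) := by
    rintro ⟨x, x'⟩ hp
    rw [Finset.mem_filter, Finset.mem_product] at hp
    obtain ⟨⟨h1, h2⟩, y, hy⟩ := hp
    simp only at h1 h2 hy
    have hx' : x' = x + ℓ • y := by rw [← hy]; abel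
    rw [Finset.mem_biUnion]
    refine ⟨y, memY y ?_, ?_⟩
    · have hb : bd (ℓ • y) (ℓ*(6*B*u)) := by
        rw [← hy]
        exact ((hX _ h2).2.sub (hX _ h1).2).mono (le_of_eq (by ring))
      have gen : ∀ z : ℤ, |ℓ * z| ≤ ℓ*(6*B*u) → |z| ≤ 6*B*u := by
        intro z hz
        rw [abs_mul, abs_of_pos hℓ0] at hz
        exact le_of_mul_le_mul_left hz hℓ0
      obtain ⟨b1, b2, b3, b4⟩ := hb
      exact ⟨gen _ b1, gen _ b2, gen _ b3, gen _ b4⟩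
    · rw [Finset.mem_image]
      exact ⟨x, by rw [Finset.mem_filter, ← hx']; exact ⟨h1, h2⟩, by rw [← hx']⟩
  have hc1 := (Finset.card_le_card hsub).trans Finset.card_biUnion_le
  set E := 240*145^2*B^10*ℓ^2 with hE
  have hE0 : 0 ≤ E := by positivity
  have hone : ∀ y ∈ Y, (((X.filter fun x => x + ℓ • y ∈ X).image fun x => (x, x+ℓ•y)).card : ℤ) * u ≤ (if y = 0 then (X.card:ℤ)*u else 0) + E := by
    intro y hy
    have h1 : (((X.filter fun x => x + ℓ • y ∈ X).image fun x => (x, x+ℓ•y)).card : ℤ) ≤ ((X.filter fun x => x + ℓ • y ∈ X).card : ℤ) := by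
      exact_mod_cast Finset.card_image_le
    split_ifs with h0
    · have h2 : ((X.filter fun x => x + ℓ • y ∈ X).card : ℤ) ≤ X.card := by exact_mod_cast Finset.card_filter_le _ _
      have := mul_le_mul_of_nonneg_right (h1.trans h2) hu0.le
      linarith
    · have := shift_count hB hα1 hβ1 hα hβ han hu hℓ hn0 X hX y h0 (Ymem y hy)
      have := mul_le_mul_of_nonneg_right h1 hu0.le
      linarith
  calc (((X ×ˢ X).filter fun p => dv ℓ (p.2 - p.1)).card : ℤ) * u
      ≤ ((∑ y ∈ Y, ((X.filter fun x => x + ℓ • y ∈ X).image fun x => (x, x+ℓ•y)).card : ℕ):ℤ) * u := by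
        gcongr
    _ = ∑ y ∈ Y, (((X.filter fun x => x + ℓ • y ∈ X).image fun x => (x, x+ℓ•y)).card : ℤ) * u := by
        push_cast; rw [Finset.sum_mul]
    _ ≤ ∑ y ∈ Y, ((if y = 0 then (X.card:ℤ)*u else 0) + E) := Finset.sum_le_sum hone
    _ ≤ X.card * u + Y.card * E := by
        rw [Finset.sum_add_distrib, Finset.sum_ite_eq', Finset.sum_const, nsmul_eq_mul]
        have : 0 ≤ (X.card:ℤ)*u := by positivity
        split_ifs <;> linarith
    _ ≤ _ := by gcongr
theorem rank_one {F : Type*} [Field F] (M : Matrix (Fin 2) (Fin 2) F) (h : M.det = 0) :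
    ∃ c : Fin 2 → F, c ≠ 0 ∧ ∀ j, ∃ s : F, M.col j = s • c := by
  obtain ⟨d, hd, hdM⟩ := Matrix.exists_vecMul_eq_zero_iff.mpr h
  refine ⟨![-d 1, d 0], ?_, fun j => ?_⟩
  · intro h0
    apply hd
    have h1 := congrFun h0 0
    have h2 := congrFun h0 1
    simp at h1 h2
    ext i; fin_cases i <;> simp [h1, h2]
  · have hj := congrFun hdM j
    simp only [Matrix.vecMul, dotProduct, Fin.sum_univ_two, Pi.zero_apply] at hj
    by_cases h0 : d 0 = 0
    · have h1 : d 1 ≠ 0 := by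
        intro h1; apply hd; ext i; fin_cases i <;> simp [h0, h1]
      refine ⟨-M 0 j / d 1, ?_⟩
      rw [h0, zero_mul, zero_add] at hj
      ext i; fin_cases i
      · simp [Matrix.col]; field_simp
      · simp [Matrix.col, h0]; exact (mul_eq_zero.mp hj).resolve_left h1
    · refine ⟨M 1 j / d 0, ?_⟩
      ext i; fin_cases i
      · simp [Matrix.col]; field_simp; linear_combination hj
      · simp [Matrix.col]; field_simp
theorem mix_ineq {B ℓ u N P : ℤ} (hB : 2 ≤ B) (hu : B^260 ≤ u) (hℓ : u^24 ≤ ℓ) (hℓ' : ℓ < (u+1)^24) (hP0 : 0 ≤ P)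
    (hN : (ℓ*u)^2 ≤ B^38*N) (hP : P*u ≤ N*u + (13*B*u)^4*(240*145^2*B^10*ℓ^2)) :
    (P*(2*ℓ^3))^200*(ℓ+1)^2 < (N^2*ℓ)^200 := by
  have hB1 : (1:ℤ) ≤ B := by omega
  have hu2 : 2 ≤ u := by
    have : B ≤ B^260 := le_self_pow₀ hB1 (by norm_num)
    linarith
  have hu1 : 1 ≤ u := by omega
  have hℓ0 : 0 < ℓ := by have : 0 < u^24 := by positivity
                         linarith
  have hN0 : 0 < N := by
    have h1 : 0 < B^38*N := lt_of_lt_of_le (by positivity) hN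
    exact pos_of_mul_pos_right h1 (by positivity)
  have key : 2*P*ℓ^2*u ≤ B^130*N^2 := by
    have h1 : 2*P*ℓ^2*u ≤ 2*N*(ℓ*u)^2 + (2*13^4*240*145^2)*B^14*((ℓ*u)^2)^2 := by
      calc 2*P*ℓ^2*u = 2*ℓ^2*(P*u) := by ring
        _ ≤ 2*ℓ^2*(N*u + (13*B*u)^4*(240*145^2*B^10*ℓ^2)) := by gcongr
        _ = 2*N*ℓ^2*u + (2*13^4*240*145^2)*B^14*((ℓ*u)^2)^2 := by ring
        _ ≤ _ := by
          have : 2*N*ℓ^2*u ≤ 2*N*ℓ^2*u*u := le_mul_of_one_le_right (by positivity) hu1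
          linarith [(by ring : 2*N*ℓ^2*u*u = 2*N*(ℓ*u)^2)]
    have h2 : (2*13^4*240*145^2 : ℤ) ≤ B^39 := by
      have : (2:ℤ)^39 ≤ B^39 := by gcongr
      refine le_trans (by norm_num) this
    have h3 : (2:ℤ) ≤ B^91 := by
      have : B ≤ B^91 := le_self_pow₀ hB1 (by norm_num)
      linarith
    calc 2*P*ℓ^2*u ≤ 2*N*(B^38*N) + B^39*B^14*(B^38*N)^2 := h1.trans (by gcongr)
      _ ≤ B^91*N*(B^38*N) + B^39*B^14*(B^38*N)^2 := by gcongr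
      _ = 2*(B^129*N^2) := by ring
      _ ≤ B*(B^129*N^2) := by gcongr
      _ = _ := by ring
  have hl1 : (ℓ+1)^2 < u^100 := by
    have h1 : (u+1)^24 ≤ (u^2)^24 := by
      gcongr; nlinarith
    have h2 : ℓ + 1 ≤ u^48 := by
      rw [← pow_mul] at h1; norm_num at h1; linarith
    calc (ℓ+1)^2 ≤ (u^48)^2 := by gcongr
      _ = u^96 := by ring
      _ < u^100 := pow_lt_pow_right₀ (by omega) (by norm_num)
  have key2 : (2*P*ℓ^2)^200*u^100 ≤ N^400 := by
    have h1 : (2*P*ℓ^2*u)^200 ≤ (B^130*N^2)^200 := by gcongr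
    have h2 : (B^130*N^2)^200 = (B^260)^100*N^400 := by ring
    have h3 : (B^260)^100*N^400 ≤ u^100*N^400 := by gcongr
    have h4 : (2*P*ℓ^2*u)^200 = u^100*((2*P*ℓ^2)^200*u^100) := by ring
    rw [h2, h4] at h1
    exact le_of_mul_le_mul_left (h1.trans h3) (by positivity)
  rcases hP0.eq_or_lt with h0 | h0
  · rw [← h0, zero_mul, zero_pow (by norm_num), zero_mul]; positivity
  calc (P*(2*ℓ^3))^200*(ℓ+1)^2 < (P*(2*ℓ^3))^200*u^100 := by gcongr
    _ = ℓ^200*((2*P*ℓ^2)^200*u^100) := by ring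
    _ ≤ ℓ^200*N^400 := by gcongr
    _ = _ := by ring
theorem root_ge {c u : ℤ} (hu : 0 ≤ u) (h : c^24 < (u+1)^24) : c ≤ u := by
  by_contra h'
  have : u+1 ≤ c := by omega
  have : (u+1)^24 ≤ c^24 := by gcongr
  linarith
theorem root24 (ℓ : ℕ) : ∃ u : ℕ, u^24 ≤ ℓ ∧ ℓ < (u+1)^24 := by
  have hex : ∃ v : ℕ, ℓ < (v+1)^24 := ⟨ℓ, lt_of_lt_of_le (Nat.lt_succ_self ℓ) (Nat.le_self_pow (by norm_num) _)⟩
  classical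
  refine ⟨Nat.find hex, ?_, Nat.find_spec hex⟩
  by_cases h0 : Nat.find hex = 0
  · rw [h0]; simp
  · have := Nat.find_min hex (m := Nat.find hex - 1) (by omega)
    rw [Nat.sub_add_cancel (by omega)] at this
    omega
theorem mix_small {B u ℓ : ℤ} (hB : 2 ≤ B) (h2 : B^14 ≤ u) (hu1 : 1 ≤ u) (hℓ : u^24 ≤ ℓ) :
    144*B^6*u^2 ≤ ℓ ∧ 144*B^6 ≤ ℓ := by
  have h1' : 144 ≤ B^8 := le_trans (by norm_num) (pow_le_pow_left₀ (by norm_num) hB 8)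
  have h3 : u^3 ≤ ℓ := (pow_le_pow_right₀ hu1 (by norm_num)).trans hℓ
  have h4 : 1 ≤ u^2 := one_le_pow₀ hu1
  clear hℓ
  have h5 : 144*B^6 ≤ u := by
    refine le_trans ?_ h2
    calc 144*B^6 ≤ B^8*B^6 := mul_le_mul_of_nonneg_right h1' (by positivity)
      _ = _ := by ring
  clear h2
  have h6 : 144*B^6*u^2 ≤ ℓ := by
    refine le_trans (mul_le_mul_of_nonneg_right h5 (by positivity)) (le_trans (le_of_eq ?_) h3)
    ring
  refine ⟨h6, le_trans ?_ h6⟩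
  exact le_mul_of_one_le_right (by positivity) h4
theorem mix_pre {B : ℤ} {ℓ : ℕ} (hB : 2 ≤ B) (hℓB : (B^260)^24 ≤ ℓ) : ∃ u : ℕ, B^5 ≤ (u:ℤ) ∧ (1:ℤ) ≤ u ∧ (u:ℤ)^24 ≤ ℓ ∧
    144*B^6*(u:ℤ)^2 ≤ ℓ ∧ 144*B^6 ≤ (ℓ:ℤ) ∧ (1:ℤ) ≤ ℓ ∧ ∀ N P : ℤ, 0 ≤ P → ((ℓ:ℤ)*u)^2 ≤ B^38*N →
    P*u ≤ N*u + (13*B*u)^4*(240*145^2*B^10*(ℓ:ℤ)^2) → (P*(2*(ℓ:ℤ)^3))^200*((ℓ:ℤ)+1)^2 < (N^2*ℓ)^200 := by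
  have hB1 : (1:ℤ) ≤ B := by omega
  obtain ⟨u, hu1, hu2⟩ := root24 ℓ
  have hℓ : ((u:ℤ))^24 ≤ ℓ := by exact_mod_cast hu1
  have hℓ' : (ℓ:ℤ) < ((u:ℤ)+1)^24 := by exact_mod_cast hu2
  have hu : B^260 ≤ (u:ℤ) := by
    exact root_ge (Int.natCast_nonneg u) (lt_of_le_of_lt hℓB hℓ')
  have huB5 : B^5 ≤ (u:ℤ) := (pow_le_pow_right₀ hB1 (by norm_num)).trans hu
  have hu1' : (1:ℤ) ≤ u := le_trans (one_le_pow₀ hB1) huB5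
  obtain ⟨hℓbig, hℓ144⟩ := mix_small hB ((pow_le_pow_right₀ hB1 (by norm_num)).trans hu) hu1' hℓ
  have hℓ1 : (1:ℤ) ≤ ℓ := (one_le_pow₀ hu1').trans hℓ
  exact ⟨u, huB5, hu1', hℓ, hℓbig, hℓ144, hℓ1, fun N P h1 h2 h3 => mix_ineq hB hu hℓ hℓ' h1 h2 h3⟩
set_option maxHeartbeats 2000000 in
open Classical in
theorem mixing {α β B Q : ℤ} {ℓ : ℕ} (hℓp : ℓ.Prime) (hB : 2 ≤ B) (hα1 : 1 ≤ α) (hβ1 : 1 ≤ β) (hα : α ≤ B) (hβ : β ≤ B)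
    (hQ1 : 1 ≤ Q) (hQ : Q ≤ B) (han : Aniso α β) (hℓB : (B^260)^24 ≤ ℓ) (v t : HA ℤ α β) (hv : (ℓ:ℤ) ∣ nrd v) (ht : (ℓ:ℤ) ∣ nrd t) :
    ∃ γ : HA ℤ α β, Gam α β Q γ ∧ bd γ (((ℓ:ℤ)^3)^200) ∧ dv ℓ (v * γ * t) := by
  have hℓf : Fact ℓ.Prime := ⟨hℓp⟩
  have hB1 : (1:ℤ) ≤ B := by omega
  obtain ⟨u, huB5, hu1', hℓ, hℓbig, hℓ144, hℓ1, himp⟩ := mix_pre hB hℓB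
  clear hℓB
  have hB62 : B^2 ≤ B^6 := pow_le_pow_right₀ hB1 (by norm_num)
  have hB21 : B ≤ B^2 := le_self_pow₀ hB1 (by norm_num)
  have nz : ∀ z : ℤ, z ≠ 0 → |z| < ℓ → (z : ZMod ℓ) ≠ 0 := by
    intro z hz hlt h
    rw [ZMod.intCast_zmod_eq_zero_iff_dvd] at h
    exact hz (Int.eq_zero_of_abs_lt_dvd h hlt)
  have hαF : (α : ZMod ℓ) ≠ 0 := nz α (by omega) (by rw [abs_of_pos (by omega)]; linarith)
  have hβF : (β : ZMod ℓ) ≠ 0 := nz β (by omega) (by rw [abs_of_pos (by omega)]; linarith)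
  have h2F : (2 : ZMod ℓ) ≠ 0 := by
    have := nz 2 (by omega) (by rw [abs_of_pos (by omega)]; linarith)
    exact_mod_cast this
  obtain ⟨p, q, hpq⟩ := exists_pq (ℓ := ℓ) (by zify; linarith) α β hαF
  have phidv : ∀ x : HA ℤ α β, phi p q x = 0 → dv ℓ x := by
    intro x hx
    have := phi_eq_zero hpq h2F hαF hβF x hx
    rw [dv_iff]
    simpa only [ZMod.intCast_zmod_eq_zero_iff_dvd] using this
  obtain ⟨X, n0, hn00, hn0, hX, hXd, hXc⟩ := xcount hB hα1 hβ1 hα hβ hQ1 hQ han (T := ℓ*u) (one_le_mul_of_one_le_of_one_le hℓ1 hu1')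
  have hn0F : (n0 : ZMod ℓ) ≠ 0 := nz n0 hn00 (by linarith)
  have hN0 : 0 < X.card := by
    by_contra h
    have : X.card = 0 := by omega
    rw [this, Nat.cast_zero, mul_zero] at hXc
    have h3 : 0 < ((ℓ:ℤ)*u)^2 := by positivity
    linarith
  obtain ⟨x0, hx0⟩ := Finset.card_pos.mp hN0
  have hBa : |α| ≤ B := by rw [abs_of_pos (by omega)]; exact hα
  have hBb : |β| ≤ B := by rw [abs_of_pos (by omega)]; exact hβ
  have hγ : ∀ x : {x // x ∈ X}, ∃ γ : HA ℤ α β, Gam α β Q γ ∧ n0 • γ = x.1 * star x0 := by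
    rintro ⟨x, hx⟩
    obtain ⟨y, hy⟩ := hXd x hx x0 hx0
    have e : n0 • ((1:ℤ) • 1 + Q • (y * star x0)) = x * star x0 := by
      have h1 : x = x0 + (n0*Q) • y := by rw [← hy]; abel
      rw [h1, add_mul, mul_star', (hX x0 hx0).1, smul_mul_assoc, smul_add, smul_smul, smul_smul, mul_one]
    refine ⟨(1:ℤ) • 1 + Q • (y * star x0), gam_iff.mpr ⟨?_, 1, _, rfl⟩, e⟩
    have e2 := congrArg nrd e
    rw [nrd_smul, nrd_mul, nrd_star, (hX x hx).1, (hX x0 hx0).1] at e2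
    have : n0^2 ≠ 0 := pow_ne_zero 2 hn00
    apply mul_left_cancel₀ this
    rw [e2]; ring
  choose γ hγ1 hγ2 using hγ
  set gs : {x // x ∈ X} → SpecialLinearGroup (Fin 2) (ZMod ℓ) := fun x => ⟨phi p q (γ x), by rw [phi_det hpq, (hγ1 x).1]; simp⟩ with hgs
  have hcoin : (coin gs : ℤ) ≤ (((X ×ˢ X).filter fun p => dv (ℓ:ℤ) (p.2 - p.1)).card : ℤ) := by
    have : coin gs ≤ ((X ×ˢ X).filter fun p => dv (ℓ:ℤ) (p.2 - p.1)).card := by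
      unfold coin
      refine Finset.card_le_card_of_injOn (fun p => (p.1.1, p.2.1)) ?_ ?_
      · rintro ⟨⟨x, hx⟩, ⟨x', hx'⟩⟩ hp
        simp only [Finset.coe_filter, Set.mem_ofPred_eq, Finset.mem_univ, true_and, hgs] at hp
        have hp' := congrArg (fun g => g.1) hp
        simp only at hp'
        simp only [Finset.coe_filter, Set.mem_ofPred_eq, Finset.mem_product]
        refine ⟨⟨hx, hx'⟩, ?_⟩
        have e1 : phi p q (x * star x0) = phi p q (x' * star x0) := by
          rw [← hγ2 ⟨x, hx⟩, ← hγ2 ⟨x', hx'⟩, phi_smul, phi_smul, hp']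
        have e2 : phi p q (x' - x) * phi p q (star x0) = 0 := by
          rw [← phi_mul hpq, sub_mul, phi_sub, e1, sub_self]
        apply phidv
        have e3 := congrArg (· * phi p q x0) e2
        simp only [mul_assoc, ← phi_mul hpq, star_mul', (hX x0 hx0).1, zero_mul, phi_smul, mul_smul_comm, mul_one] at e3
        exact (smul_eq_zero.mp e3).resolve_left hn0F
      · rintro ⟨⟨x, hx⟩, ⟨x', hx'⟩⟩ _ ⟨⟨y, hy⟩, ⟨y', hy'⟩⟩ _ h
        simpa using h
    exact_mod_cast this
  have hen := energy hB hα1 hβ1 hα hβ han huB5 hℓ hn0 X hX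
  have hmix := himp X.card (coin gs) (by positivity) hXc
    ((mul_le_mul_of_nonneg_right hcoin (by positivity)).trans hen)
  by_cases hv0 : phi p q v = 0
  · exact ⟨1, Gam.one Q, ⟨by simpa using one_le_pow₀ (one_le_pow₀ hℓ1), by simp, by simp, by simp⟩, ((phidv v hv0).mul_right _).mul_right _⟩
  have hvd : (phi p q v).det = 0 := by rw [phi_det hpq, ZMod.intCast_zmod_eq_zero_iff_dvd]; exact hv
  have htd : (phi p q t).det = 0 := by rw [phi_det hpq, ZMod.intCast_zmod_eq_zero_iff_dvd]; exact ht
  obtain ⟨c', hc'0, hc'⟩ := Matrix.exists_mulVec_eq_zero_iff.mpr hvd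
  obtain ⟨c, hc0, hc⟩ := rank_one _ htd
  obtain ⟨l, hl, r, hr⟩ := expander_SL2 gs 200 (by
    rw [ZMod.card, Fintype.card_coe]
    exact_mod_cast hmix) c c' hc0 hc'0
  have hlist : ∀ l : List {x // x ∈ X}, Gam α β Q (l.map γ).prod ∧ bd (l.map γ).prod (((ℓ:ℤ)^3)^l.length) ∧ phi p q (l.map γ).prod = (l.map gs).prod.1 := by
    intro l
    induction l with
    | nil => exact ⟨Gam.one Q, ⟨by simp, by simp, by simp, by simp⟩, by simpa using phi_one⟩
    | cons x l ih =>
      simp only [List.map_cons, List.prod_cons, List.length_cons]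
      refine ⟨(hγ1 x).mul ih.1, ?_, ?_⟩
      · have b1 : bd (γ x) (4*B^2*(3*B*(ℓ*u))*(3*B*(ℓ*u))) := by
          apply bd_of_smul hn00
          rw [hγ2 x]
          exact (hX x.1 x.2).2.mul hB1 hBa hBb (hX x0 hx0).2.star
        refine (b1.mul hB1 hBa hBb ih.2.1).mono ?_
        have : 4*B^2*(4*B^2*(3*B*(ℓ*u))*(3*B*(ℓ*u))) ≤ (ℓ:ℤ)^3 := by
          calc _ = (144*B^6*(u:ℤ)^2) * ℓ^2 := by ring
            _ ≤ ℓ * ℓ^2 := by gcongr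
            _ = _ := by ring
        calc _ ≤ (ℓ:ℤ)^3 * ((ℓ:ℤ)^3)^l.length := by gcongr
          _ = _ := by ring
      · rw [phi_mul hpq, ih.2.2]; rfl
  obtain ⟨g1, g2, g3⟩ := hlist l
  refine ⟨(l.map γ).prod, g1, g2.mono (le_of_eq ?_), phidv _ ?_⟩
  · rw [hl]
  · rw [phi_mul hpq, phi_mul hpq, g3]
    ext i j
    obtain ⟨s, hs⟩ := hc j
    have : (phi p q v * (l.map gs).prod.1 * phi p q t) i j = (phi p q v *ᵥ ((l.map gs).prod.1 *ᵥ (phi p q t).col j)) i := by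
      rw [Matrix.mulVec_mulVec]; rfl
    rw [this, hs, Matrix.mulVec_smul, hr, Matrix.mulVec_smul, Matrix.mulVec_smul, hc']
    simp
end
section
open Finset
noncomputable def es (k : ℕ) (P : Finset ℕ) (g : ℕ → ℝ) : ℝ := ∑ A ∈ P.powersetCard k, ∏ p ∈ A, g p
noncomputable def Tr (b : ℕ) (P : Finset ℕ) (g : ℕ → ℝ) : ℝ := ∑ k ∈ range (b+1), (-1)^k * es k P g
theorem es_zero (P g) : es 0 P g = 1 := by simp [es]
theorem es_empty (k : ℕ) (g) : es (k+1) ∅ g = 0 := by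
  rw [es, powersetCard_eq_empty.mpr (by simp), sum_empty]
theorem es_insert {P : Finset ℕ} {p : ℕ} (hp : p ∉ P) (g) (k : ℕ) : es (k+1) (insert p P) g = es (k+1) P g + g p * es k P g := by
  unfold es
  rw [powersetCard_succ_insert hp, sum_union, sum_image]
  · congr 1
    rw [mul_sum]
    refine sum_congr rfl fun A hA => ?_
    rw [prod_insert]
    exact fun h => hp ((mem_powersetCard.mp hA).1 h)
  · intro A hA A' hA' h
    have h1 : p ∉ A := fun h => hp ((mem_powersetCard.mp hA).1 h)
    have h2 : p ∉ A' := fun h => hp ((mem_powersetCard.mp hA').1 h)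
    rw [← erase_insert h1, ← erase_insert h2, h]
  · rw [disjoint_left]
    intro A hA hA'
    obtain ⟨A', _, rfl⟩ := mem_image.mp hA'
    exact hp ((mem_powersetCard.mp hA).1 (mem_insert_self _ _))
theorem es_nonneg {P : Finset ℕ} {g : ℕ → ℝ} (hg : ∀ p ∈ P, 0 ≤ g p) (k) : 0 ≤ es k P g :=
  sum_nonneg fun _ hA => prod_nonneg fun p hp => hg p ((mem_powersetCard.mp hA).1 hp)
theorem Tr_zero (P g) : Tr 0 P g = 1 := by simp [Tr, es_zero]
theorem Tr_succ (b P g) : Tr (b+1) P g = Tr b P g + (-1)^(b+1) * es (b+1) P g := by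
  simp [Tr, sum_range_succ _ (b+1)]
theorem Tr_insert {P : Finset ℕ} {p : ℕ} (hp : p ∉ P) (g) (b : ℕ) : Tr (b+1) (insert p P) g = Tr (b+1) P g - g p * Tr b P g := by
  unfold Tr
  rw [sum_range_succ' _ (b+1), sum_range_succ' _ (b+1), mul_sum]
  simp only [es_insert hp, es_zero, mul_add, sum_add_distrib]
  have : ∑ x ∈ range (b+1), (-1:ℝ)^(x+1) * (g p * es x P g) = - ∑ x ∈ range (b+1), g p * ((-1)^x * es x P g) := by
    rw [← sum_neg_distrib]; refine sum_congr rfl fun x _ => by ring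
  rw [this]; ring
theorem bonf {P : Finset ℕ} {g : ℕ → ℝ} (hg : ∀ p ∈ P, 0 ≤ g p ∧ g p ≤ 1) : ∀ b, 0 ≤ (-1:ℝ)^b * (Tr b P g - ∏ p ∈ P, (1 - g p)) := by
  induction P using Finset.induction_on with
  | empty =>
    intro b
    have : Tr b ∅ g = 1 := by
      induction b with
      | zero => exact Tr_zero _ _
      | succ b ih => rw [Tr_succ, ih]; simp [es_empty]
    simp [this]
  | insert p P hp ih =>
    have ih' := ih fun q hq => hg q (mem_insert_of_mem hq)
    have hgp := hg p (mem_insert_self _ _)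
    intro b
    rw [prod_insert hp]
    cases b with
    | zero =>
      rw [Tr_zero]
      have h1 : ∏ q ∈ P, (1 - g q) ≤ 1 := prod_le_one (fun q hq => by have := hg q (mem_insert_of_mem hq); linarith) (fun q hq => by have := hg q (mem_insert_of_mem hq); linarith)
      have h2 : 0 ≤ ∏ q ∈ P, (1 - g q) := prod_nonneg (fun q hq => by have := hg q (mem_insert_of_mem hq); linarith)
      nlinarith
    | succ b =>
      rw [Tr_insert hp]
      have h1 := ih' (b+1)
      have h2 := mul_nonneg hgp.1 (ih' b)
      calc (0:ℝ) ≤ _ := add_nonneg h1 h2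
        _ = _ := by ring
theorem bonf_even {P : Finset ℕ} {g : ℕ → ℝ} (hg : ∀ p ∈ P, 0 ≤ g p ∧ g p ≤ 1) {b : ℕ} (hb : Even b) :
    ∏ p ∈ P, (1 - g p) ≤ Tr b P g ∧ Tr b P g - ∏ p ∈ P, (1 - g p) ≤ es (b+1) P g := by
  have h1 := bonf hg b
  have h2 := bonf hg (b+1)
  rw [Tr_succ, pow_succ, hb.neg_one_pow] at h2
  rw [hb.neg_one_pow] at h1
  constructor <;> linarith
theorem es_le {P : Finset ℕ} {g : ℕ → ℝ} (hg : ∀ p ∈ P, 0 ≤ g p) : ∀ k : ℕ, es k P g * k.factorial ≤ (∑ p ∈ P, g p)^k := by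
  induction P using Finset.induction_on with
  | empty =>
    intro k
    cases k with
    | zero => simp [es_zero]
    | succ k => simp [es_empty]
  | insert p P hp ih =>
    have ih' := ih fun q hq => hg q (mem_insert_of_mem hq)
    have hgp := hg p (mem_insert_self _ _)
    have hs : 0 ≤ ∑ p ∈ P, g p := sum_nonneg fun q hq => hg q (mem_insert_of_mem hq)
    intro k
    rw [sum_insert hp]
    cases k with
    | zero => simp [es_zero]
    | succ k =>
      rw [es_insert hp]
      set σ := ∑ p ∈ P, g p
      have ber : ∀ k : ℕ, σ^(k+1) + (k+1)*g p*σ^k ≤ (g p + σ)^(k+1) := by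
        intro k
        induction k with
        | zero => simp; linarith
        | succ k ih =>
          calc _ ≤ (σ^(k+1) + (k+1)*g p*σ^k)*(g p+σ) := by
                push_cast
                have : 0 ≤ (k+1)*g p*σ^k*g p := by positivity
                rw [pow_succ σ (k+1), pow_succ σ k]; nlinarith
            _ ≤ (g p + σ)^(k+1)*(g p+σ) := mul_le_mul_of_nonneg_right ih (by linarith)
            _ = _ := by ring
      refine le_trans ?_ (ber k)
      have h1 := ih' (k+1)
      have h2 := mul_le_mul_of_nonneg_left (ih' k) (show 0 ≤ ((k:ℝ)+1) * g p by positivity)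
      rw [Nat.factorial_succ] at h1 ⊢
      push_cast at h1 ⊢
      nlinarith
theorem prod_ge {P : Finset ℕ} {g : ℕ → ℝ} (hg : ∀ p ∈ P, 0 ≤ g p ∧ g p ≤ 1/2) (hs : ∑ p ∈ P, g p ≤ 8) :
    Real.exp (-16) ≤ ∏ p ∈ P, (1 - g p) := by
  calc Real.exp (-16) ≤ Real.exp (∑ p ∈ P, -2 * g p) := by
        apply Real.exp_le_exp.mpr; rw [← mul_sum]; linarith
    _ = ∏ p ∈ P, Real.exp (-2 * g p) := Real.exp_sum _ _
    _ ≤ _ := by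
        refine prod_le_prod (fun _ _ => (Real.exp_pos _).le) fun p hp => ?_
        obtain ⟨h0, h1⟩ := hg p hp
        have h2 := Real.add_one_le_exp (2 * g p)
        have h3 : Real.exp (-2 * g p) * Real.exp (2 * g p) = 1 := by rw [← Real.exp_add]; simp
        have h4 := Real.exp_pos (-2 * g p)
        have h5 : Real.exp (-2 * g p) * (2 * g p + 1) ≤ 1 := by nlinarith
        have h6 : 1 ≤ (1 - g p) * (2 * g p + 1) := by nlinarith
        by_contra hc
        nlinarith
def App (S : ℕ) (PP : Finset ℕ) (ind : ℕ → ℕ → ℝ) (g : ℕ → ℝ) (QQ : Finset ℕ) (h : ℕ → ℝ) (m E : ℝ) : Prop :=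
  ∀ A ⊆ PP, Disjoint A QQ → |∑ s ∈ range S, h s * ∏ p ∈ A, ind s p - S * m * ∏ p ∈ A, g p| ≤ E * 2^A.card
variable {S : ℕ} {PP : Finset ℕ} {ind : ℕ → ℕ → ℝ} {g : ℕ → ℝ}
theorem App.add {QQ h h' m m' E E'} (a : App S PP ind g QQ h m E) (a' : App S PP ind g QQ h' m' E') :
    App S PP ind g QQ (fun s => h s + h' s) (m + m') (E + E') := by
  intro A hA hd
  have h1 := a A hA hd
  have h2 := a' A hA hd
  rw [add_mul]
  refine le_trans (le_of_eq ?_) ((abs_add_le _ _).trans (add_le_add h1 h2))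
  congr 1
  simp only [add_mul, sum_add_distrib]; ring
theorem App.smul {QQ h m E} (a : App S PP ind g QQ h m E) {c : ℝ} (hc : |c| = 1) :
    App S PP ind g QQ (fun s => c * h s) (c * m) E := by
  intro A hA hd
  have h1 := a A hA hd
  refine le_trans (le_of_eq ?_) h1
  rw [← one_mul |_ - _ * m * _|, ← hc, ← abs_mul, mul_sub, mul_sum]
  congr 2
  · exact sum_congr rfl fun s _ => by ring
  · ring
theorem App.mono {QQ h m E E'} (a : App S PP ind g QQ h m E) (hE : E ≤ E') : App S PP ind g QQ h m E' :=
  fun A hA hd => (a A hA hd).trans (mul_le_mul_of_nonneg_right hE (by positivity))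
theorem App.sum {ι : Type} {QQ} (s : Finset ι) {h : ι → ℕ → ℝ} {m E : ι → ℝ} (a : ∀ i ∈ s, App S PP ind g QQ (h i) (m i) (E i)) :
    App S PP ind g QQ (fun x => ∑ i ∈ s, h i x) (∑ i ∈ s, m i) (∑ i ∈ s, E i) := by
  classical
  induction s using Finset.induction_on with
  | empty => intro A _ _; simp
  | insert i s hi ih =>
    simp only [sum_insert hi]
    exact (a i (mem_insert_self _ _)).add (ih fun j hj => a j (mem_insert_of_mem hj))
theorem App.es {QQ P h m E} (a : App S PP ind g QQ h m E) (hP : P ⊆ PP) (hd : Disjoint P QQ) (k : ℕ) :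
    App S PP ind g (QQ ∪ P) (fun s => h s * es k P (ind s)) (m * es k P g) (E * es k P (fun _ => 2)) := by
  have := App.sum (S := S) (PP := PP) (ind := ind) (g := g) (QQ := QQ ∪ P) (P.powersetCard k) (h := fun A s => h s * ∏ p ∈ A, ind s p)
    (m := fun A => m * ∏ p ∈ A, g p) (E := fun A => E * ∏ p ∈ A, 2) ?_
  · simpa only [Masser.es, mul_sum] using this
  intro B hB A hA hAd
  have hBP := (mem_powersetCard.mp hB).1
  rw [disjoint_union_right] at hAd
  have hBA : Disjoint B A := (hAd.2.mono_right hBP).symm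
  have := a (B ∪ A) (union_subset (hBP.trans hP) hA) (disjoint_union_left.mpr ⟨hd.mono_left hBP, hAd.1⟩)
  simp only [prod_union hBA] at this
  rw [card_union_of_disjoint hBA] at this
  rw [prod_const]
  refine le_trans (le_of_eq ?_) (this.trans (le_of_eq ?_))
  · congr 2
    · exact sum_congr rfl fun s _ => by ring
    · ring
  · rw [pow_add]; ring
theorem App.Tr {QQ P h m E} (a : App S PP ind g QQ h m E) (hP : P ⊆ PP) (hd : Disjoint P QQ) (b : ℕ) :
    App S PP ind g (QQ ∪ P) (fun s => h s * Tr b P (ind s)) (m * Tr b P g) (E * ∑ k ∈ range (b+1), Masser.es k P (fun _ => 2)) := by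
  have := App.sum (range (b+1)) (fun k _ => (a.es hP hd k).smul (c := (-1)^k) (by simp))
  simp only [Masser.Tr, mul_sum]
  simpa only [mul_left_comm] using this
theorem brun_hooley (hi : ∀ s, ∀ p ∈ PP, 0 ≤ ind s p ∧ ind s p ≤ 1) (hg : ∀ p ∈ PP, 0 ≤ g p ∧ g p ≤ 1/2)
    (P : ℕ → Finset ℕ) (hP : ∀ i, P i ⊆ PP) (hPd : ∀ i j, i < j → Disjoint (P j) (P i)) (hs : ∀ i, ∑ p ∈ P i, g p ≤ 8)
    (b : ℕ → ℕ) (hb : ∀ i, Even (b i)) (ε W : ℕ → ℝ) (hε : ∀ i, es (b i + 1) (P i) g ≤ ε i * Real.exp (-16))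
    (hW : ∀ i, ∑ k ∈ range (b i + 2), es k (P i) (fun _ => 2) ≤ W i)
    (a0 : App S PP ind g ∅ (fun _ => 1) 1 1) : ∀ J : ℕ, ∃ (Y L : ℕ → ℝ) (mY mL : ℝ),
      App S PP ind g ((range J).biUnion P) Y mY (∏ i ∈ range J, W i) ∧ App S PP ind g ((range J).biUnion P) L mL (∏ i ∈ range J, W i) ∧
      (∀ s, ∏ i ∈ range J, ∏ p ∈ P i, (1 - ind s p) ≤ Y s ∧ L s ≤ ∏ i ∈ range J, ∏ p ∈ P i, (1 - ind s p)) ∧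
      Real.exp (-16)^J ≤ mY ∧ mY * (1 - ∑ i ∈ range J, ε i) ≤ mL := by
  intro J
  induction J with
  | zero => exact ⟨fun _ => 1, fun _ => 1, 1, 1, by simpa using a0, by simpa using a0, by simp, by simp, by simp⟩
  | succ J ih =>
    obtain ⟨Y, L, mY, mL, aY, aL, hs1, hm1, hm2⟩ := ih
    have hd : Disjoint (P J) ((range J).biUnion P) := by
      rw [disjoint_biUnion_right]; intro i hi; exact hPd i J (mem_range.mp hi)
    have hW0 : ∀ i, 0 ≤ W i := fun i => le_trans (sum_nonneg fun k _ => es_nonneg (fun _ _ => by norm_num) k) (hW i)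
    have hE0 : 0 ≤ ∏ i ∈ range J, W i := prod_nonneg fun i _ => hW0 i
    have hU : (range (J+1)).biUnion P = (range J).biUnion P ∪ P J := by
      rw [range_add_one, biUnion_insert, union_comm]
    have e0 : 0 ≤ es (b J + 1) (P J) (fun _ => 2) := es_nonneg (fun _ _ => by norm_num) _
    have hWJ := hW J
    rw [sum_range_succ] at hWJ
    have bI := fun s => bonf_even (P := P J) (g := ind s) (fun p hp => hi s p (hP J hp)) (hb J)
    have bg := bonf_even (P := P J) (g := g) (fun p hp => ⟨(hg p (hP J hp)).1, by linarith [(hg p (hP J hp)).2]⟩) (hb J)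
    have hV := prod_ge (P := P J) (g := g) (fun p hp => hg p (hP J hp)) (hs J)
    have hT : Real.exp (-16) ≤ Tr (b J) (P J) g := hV.trans bg.1
    have hexp := Real.exp_pos (-16)
    have hmY : 0 < mY := lt_of_lt_of_le (by positivity) hm1
    have hX0 : ∀ s j, 0 ≤ ∏ p ∈ P j, (1 - ind s p) := fun s j => prod_nonneg fun p hp => by linarith [(hi s p (hP j hp)).2]
    have aYT := aY.Tr (hP J) hd (b J)
    have aLe := (aL.Tr (hP J) hd (b J)).add ((aY.es (hP J) hd (b J + 1)).smul (c := -1) (by simp))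
    rw [← hU] at aYT aLe
    refine ⟨_, _, _, _, aYT.mono ?_, aLe.mono ?_, ?_, ?_, ?_⟩
    · rw [prod_range_succ]; exact mul_le_mul_of_nonneg_left (by linarith) hE0
    · rw [prod_range_succ, ← mul_add]; exact mul_le_mul_of_nonneg_left hWJ hE0
    · intro s
      simp only [prod_range_succ]
      obtain ⟨h1, h2⟩ := hs1 s
      obtain ⟨h3, h4⟩ := bI s
      have h5 := hX0 s J
      have h6 : 0 ≤ ∏ i ∈ range J, ∏ p ∈ P i, (1 - ind s p) := prod_nonneg fun j _ => hX0 s j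
      generalize ∏ i ∈ range J, ∏ p ∈ P i, (1 - ind s p) = X at *
      generalize ∏ p ∈ P J, (1 - ind s p) = x at *
      generalize Masser.Tr (b J) (P J) (ind s) = y at *
      generalize Masser.es (b J + 1) (P J) (ind s) = e at *
      constructor
      · exact mul_le_mul h1 h3 h5 (h6.trans h1)
      · have k1 : L s * y ≤ X * y := mul_le_mul_of_nonneg_right h2 (h5.trans h3)
        have k2 : X * (y - x) ≤ Y s * e := mul_le_mul h1 h4 (by linarith) (h6.trans h1)
        nlinarith
    · rw [pow_succ]; exact mul_le_mul hm1 hT hexp.le hmY.le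
    · rw [sum_range_succ]
      have hεJ := hε J
      have e1 : 0 ≤ es (b J + 1) (P J) g := es_nonneg (fun p hp => (hg p (hP J hp)).1) _
      have ε0 : 0 ≤ ε J := by
        by_contra h
        nlinarith
      generalize Masser.Tr (b J) (P J) g = y at *
      generalize Masser.es (b J + 1) (P J) g = e at *
      have k1 := mul_le_mul_of_nonneg_right hm2 (hexp.le.trans hT)
      have k2 : e ≤ ε J * y := hεJ.trans (mul_le_mul_of_nonneg_left hT ε0)
      have k3 := mul_le_mul_of_nonneg_left k2 hmY.le
      nlinarith
end
section
open Finset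
section cnt
variable (a b c : ℤ)
def qf (s : ℕ) : ℤ := a*(s:ℤ)^2 + b*s + c
def rt (p : ℕ) : Finset ℕ := (range p).filter fun r => (p:ℤ) ∣ qf a b c r
noncomputable def gq (p : ℕ) : ℝ := (rt a b c p).card / p
noncomputable def inq (s p : ℕ) : ℝ := if (p:ℤ) ∣ qf a b c s then 1 else 0
theorem rt_card {p : ℕ} (hp : p.Prime) (ha : ¬ (p:ℤ) ∣ a) : (rt a b c p).card ≤ 2 := by
  by_contra h
  obtain ⟨x, hx, y, hy, z, hz, hxy, hxz, hyz⟩ := two_lt_card.mp (not_le.mp h)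
  rw [rt, mem_filter, mem_range, qf] at hx hy hz
  have hpi := Nat.prime_iff_prime_int.mp hp
  have nd : ∀ u v : ℕ, u < p → v < p → u ≠ v → ¬ (p:ℤ) ∣ (u:ℤ) - v := by
    intro u v hu hv huv hd
    have := Int.eq_zero_of_abs_lt_dvd hd (by rw [abs_lt]; constructor <;> omega)
    omega
  have h1 : (p:ℤ) ∣ (x - y) * (a*(x+y)+b) := by
    exact (dvd_sub hx.2 hy.2).trans (dvd_of_eq (by ring))
  have h2 : (p:ℤ) ∣ (x - z) * (a*(x+z)+b) := by
    exact (dvd_sub hx.2 hz.2).trans (dvd_of_eq (by ring))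
  have h1' := (hpi.dvd_or_dvd h1).resolve_left (nd x y hx.1 hy.1 hxy)
  have h2' := (hpi.dvd_or_dvd h2).resolve_left (nd x z hx.1 hz.1 hxz)
  have h3 : (p:ℤ) ∣ a * (y - z) := by
    exact (dvd_sub h1' h2').trans (dvd_of_eq (by ring))
  exact (hpi.dvd_or_dvd h3).elim ha (nd y z hy.1 hz.1 hyz)
theorem inq_eq {p : ℕ} (hp : 0 < p) (s : ℕ) : inq a b c s p = ∑ t ∈ rt a b c p, if s ≡ t [MOD p] then (1:ℝ) else 0 := by
  have key : (p:ℤ) ∣ qf a b c s ↔ s % p ∈ rt a b c p := by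
    have hm : (p:ℤ) ∣ qf a b c s - qf a b c (s % p) := by
      have h0 : (p:ℤ) ∣ (s:ℤ) - ((s % p : ℕ):ℤ) := by
        rw [Int.natCast_mod]; exact Int.dvd_self_sub_emod
      have : qf a b c s - qf a b c (s % p) = ((s:ℤ) - ((s % p : ℕ):ℤ)) * (a*((s:ℤ) + ((s % p : ℕ):ℤ)) + b) := by
        unfold qf; ring
      rw [this]; exact h0.mul_right _
    rw [rt, mem_filter, mem_range]
    constructor
    · exact fun h => ⟨Nat.mod_lt _ hp, by simpa using dvd_sub h hm⟩
    · exact fun h => by simpa using dvd_add hm h.2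
  have e : ∀ t ∈ rt a b c p, (if s ≡ t [MOD p] then (1:ℝ) else 0) = if s % p = t then 1 else 0 := by
    intro t ht
    have : t < p := by simp only [rt, mem_filter, mem_range] at ht; exact ht.1
    simp only [Nat.ModEq, Nat.mod_eq_of_lt this]
  rw [sum_congr rfl e, sum_ite_eq, inq]
  simp only [key]
theorem cnt_ap (S r q : ℕ) (hq : 0 < q) : |∑ s ∈ range S, (if s ≡ r [MOD q] then (1:ℝ) else 0) - (S:ℝ)/q| ≤ 1 := by
  have h1 := Nat.count_modEq_card S hq r
  rw [Nat.count_eq_card_filter_range] at h1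
  rw [sum_boole, h1]
  have hq' : (0:ℝ) < q := by exact_mod_cast hq
  have h2 : (S:ℝ) / q = ((S/q : ℕ):ℝ) + ((S%q : ℕ):ℝ)/q := by
    have : (S:ℝ) = ((q * (S/q) + S%q : ℕ):ℝ) := by rw [Nat.div_add_mod]
    rw [this]; push_cast; field_simp
  have h3 : ((S%q : ℕ):ℝ)/q < 1 := by rw [div_lt_one hq']; exact_mod_cast Nat.mod_lt _ hq
  have h4 : 0 ≤ ((S%q : ℕ):ℝ)/q := by positivity
  rw [h2, abs_le]; push_cast
  split_ifs <;> constructor <;> simp <;> linarith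
theorem cnt_main (S : ℕ) (A : Finset ℕ) : ∀ (_ : ∀ p ∈ A, p.Prime) (q r : ℕ) (_ : 0 < q) (_ : ∀ p ∈ A, q.Coprime p),
    |∑ s ∈ range S, (if s ≡ r [MOD q] then (1:ℝ) else 0) * ∏ p ∈ A, inq a b c s p - (S:ℝ)/q * ∏ p ∈ A, gq a b c p| ≤ ∏ p ∈ A, ((rt a b c p).card : ℝ) := by
  induction A using Finset.induction_on with
  | empty => intro _ q r hq _; simpa using cnt_ap S r q hq
  | insert p A hp ih =>
    intro hA q r hq hco
    have hpp := hA p (mem_insert_self _ _)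
    have hqp := hco p (mem_insert_self _ _)
    have step : ∀ t : ℕ, ∃ r' : ℕ, ∀ s, (if s ≡ r [MOD q] then (1:ℝ) else 0) * (if s ≡ t [MOD p] then (1:ℝ) else 0) = if s ≡ r' [MOD q*p] then 1 else 0 := by
      intro t
      obtain ⟨r', h1, h2⟩ := Nat.chineseRemainder hqp r t
      refine ⟨r', fun s => ?_⟩
      have e3 := Nat.modEq_and_modEq_iff_modEq_mul hqp (a := s) (b := r')
      have e1 : s ≡ r [MOD q] ↔ s ≡ r' [MOD q] := ⟨fun h => h.trans h1.symm, fun h => h.trans h1⟩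
      have e2 : s ≡ t [MOD p] ↔ s ≡ r' [MOD p] := ⟨fun h => h.trans h2.symm, fun h => h.trans h2⟩
      simp only [← e3, e1, e2, ite_and, mul_ite, mul_one, mul_zero]
      split_ifs <;> rfl
    choose r' hr' using step
    have ih' := fun t => ih (fun x hx => hA x (mem_insert_of_mem hx)) (q*p) (r' t) (Nat.mul_pos hq hpp.pos)
      (fun x hx => Nat.Coprime.mul_left (hco x (mem_insert_of_mem hx)) ((Nat.coprime_primes hpp (hA x (mem_insert_of_mem hx))).mpr (by rintro rfl; exact hp hx)))
    have e : ∑ s ∈ range S, (if s ≡ r [MOD q] then (1:ℝ) else 0) * ∏ p ∈ insert p A, inq a b c s p - (S:ℝ)/q * ∏ p ∈ insert p A, gq a b c p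
        = ∑ t ∈ rt a b c p, (∑ s ∈ range S, (if s ≡ r' t [MOD q*p] then (1:ℝ) else 0) * ∏ p ∈ A, inq a b c s p - (S:ℝ)/((q*p:ℕ):ℝ) * ∏ p ∈ A, gq a b c p) := by
      rw [sum_sub_distrib, sum_comm, sum_const, nsmul_eq_mul]
      congr 1
      · refine sum_congr rfl fun s _ => ?_
        rw [prod_insert hp, inq_eq a b c hpp.pos, ← mul_assoc, mul_sum, sum_mul]
        exact sum_congr rfl fun t _ => by rw [hr']
      · rw [prod_insert hp, gq]; push_cast
        have : (p:ℝ) ≠ 0 := by exact_mod_cast hpp.ne_zero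
        have : (q:ℝ) ≠ 0 := by exact_mod_cast hq.ne'
        field_simp
    rw [e, prod_insert hp]
    refine (abs_sum_le_sum_abs _ _).trans ((sum_le_sum fun t _ => ih' t).trans (le_of_eq ?_))
    rw [sum_const, nsmul_eq_mul]
theorem app_base (S : ℕ) (PP : Finset ℕ) (h : ∀ p ∈ PP, p.Prime ∧ ¬ (p:ℤ) ∣ a) :
    App S PP (inq a b c) (gq a b c) ∅ (fun _ => 1) 1 1 := by
  intro A hA _
  have := cnt_main a b c S A (fun p hp => (h p (hA hp)).1) 1 0 one_pos (fun p _ => Nat.coprime_one_left p)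
  simp only [Nat.modEq_one, if_true, Nat.cast_one, div_one] at this
  rw [mul_one, one_mul]
  refine this.trans ((prod_le_prod (fun _ _ => by positivity) (fun p hp => ?_)).trans (le_of_eq (prod_const 2)))
  exact_mod_cast rt_card a b c (h p (hA hp)).1 (h p (hA hp)).2
end cnt
theorem primes_dyadic (j : ℕ) : j * ((Ioc (2^j) (2^(j+1))).filter Nat.Prime).card ≤ 2^(j+2) := by
  set D := (Ioc (2^j) (2^(j+1))).filter Nat.Prime
  have h1 : (2^j)^D.card ≤ ∏ p ∈ D, p := by
    rw [← prod_const]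
    exact prod_le_prod' fun p hp => (mem_Ioc.mp (mem_filter.mp hp).1).1.le
  have h2 : ∏ p ∈ D, p ≤ primorial (2^(j+1)) := by
    apply prod_le_prod_of_subset_of_one_le'
    · intro p hp
      have := mem_filter.mp hp
      have h3 := mem_Ioc.mp this.1
      exact mem_filter.mpr ⟨mem_range.mpr (by omega), this.2⟩
    · intro p hp _; exact (mem_filter.mp hp).2.one_lt.le
  have h3 := h1.trans (h2.trans (primorial_le_four_pow (2^(j+1))))
  rw [show (4:ℕ) = 2^2 by norm_num, ← pow_mul, ← pow_mul] at h3
  have := (Nat.pow_le_pow_iff_right (by norm_num : 1 < 2)).mp h3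
  calc _ ≤ _ := this
    _ = _ := by ring
theorem sum_inv_block (i : ℕ) (D : Finset ℕ) (hD : ∀ p ∈ D, p.Prime ∧ 2^(2^i) < p ∧ p ≤ 2^(2^(i+1))) : ∑ p ∈ D, (2:ℝ)/p ≤ 8 := by
  have hsub : D ⊆ (Ico (2^i) (2^(i+1))).biUnion fun j => (Ioc (2^j) (2^(j+1))).filter Nat.Prime := by
    intro p hp
    obtain ⟨h1, h2, h3⟩ := hD p hp
    have hp1 : p - 1 ≠ 0 := by have := h1.two_le; omega
    rw [mem_biUnion]
    refine ⟨Nat.log 2 (p-1), ?_, mem_filter.mpr ⟨mem_Ioc.mpr ?_, h1⟩⟩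
    · rw [mem_Ico]
      exact ⟨Nat.le_log_of_pow_le (by norm_num) (by omega), Nat.log_lt_of_lt_pow hp1 (by omega)⟩
    · have := Nat.pow_log_le_self 2 hp1
      have := Nat.lt_pow_succ_log_self (b := 2) (by norm_num) (p-1)
      omega
  calc ∑ p ∈ D, (2:ℝ)/p ≤ ∑ p ∈ (Ico (2^i) (2^(i+1))).biUnion fun j => (Ioc (2^j) (2^(j+1))).filter Nat.Prime, (2:ℝ)/p :=
        sum_le_sum_of_subset_of_nonneg hsub fun _ _ _ => by positivity
    _ ≤ ∑ j ∈ Ico (2^i) (2^(i+1)), ∑ p ∈ (Ioc (2^j) (2^(j+1))).filter Nat.Prime, (2:ℝ)/p := by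
        rw [sum_biUnion]
        have : ∀ j j' : ℕ, j < j' → Disjoint ((Ioc (2^j) (2^(j+1))).filter Nat.Prime) ((Ioc (2^j') (2^(j'+1))).filter Nat.Prime) := by
          intro j j' h
          rw [disjoint_left]
          intro p h1 h2
          have h3 := (mem_Ioc.mp (mem_filter.mp h1).1).2
          have h4 := (mem_Ioc.mp (mem_filter.mp h2).1).1
          have h5 : 2^(j+1) ≤ 2^j' := Nat.pow_le_pow_right (by norm_num) h
          omega
        intro j _ j' _ hne
        rcases lt_or_gt_of_ne hne with h | h
        · exact this j j' h
        · exact (this j' j h).symm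
    _ ≤ ∑ j ∈ Ico (2^i) (2^(i+1)), (8:ℝ)/2^i := by
        refine sum_le_sum fun j hj => ?_
        have hj1 : 2^i ≤ j := (mem_Ico.mp hj).1
        have hj1' : (2:ℝ)^i ≤ j := by exact_mod_cast hj1
        have hd := primes_dyadic j
        have hd' : (j:ℝ) * ((Ioc (2^j) (2^(j+1))).filter Nat.Prime).card ≤ 2^(j+2) := by exact_mod_cast hd
        have : ∀ p ∈ (Ioc (2^j) (2^(j+1))).filter Nat.Prime, (2:ℝ)/p ≤ 2/2^j := by
          intro p hp
          have := (mem_Ioc.mp (mem_filter.mp hp).1).1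
          have : (2:ℝ)^j ≤ p := by exact_mod_cast this.le
          gcongr
        refine (sum_le_sum this).trans ?_
        rw [sum_const, nsmul_eq_mul, ← mul_div_assoc, div_le_div_iff₀ (by positivity) (by positivity)]
        have : (2:ℝ)^(j+2) = 4*2^j := by ring
        nlinarith
    _ = 8 := by
        rw [sum_const, nsmul_eq_mul, Nat.card_Ico, pow_succ]
        have : 2^i*2 - 2^i = 2^i := by omega
        rw [this]; push_cast; field_simp
end
section
open Finset
theorem lam_sum (J : ℕ) : ∀ c : ℕ, ∑ i ∈ range J, 2^(i+1)*(c+2*(J-1-i)) ≤ 2^J*(2*c+4) := by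
  induction J with
  | zero => intro c; simp
  | succ J ih =>
    intro c
    rw [sum_range_succ]
    have : ∑ i ∈ range J, 2^(i+1)*(c+2*(J+1-1-i)) = ∑ i ∈ range J, 2^(i+1)*((c+2)+2*(J-1-i)) := by
      refine sum_congr rfl fun i hi => ?_
      have := mem_range.mp hi
      congr 1; omega
    rw [this]
    have := ih (c+2)
    have h2 : J+1-1-J = 0 := by omega
    rw [h2, pow_succ]; nlinarith
theorem sum_es_two (P : Finset ℕ) (b N : ℕ) (h : 1 + 2*P.card ≤ N) : ∑ k ∈ range (b+1), es k P (fun _ => 2) ≤ (N:ℝ)^b := by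
  have h1 : ∀ k, es k P (fun _ => 2) ≤ (2*P.card:ℝ)^k := by
    intro k
    have := es_le (P := P) (g := fun _ => 2) (fun _ _ => by norm_num) k
    rw [sum_const, nsmul_eq_mul, mul_comm (P.card:ℝ)] at this
    have h0 : 0 ≤ es k P (fun _ => 2) := es_nonneg (fun _ _ => by norm_num) k
    have h2 : (1:ℝ) ≤ k.factorial := by exact_mod_cast Nat.factorial_pos k
    nlinarith
  have h2 : ((2*P.card:ℝ) + 1)^b ≤ (N:ℝ)^b := by
    have : (1 + 2*P.card:ℝ) ≤ N := by exact_mod_cast h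
    gcongr; linarith
  refine le_trans ?_ h2
  rw [add_pow]
  refine sum_le_sum fun k hk => (h1 k).trans ?_
  rw [one_pow, mul_one]
  have : (1:ℝ) ≤ b.choose k := by exact_mod_cast Nat.choose_pos (by have := mem_range.mp hk; omega)
  exact le_mul_of_one_le_right (by positivity) this
theorem sieve : ∃ K : ℕ, ∀ (J : ℕ) (a b c : ℤ) (PP : Finset ℕ),
    (∀ p ∈ PP, p.Prime ∧ 4 < p ∧ p ≤ 2^(2^(J+1)) ∧ ¬ (p:ℤ) ∣ a) → ∃ s < (2^(2^(J+1)))^K, ∀ p ∈ PP, ¬ (p:ℤ) ∣ qf a b c s := by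
  obtain ⟨n0, hn0⟩ : ∃ n0 : ℕ, ∀ n ≥ n0, (16:ℝ)^n/n.factorial ≤ Real.exp (-16)/4 := by
    have := FloorSemiring.tendsto_pow_div_factorial_atTop (16:ℝ)
    have h := this.eventually_lt_const (show 0 < Real.exp (-16)/4 by positivity)
    obtain ⟨n0, h⟩ := Filter.eventually_atTop.mp h
    exact ⟨n0, fun n hn => (h n hn).le⟩
  refine ⟨4*(2*n0+1)+30, fun J a b c PP hPP => ?_⟩
  set S := (2^(2^(J+1)))^(4*(2*n0+1)+30) with hS
  set P : ℕ → Finset ℕ := fun i => PP.filter fun p => 2^(2^(i+1)) < p ∧ p ≤ 2^(2^(i+2)) with hPdef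
  set bb : ℕ → ℕ := fun i => 2*(n0+(J-1-i)) with hbb
  have hP : ∀ i, P i ⊆ PP := fun i => filter_subset _ _
  have hPm : ∀ i, ∀ p ∈ P i, p.Prime ∧ 2^(2^(i+1)) < p ∧ p ≤ 2^(2^(i+2)) := by
    intro i p hp
    exact ⟨(hPP p (hP i hp)).1, (mem_filter.mp hp).2⟩
  have hg2 : ∀ p ∈ PP, gq a b c p ≤ 2/p := by
    intro p hp
    have : ((rt a b c p).card:ℝ) ≤ 2 := by exact_mod_cast rt_card a b c (hPP p hp).1 (hPP p hp).2.2.2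
    unfold gq; gcongr
  have hg0 : ∀ p, 0 ≤ gq a b c p := fun p => by unfold gq; positivity
  have hg : ∀ p ∈ PP, 0 ≤ gq a b c p ∧ gq a b c p ≤ 1/2 := by
    intro p hp
    refine ⟨hg0 p, (hg2 p hp).trans ?_⟩
    have : (4:ℝ) < p := by exact_mod_cast (hPP p hp).2.1
    rw [div_le_div_iff₀ (by linarith) (by norm_num)]; linarith
  have hs : ∀ i, ∑ p ∈ P i, gq a b c p ≤ 8 := fun i =>
    (sum_le_sum fun p hp => hg2 p (hP i hp)).trans (sum_inv_block (i+1) (P i) (hPm i))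
  have hi : ∀ s, ∀ p ∈ PP, 0 ≤ inq a b c s p ∧ inq a b c s p ≤ 1 := by
    intro s p _; unfold inq; split_ifs <;> norm_num
  have hPd : ∀ i j, i < j → Disjoint (P j) (P i) := by
    intro i j hij
    rw [disjoint_left]
    intro p h1 h2
    have h3 := (hPm j p h1).2.1
    have h4 := (hPm i p h2).2.2
    have h5 : 2^(2^(i+2)) ≤ 2^(2^(j+1)) := Nat.pow_le_pow_right (by norm_num) (Nat.pow_le_pow_right (by norm_num) (by omega))
    exact absurd (h4.trans h5) (not_le.mpr h3)
  have hε : ∀ i, es (bb i + 1) (P i) (gq a b c) ≤ ((1/2:ℝ)^(J-1-i)/4) * Real.exp (-16) := by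
    intro i
    set n := bb i + 1 with hn
    have h1 := es_le (P := P i) (g := gq a b c) (fun p _ => hg0 p) n
    have h2 : (∑ p ∈ P i, gq a b c p)^n ≤ 8^n := pow_le_pow_left₀ (sum_nonneg fun p _ => hg0 p) (hs i) n
    have hf : (0:ℝ) < n.factorial := by exact_mod_cast Nat.factorial_pos n
    have h3 := hn0 n (by simp only [hn, hbb]; omega)
    have h4 : (1/2:ℝ)^n ≤ (1/2)^(J-1-i) := pow_le_pow_of_le_one (by norm_num) (by norm_num) (by simp only [hn, hbb]; omega)
    calc es n (P i) (gq a b c) ≤ 8^n/n.factorial := by rw [le_div_iff₀ hf]; exact h1.trans h2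
      _ = (1/2)^n * (16^n/n.factorial) := by rw [← mul_div_assoc, ← mul_pow]; norm_num
      _ ≤ (1/2)^(J-1-i) * (Real.exp (-16)/4) := by gcongr
      _ = _ := by ring
  have hW : ∀ i, ∑ k ∈ range (bb i + 2), es k (P i) (fun _ => 2) ≤ ((2^(2^(i+2)+2) : ℕ):ℝ)^(bb i + 1) := by
    intro i
    apply sum_es_two
    have : (P i).card ≤ 2^(2^(i+2)) := by
      have : P i ⊆ Icc 1 (2^(2^(i+2))) := fun p hp => mem_Icc.mpr ⟨(hPm i p hp).1.one_lt.le, (hPm i p hp).2.2⟩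
      simpa using card_le_card this
    have h1 : 1 ≤ 2^(2^(i+2)) := Nat.one_le_two_pow
    rw [pow_add]; omega
  obtain ⟨Y, L, mY, mL, -, aL, hXL, hmY, hmL⟩ := brun_hooley hi hg P hP hPd hs bb (fun i => even_two_mul _) _ _ hε hW
    (app_base a b c S PP fun p hp => ⟨(hPP p hp).1, (hPP p hp).2.2.2⟩) J
  by_contra hcon
  push Not at hcon
  have hL0 : ∀ s ∈ range S, L s ≤ 0 := by
    intro s hs
    obtain ⟨p, hp, hd⟩ := hcon s (mem_range.mp hs)
    refine (hXL s).2.trans (le_of_eq ?_)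
    obtain ⟨h1, h2, h3, -⟩ := hPP p hp
    have hex : ∃ i, p ≤ 2^(2^(i+2)) := ⟨J, h3.trans (Nat.pow_le_pow_right (by norm_num) (Nat.pow_le_pow_right (by norm_num) (by omega)))⟩
    have hmin : 2^(2^(Nat.find hex+1)) < p := by
      by_cases h0 : Nat.find hex = 0
      · rw [h0]; simpa using h2
      · have := Nat.find_min hex (m := Nat.find hex - 1) (by omega)
        rw [show Nat.find hex - 1 + 2 = Nat.find hex + 1 by omega] at this
        exact not_le.mp this
    have hlt : Nat.find hex < J := by
      by_contra h
      have : 2^(2^(J+1)) ≤ 2^(2^(Nat.find hex+1)) := Nat.pow_le_pow_right (by norm_num) (Nat.pow_le_pow_right (by norm_num) (by omega))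
      exact absurd (h3.trans this) (not_le.mpr hmin)
    refine prod_eq_zero (mem_range.mpr hlt) (prod_eq_zero (i := p) (mem_filter.mpr ⟨hp, hmin, Nat.find_spec hex⟩) ?_)
    rw [inq, if_pos hd, sub_self]
  have hA := aL ∅ (empty_subset _) (disjoint_empty_left _)
  simp only [prod_empty, mul_one, card_empty, pow_zero] at hA
  have h1 := (abs_le.mp hA).1
  have h2 : ∑ s ∈ range S, L s ≤ 0 := sum_nonpos hL0
  have hεs : ∑ i ∈ range J, (1/2:ℝ)^(J-1-i)/4 ≤ 1/2 := by
    rw [sum_range_reflect (fun i => (1/2:ℝ)^i/4) J, ← sum_div]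
    have := sum_geometric_two_le J
    linarith
  have hexp : (2:ℝ)^(-32:ℤ) ≤ Real.exp (-16) := by
    rw [Real.exp_neg, zpow_neg]
    apply inv_anti₀ (Real.exp_pos _)
    have h3 : Real.exp 16 = Real.exp 1 ^ 16 := by rw [← Real.exp_nat_mul]; norm_num
    rw [h3]
    calc Real.exp 1 ^ 16 ≤ 4^16 := pow_le_pow_left₀ (Real.exp_pos _).le (by linarith [Real.exp_one_lt_d9]) 16
      _ = _ := by norm_num
  have hmY' : ((2:ℝ)^(32*J))⁻¹ ≤ mY := by
    refine le_trans (le_of_eq ?_) ((pow_le_pow_left₀ (by positivity) hexp J).trans hmY)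
    rw [zpow_neg, inv_pow, ← zpow_natCast, ← zpow_natCast, ← zpow_mul]; norm_cast
  have hE : ∏ i ∈ range J, ((2^(2^(i+2)+2) : ℕ):ℝ)^(bb i + 1) ≤ 2^(4*(2^J*(2*(2*n0+1)+4))) := by
    have h3 := lam_sum J (2*n0+1)
    have h4 : ∏ i ∈ range J, ((2^(2^(i+2)+2) : ℕ))^(bb i + 1) ≤ 2^(4*(2^J*(2*(2*n0+1)+4))) := by
      simp only [← pow_mul]
      rw [prod_pow_eq_pow_sum]
      apply Nat.pow_le_pow_right (by norm_num)
      refine le_trans ?_ (Nat.mul_le_mul_left 4 h3)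
      rw [mul_sum]
      refine sum_le_sum fun i _ => ?_
      have e1 : bb i + 1 = 2*n0+1+2*(J-1-i) := by rw [hbb]; ring
      rw [e1, ← mul_assoc]
      apply Nat.mul_le_mul_right
      have : 1 ≤ 2^i := Nat.one_le_two_pow
      rw [pow_add, pow_succ]; omega
    exact_mod_cast h4
  have hmYpos : 0 < mY := lt_of_lt_of_le (by positivity) hmY'
  have h5 : ((2:ℝ)^(32*J))⁻¹ * (1/2) ≤ mL := by
    refine le_trans ?_ hmL
    exact mul_le_mul hmY' (by linarith) (by norm_num) hmYpos.le
  have h6 : (S:ℝ) * (((2:ℝ)^(32*J))⁻¹ * (1/2)) ≤ 2^(4*(2^J*(2*(2*n0+1)+4))) := by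
    have : (S:ℝ) * (((2:ℝ)^(32*J))⁻¹ * (1/2)) ≤ S * mL := mul_le_mul_of_nonneg_left h5 (by positivity)
    linarith
  have h7 : (S:ℝ) ≤ 2^(4*(2^J*(2*(2*n0+1)+4)) + 32*J + 1) := by
    have e : (S:ℝ) = (S:ℝ) * (((2:ℝ)^(32*J))⁻¹ * (1/2)) * (2^(32*J)*2) := by field_simp
    rw [e, pow_succ, pow_add, mul_assoc ((2:ℝ)^_)]
    exact mul_le_mul_of_nonneg_right h6 (by positivity)
  have h8 : S ≤ 2^(4*(2^J*(2*(2*n0+1)+4)) + 32*J + 1) := by exact_mod_cast h7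
  rw [hS, ← pow_mul] at h8
  have h9 := (Nat.pow_le_pow_iff_right (by norm_num : 1 < 2)).mp h8
  have h10 : J < 2^J := Nat.lt_two_pow_self
  rw [pow_succ] at h9
  nlinarith
theorem two_pow_between (X : ℕ) (hX : 4 ≤ X) : ∃ J, X ≤ 2^(2^(J+1)) ∧ 2^(2^(J+1)) ≤ X^2 := by
  have hex : ∃ J, X ≤ 2^(2^(J+1)) := by
    refine ⟨X, Nat.lt_two_pow_self.le.trans (Nat.pow_le_pow_right (by norm_num) ?_)⟩
    exact (Nat.lt_two_pow_self.le).trans (Nat.pow_le_pow_right (by norm_num) (by omega))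
  refine ⟨Nat.find hex, Nat.find_spec hex, ?_⟩
  by_cases h0 : Nat.find hex = 0
  · rw [h0]; norm_num; nlinarith
  · have := Nat.find_min hex (m := Nat.find hex - 1) (by omega)
    rw [Nat.sub_add_cancel (by omega)] at this
    rw [pow_succ 2 (Nat.find hex), pow_mul]
    exact Nat.pow_le_pow_left (by omega) 2
end
theorem small_t {α β B : ℤ} {ℓ : ℕ} (hℓp : ℓ.Prime) (hB : 2 ≤ B) (hα1 : 1 ≤ α) (hβ1 : 1 ≤ β) (hα : α ≤ B) (hβ : β ≤ B)
    (han : Aniso α β) (hℓ : 4*B^2 < ℓ) : ∃ (t : HA ℤ α β) (m : ℤ), nrd t = ℓ*m ∧ m ≠ 0 ∧ |m| ≤ 4*B^2 ∧ bd t ℓ := by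
  have hℓf : Fact ℓ.Prime := ⟨hℓp⟩
  have hαF : (α : ZMod ℓ) ≠ 0 := by
    rw [Ne, ZMod.intCast_zmod_eq_zero_iff_dvd]
    intro h
    have := Int.le_of_dvd (by omega) h
    nlinarith
  obtain ⟨p, q, hpq⟩ := exists_pq (ℓ := ℓ) (by zify; nlinarith) α β hαF
  set k := Nat.sqrt ℓ with hk
  have hk1 : k*k ≤ ℓ := Nat.sqrt_le ℓ
  have hk2 : ℓ < (k+1)*(k+1) := Nat.lt_succ_sqrt ℓ
  let Φ : Fin 4 → ℕ := fun _ => k+1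
  let f : (Fin 4 → Fin (k+1)) → ZMod ℓ × ZMod ℓ := fun x =>
    ((x 0 : ℕ) - p*(x 2 : ℕ) - α*q*(x 3 : ℕ), (x 1 : ℕ) - q*(x 2 : ℕ) - p*(x 3 : ℕ))
  obtain ⟨x, y, hxy, hf⟩ := Fintype.exists_ne_map_eq_of_card_lt f (by
    rw [Fintype.card_prod, ZMod.card, Fintype.card_fun, Fintype.card_fin, Fintype.card_fin]
    calc ℓ*ℓ < ((k+1)*(k+1))*((k+1)*(k+1)) := Nat.mul_lt_mul'' hk2 hk2
      _ = _ := by ring)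
  let t : HA ℤ α β := ⟨(x 0:ℕ)-(y 0:ℕ), (x 1:ℕ)-(y 1:ℕ), (x 2:ℕ)-(y 2:ℕ), (x 3:ℕ)-(y 3:ℕ)⟩
  have ab : ∀ i, |((x i:ℕ):ℤ) - (y i:ℕ)| ≤ k := by
    intro i
    have h1 := (x i).isLt
    have h2 := (y i).isLt
    rw [abs_le]; constructor <;> omega
  have hbt : bd t k := ⟨ab 0, ab 1, ab 2, ab 3⟩
  have hd : (ℓ:ℤ) ∣ nrd t := by
    rw [← ZMod.intCast_zmod_eq_zero_iff_dvd]
    have h0 := congrArg Prod.fst hf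
    have h1 := congrArg Prod.snd hf
    simp only [f] at h0 h1
    have e0 : ((x 0:ℕ):ZMod ℓ)-(y 0:ℕ) = p*((x 2:ℕ)-(y 2:ℕ)) + α*q*((x 3:ℕ)-(y 3:ℕ)) := by linear_combination h0
    have e1 : ((x 1:ℕ):ZMod ℓ)-(y 1:ℕ) = q*((x 2:ℕ)-(y 2:ℕ)) + p*((x 3:ℕ)-(y 3:ℕ)) := by linear_combination h1
    simp only [nrd, t]
    push_cast
    rw [e0, e1, ← hpq]; ring
  obtain ⟨m, hm⟩ := hd
  have hℓ0 : (0:ℤ) < ℓ := by exact_mod_cast hℓp.pos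
  refine ⟨t, m, hm, ?_, ?_, hbt.mono (by nlinarith)⟩
  · rintro rfl
    rw [mul_zero] at hm
    have ht := han t hm
    apply hxy
    have h0 := congrArg QuaternionAlgebra.re ht
    have h1 := congrArg QuaternionAlgebra.imI ht
    have h2 := congrArg QuaternionAlgebra.imJ ht
    have h3 := congrArg QuaternionAlgebra.imK ht
    simp only [t, re_zero, imI_zero, imJ_zero, imK_zero] at h0 h1 h2 h3
    funext i
    apply Fin.ext
    fin_cases i <;> simp <;> omega
  · have h1 := hbt.nrd (B := B) (by omega) (by rw [abs_of_pos (by omega)]; exact hα) (by rw [abs_of_pos (by omega)]; exact hβ)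
    rw [hm, abs_mul, abs_of_pos hℓ0] at h1
    have h2 : (ℓ:ℤ)*|m| ≤ ℓ*(4*B^2) := h1.trans (by nlinarith)
    exact le_of_mul_le_mul_left h2 hℓ0
theorem gam_unit {α β Q r : ℤ} {x y : HA ℤ α β} (hx : nrd x = 1) (e : x = r • 1 + Q • y) : IsCoprime r Q := by
  refine ⟨r, 2*r*y.re + Q*nrd y, ?_⟩
  have : nrd x = r^2 + Q*(2*r*y.re + Q*nrd y) := by
    rw [e]; simp [nrd]; ring
  rw [hx] at this; rw [this]; ring
set_option maxHeartbeats 1000000 in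
theorem desc_step {α β B R D M μ m : ℤ} {ℓ : ℕ} (hℓp : ℓ.Prime) (hB : 2 ≤ B) (hα1 : 1 ≤ α) (hβ1 : 1 ≤ β) (hα : α ≤ B) (hβ : β ≤ B)
    (hR1 : 1 ≤ R) (hRB : R ≤ B) (han : Aniso α β) (hℓB : ((B^9)^260)^24 ≤ ℓ) (a v : HA ℤ α β) (hv : nrd v = D*(ℓ*m)^2)
    (hva : dv R (v - μ • a)) (hμ : IsCoprime μ R) (hℓR : IsCoprime (ℓ:ℤ) R) (hM : bd v M) :
    ∃ (v' : HA ℤ α β) (μ' : ℤ), nrd v' = D*m^2 ∧ dv R (v' - μ' • a) ∧ IsCoprime μ' R ∧ bd v' (M*(ℓ:ℤ)^1206) := by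
  have hB1 : 1 ≤ B := by omega
  have hBB : B ≤ B^9 := le_self_pow₀ hB1 (by norm_num)
  have hB5 : B^5 ≤ ℓ := by
    refine le_trans ?_ hℓB
    rw [← pow_mul, ← pow_mul]; exact pow_le_pow_right₀ hB1 (by norm_num)
  have hℓ4 : 4*B^2 < ℓ := by
    have : 8 ≤ B^3 := le_trans (by norm_num) (pow_le_pow_left₀ (by norm_num) hB 3)
    nlinarith [sq_nonneg B, pow_pos (show 0 < B by omega) 2, show B^5 = B^3*B^2 by ring]
  have hB9 : B*(4*B^2)^2 ≤ B^9 := by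
    have : 16 ≤ B^4 := le_trans (by norm_num) (pow_le_pow_left₀ (by norm_num) hB 4)
    nlinarith [pow_pos (show 0 < B by omega) 5, show B^9 = B^4*B^5 by ring]
  have h2B9 : 2 ≤ B^9 := hB.trans hBB
  obtain ⟨t, m0, ht, hm0, hm0B, hbt⟩ := small_t hℓp hB hα1 hβ1 hα hβ han hℓ4
  have hm1 : 1 ≤ |m0| := Int.one_le_abs hm0
  have hm2 : m0^2 ≤ (4*B^2)^2 := by rw [← sq_abs]; exact pow_le_pow_left₀ (abs_nonneg _) hm0B 2
  have hm3 : 1 ≤ m0^2 := by rw [← sq_abs]; exact one_le_pow₀ hm1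
  have hQ2 : R*m0^2 ≤ B^9 := le_trans (mul_le_mul hRB hm2 (by positivity) (by omega)) hB9
  have mix1 := fun v t hv ht => mixing hℓp h2B9 hα1 hβ1 (hα.trans hBB) (hβ.trans hBB) hR1 (hRB.trans hBB) han hℓB v t hv ht
  have mix2 := fun v t hv ht => mixing hℓp h2B9 hα1 hβ1 (hα.trans hBB) (hβ.trans hBB) (one_le_mul_of_one_le_of_one_le hR1 hm3) hQ2 han hℓB v t hv ht
  clear hℓB
  generalize hG : (((ℓ:ℤ)^3)^200) = G at mix1 mix2
  have hℓ0 : (ℓ:ℤ) ≠ 0 := by have := hℓp.ne_zero; exact_mod_cast this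
  obtain ⟨γ1, hγ1, hbγ1, v1, hv1⟩ := mix1 v t (hv ▸ ⟨D*(ℓ*m^2), by ring⟩) (ht ▸ ⟨m0, rfl⟩)
  have nv1 : nrd v1 = ℓ*(D*m^2*m0) := by
    have := congrArg nrd hv1
    rw [nrd_smul, nrd_mul, nrd_mul, hγ1.1, hv, ht] at this
    apply mul_left_cancel₀ (pow_ne_zero 2 hℓ0)
    rw [← this]; ring
  obtain ⟨γ2, hγ2, hbγ2, v2, hv2⟩ := mix2 v1 (star t) (nv1 ▸ ⟨_, rfl⟩) (by rw [nrd_star, ht]; exact ⟨m0, rfl⟩)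
  obtain ⟨n1, r1, y1, e1⟩ := gam_iff.mp hγ1
  obtain ⟨n2, r2, y2, e2⟩ := gam_iff.mp hγ2
  have c1 := gam_unit n1 e1
  have c2 : IsCoprime r2 R := IsCoprime.of_isCoprime_of_dvd_right (gam_unit n2 e2) ⟨_, rfl⟩
  set z : HA ℤ α β := (r2*ℓ) • 1 + (R*m0) • (t*y2*star t) with hz
  have ez : t * γ2 * star t = m0 • z := by
    rw [e2, mul_add, add_mul, mul_smul_comm, mul_one, smul_mul_assoc, mul_star', ht, mul_smul_comm, smul_mul_assoc, hz, smul_add, smul_smul, smul_smul, smul_smul]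
    congr 2 <;> ring
  have nz : nrd z = ℓ^2 := by
    have := congrArg nrd ez
    rw [nrd_mul, nrd_mul, nrd_star, n2, ht, nrd_smul] at this
    apply mul_left_cancel₀ (pow_ne_zero 2 hm0)
    rw [← this]; ring
  have eV : v*γ1*t*γ2*star t = m0 • (v*γ1*z) := by
    rw [← mul_smul_comm, ← ez]; simp only [mul_assoc]
  have eV2 : v*γ1*t*γ2*star t = ((ℓ:ℤ)^2) • v2 := by
    rw [hv1, smul_mul_assoc, smul_mul_assoc, hv2, smul_smul, sq]
  have cop : IsCoprime ((ℓ:ℤ)^2) m0 := by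
    apply IsCoprime.pow_left
    rw [Prime.coprime_iff_not_dvd (Nat.prime_iff_prime_int.mp hℓp)]
    intro h
    exact hm0 (Int.eq_zero_of_abs_lt_dvd h (by linarith))
  obtain ⟨w, hw⟩ := dv.of_coprime_smul (n := (ℓ:ℤ)^2) (r := m0) (x := v*γ1*z) ⟨v2, by rw [← eV, eV2]⟩ cop
  have nw : nrd w = D*m^2 := by
    have := congrArg nrd hw
    rw [nrd_mul, nrd_mul, nrd_smul, n1, nz, hv] at this
    apply mul_left_cancel₀ (pow_ne_zero 2 (pow_ne_zero 2 hℓ0))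
    rw [← this]; ring
  obtain ⟨k, k', hk⟩ := IsCoprime.pow_left (m := 2) hℓR
  refine ⟨w, k*(μ*r1*(r2*ℓ)), nw, ?_, ?_, ?_⟩
  · have hz' : dv R (z - (r2*ℓ) • 1) := ⟨m0 • (t*y2*star t), by rw [hz, smul_smul]; abel⟩
    have hγ' : dv R (γ1 - r1 • 1) := ⟨y1, by rw [e1]; abel⟩
    have h1 : dv R (v*γ1*z - (μ*r1*(r2*ℓ)) • a) := by
      have : v*γ1*z - (μ*r1*(r2*ℓ)) • a = v*γ1*(z - (r2*ℓ) • 1) + (r2*ℓ) • (v*(γ1 - r1 • 1)) + (r2*ℓ*r1) • (v - μ • a) := by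
        simp only [mul_sub, mul_smul_comm, mul_one, smul_sub, smul_smul]
        rw [show r2*ℓ*r1*μ = μ*r1*(r2*ℓ) by ring]; abel
      rw [this]
      exact ((hz'.mul_left _).add ((hγ'.mul_left _).smul _)).add (hva.smul _)
    have h2 : w - (k*(μ*r1*(r2*ℓ))) • a = k • (v*γ1*z - (μ*r1*(r2*ℓ)) • a) + R • (k' • w) := by
      rw [hw, smul_sub, smul_smul, smul_smul, smul_smul, mul_comm R k']
      have : w = (1:ℤ) • w := (one_smul _ _).symm
      conv_lhs => rw [this, ← hk, add_smul]
      abel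
    rw [h2]
    exact (h1.smul _).add ⟨_, rfl⟩
  · refine IsCoprime.mul_left ⟨(ℓ:ℤ)^2, k', by rw [← hk]; ring⟩ ((hμ.mul_left c1).mul_left (c2.mul_left hℓR))
  · have hBa : |α| ≤ B := by rw [abs_of_pos (by omega)]; exact hα
    have hBb : |β| ≤ B := by rw [abs_of_pos (by omega)]; exact hβ
    have b1 := (((hM.mul hB1 hBa hBb hbγ1).mul hB1 hBa hBb hbt).mul hB1 hBa hBb hbγ2).mul hB1 hBa hBb hbt.star
    rw [eV, hw, smul_smul] at b1
    have b2 := bd_of_smul (mul_ne_zero hm0 (pow_ne_zero 2 hℓ0)) b1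
    refine b2.mono ?_
    have hM0 := hM.nonneg
    have e : (ℓ:ℤ)^1206 = (ℓ:ℤ)^4*(ℓ^2*G^2) := by
      rw [← hG]; ring
    rw [e]
    have hle : (4*B^2)^4 ≤ (ℓ:ℤ)^4 := pow_le_pow_left₀ (by positivity) hℓ4.le 4
    calc _ = (4*B^2)^4*(M*(ℓ^2*G^2)) := by ring
      _ ≤ ℓ^4*(M*(ℓ^2*G^2)) := mul_le_mul_of_nonneg_right hle (by positivity)
      _ = _ := by ring
theorem desc {α β B R D : ℤ} (hB : 2 ≤ B) (hα1 : 1 ≤ α) (hβ1 : 1 ≤ β) (hα : α ≤ B) (hβ : β ≤ B)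
    (hR1 : 1 ≤ R) (hRB : R ≤ B) (han : Aniso α β) (a : HA ℤ α β) : ∀ (m : ℕ), 0 < m → (∀ ℓ : ℕ, ℓ.Prime → ℓ ∣ m → ((B^9)^260)^24 ≤ (ℓ:ℤ)) →
    IsCoprime (m:ℤ) R → ∀ (M μ : ℤ) (v : HA ℤ α β), nrd v = D*m^2 → dv R (v - μ • a) → IsCoprime μ R → bd v M →
    ∃ (v' : HA ℤ α β) (μ' : ℤ), nrd v' = D ∧ dv R (v' - μ' • a) ∧ IsCoprime μ' R ∧ bd v' (M*(m:ℤ)^1206) := by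
  intro m
  induction m using Nat.strong_induction_on with
  | _ m ih =>
  intro hm hbig hco M μ v hv hva hμ hM
  by_cases h1 : m = 1
  · subst h1
    exact ⟨v, μ, by rw [hv, Nat.cast_one, one_pow, mul_one], hva, hμ, hM.mono (by rw [Nat.cast_one, one_pow, mul_one])⟩
  obtain ⟨ℓ, hℓ, m', rfl⟩ := Nat.exists_prime_and_dvd h1
  have hm' : 0 < m' := Nat.pos_of_ne_zero (by rintro rfl; simp at hm)
  have hlt : m' < ℓ*m' := by have := hℓ.two_le; nlinarith
  push_cast at hv hco ⊢
  obtain ⟨v1, μ1, k1, k2, k3, k4⟩ := desc_step hℓ hB hα1 hβ1 hα hβ hR1 hRB han (hbig ℓ hℓ (dvd_mul_right _ _)) a v hv hva hμ hco.of_mul_left_left hM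
  obtain ⟨v2, μ2, j1, j2, j3, j4⟩ := ih m' hlt hm' (fun p hp hd => hbig p hp (hd.mul_left _)) hco.of_mul_left_right _ μ1 v1 k1 k2 k3 k4
  exact ⟨v2, μ2, j1, j2, j3, j4.mono (le_of_eq (by rw [mul_pow]; ring))⟩
def toR {α β : ℤ} (x : HA ℤ α β) : HA ℝ (α:ℝ) (β:ℝ) := ⟨x.re, x.imI, x.imJ, x.imK⟩
section
variable {α β : ℤ}
theorem toR_mul (x y : HA ℤ α β) : toR (x*y) = toR x * toR y := by
  ext <;> simp [toR]
theorem toR_star (x : HA ℤ α β) : toR (star x) = star (toR x) := by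
  ext <;> simp [toR]
theorem toR_smul (r : ℤ) (x : HA ℤ α β) : toR (r • x) = (r:ℝ) • toR x := by
  ext <;> simp [toR]
theorem nrd_toR (x : HA ℤ α β) : nrd (toR x) = ((nrd x : ℤ):ℝ) := by
  simp [toR, nrd]
theorem bd_toR {x : HA ℤ α β} {M : ℤ} (h : bd x M) : bd (toR x) (M:ℝ) := by
  obtain ⟨h1,h2,h3,h4⟩ := h
  refine ⟨?_,?_,?_,?_⟩ <;> simp only [toR] <;> exact_mod_cast by assumption
theorem bd_of_toR {x : HA ℤ α β} {M : ℤ} (h : bd (toR x) (M:ℝ)) : bd x M := by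
  obtain ⟨h1,h2,h3,h4⟩ := h
  simp only [toR] at h1 h2 h3 h4
  exact ⟨by exact_mod_cast h1, by exact_mod_cast h2, by exact_mod_cast h3, by exact_mod_cast h4⟩
end
theorem cassels' {n : ℕ} (hn : 1 ≤ n) (F : Matrix (Fin n) (Fin n) ℤ) (L : Matrix (Fin n) (Fin n) ℝ) {B : ℝ} (hB : 1 ≤ B)
    (hq : ∀ i j, |(F i j : ℝ)| ≤ B) (hs : F.IsSymm) (hd : F.det ≠ 0)
    (hF : L.transpose * F.map (Int.cast : ℤ → ℝ) * L = F.map (Int.cast : ℤ → ℝ)) (v : Fin n → ℤ) (hv : v ≠ 0) (hv0 : v ⬝ᵥ F.mulVec v = 0) :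
    ∃ w : Fin n → ℤ, w ≠ 0 ∧ w ⬝ᵥ F.mulVec w = 0 ∧ ∀ i, |(L.mulVec (cst w)) i| ≤ 2*(3*n*B)^(n-1)+1 := by
  have hdR : (F.map (Int.cast : ℤ → ℝ)).det ≠ 0 := by
    have : (F.map (Int.cast : ℤ → ℝ)).det = ((F.det : ℤ) : ℝ) := by
      have := (Int.castRingHom ℝ).map_det F
      simpa using this.symm
    rw [this]; exact_mod_cast hd
  have hdet : L.det^2 = 1 := by
    have := congrArg Matrix.det hF
    rw [Matrix.det_mul, Matrix.det_mul, Matrix.det_transpose] at this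
    apply mul_left_cancel₀ hdR
    linarith
  have h2 : |L.det| = 1 := by
    rcases (mul_self_eq_one_iff.mp ((sq _).symm.trans hdet)) with h | h <;> simp [h]
  refine cassels hn F L (F.map Int.cast) hB hq (by
      ext i j; simp only [Matrix.transpose_apply, Matrix.map_apply]; rw [hs.apply]) (by
      intro h; rw [h] at hdet; norm_num at hdet) h2.le ?_ v hv hv0
  intro z w
  have : ((z ⬝ᵥ F.mulVec w : ℤ) : ℝ) = cst z ⬝ᵥ (F.map (Int.cast : ℤ → ℝ)).mulVec (cst w) := by
    simp [dotProduct, Matrix.mulVec, cst]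
  rw [this]
  conv_lhs => rw [← hF, ← Matrix.mulVec_mulVec, ← Matrix.mulVec_mulVec, Matrix.dotProduct_mulVec, Matrix.vecMul_transpose]
def Rm {α β : ℝ} (g : HA ℝ α β) : Matrix (Fin 4) (Fin 4) ℝ :=
  !![g.re, α*g.imI, β*g.imJ, -(α*β*g.imK); g.imI, g.re, -(β*g.imK), β*g.imJ;
    g.imJ, α*g.imK, g.re, -(α*g.imI); g.imK, g.imJ, -g.imI, g.re]
theorem Rm_id {α β : ℤ} (g : HA ℝ (α:ℝ) (β:ℝ)) (hg : nrd g = 1) :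
    (Rm g).transpose * (Matrix.diagonal ![1, -α, -β, α*β]).map (Int.cast : ℤ → ℝ) * Rm g = (Matrix.diagonal ![1, -α, -β, α*β]).map (Int.cast : ℤ → ℝ) := by
  have e : (Matrix.diagonal ![1, -α, -β, α*β]).map (Int.cast : ℤ → ℝ) = !![1,0,0,0;0,-(α:ℝ),0,0;0,0,-(β:ℝ),0;0,0,0,(α:ℝ)*β] := by
    ext i j; fin_cases i <;> fin_cases j <;> simp [Matrix.diagonal]
  rw [e]
  simp only [nrd] at hg
  ext i j
  fin_cases i <;> fin_cases j <;> simp [Rm, Matrix.mul_apply, Fin.sum_univ_four] <;> first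
    | ring1
    | linear_combination hg
    | linear_combination -α*hg
    | linear_combination -β*hg
    | linear_combination α*β*hg
theorem Rm_mulVec {α β : ℤ} (g : HA ℝ (α:ℝ) (β:ℝ)) (x : HA ℤ α β) : (Rm g).mulVec ![x.re, x.imI, x.imJ, x.imK] =
    ![(toR x * g).re, (toR x * g).imI, (toR x * g).imJ, (toR x * g).imK] := by
  ext i
  fin_cases i <;> simp [Rm, Matrix.mulVec, dotProduct, Fin.sum_univ_four, toR] <;> ring
theorem H1 {α β B : ℤ} (hα1 : 1 ≤ α) (hβ1 : 1 ≤ β) (hα : α ≤ B) (hβ : β ≤ B) (han : Aniso α β)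
    (g : HA ℝ (α:ℝ) (β:ℝ)) (hg : nrd g = 1) : ∃ a b : HA ℤ α β, nrd a = nrd b ∧ nrd a ≠ 0 ∧
      bd b (2*(24*B^2)^7+1) ∧ bd (toR a * g) (2*(24*(B:ℝ)^2)^7+1) := by
  set D4 : Matrix (Fin 4) (Fin 4) ℤ := Matrix.diagonal ![1, -α, -β, α*β] with hD4
  let e : Fin 4 ⊕ Fin 4 ≃ Fin 8 := finSumFinEquiv
  set F : Matrix (Fin 8) (Fin 8) ℤ := Matrix.reindex e e (Matrix.fromBlocks D4 0 0 (-D4)) with hF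
  set L : Matrix (Fin 8) (Fin 8) ℝ := Matrix.reindex e e (Matrix.fromBlocks 1 0 0 (Rm g)) with hL
  have hB : 1 ≤ B := hα1.trans hα
  have hq4 : ∀ i j, |D4 i j| ≤ B^2 := by
    have := sq_nonneg B
    intro i j
    rw [hD4, Matrix.diagonal_apply]
    split_ifs with h
    · fin_cases i
      · simp; rw [abs_of_pos] <;> omega
      · simp [abs_of_pos (show 0 < α by omega)]; nlinarith
      · simp [abs_of_pos (show 0 < β by omega)]; nlinarith
      · simp [abs_mul, abs_of_pos (show 0 < α by omega), abs_of_pos (show 0 < β by omega)]; nlinarith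
    · simp [this]
  have hd4 : D4.det ≠ 0 := by
    rw [hD4, Matrix.det_diagonal, Fin.prod_univ_four]
    simp; omega
  obtain ⟨w, hw0, hw, hwb⟩ := cassels' (n := 8) (by norm_num) F L (B := (B:ℝ)^2) (by
      have : (1:ℝ) ≤ B := by exact_mod_cast hB
      nlinarith) (by
      intro i j
      obtain ⟨i', rfl⟩ := e.surjective i
      obtain ⟨j', rfl⟩ := e.surjective j
      have : |F (e i') (e j')| ≤ B^2 := by
        rw [hF, Matrix.reindex_apply, Matrix.submatrix_apply, e.symm_apply_apply, e.symm_apply_apply]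
        rcases i' with i' | i' <;> rcases j' with j' | j'
        · exact hq4 _ _
        · simp [sq_nonneg]
        · simp [sq_nonneg]
        · simpa using hq4 i' j'
      exact_mod_cast this) (by
      rw [hF, Matrix.IsSymm, Matrix.transpose_reindex, Matrix.fromBlocks_transpose]
      simp [hD4, Matrix.diagonal_transpose]) (by
      rw [hF, Matrix.det_reindex_self, Matrix.det_fromBlocks_zero₂₁, Matrix.det_neg]
      simp [hd4]) (by
      have : F.map (Int.cast : ℤ → ℝ) = Matrix.reindex e e (Matrix.fromBlocks (D4.map Int.cast) 0 0 (-(D4.map Int.cast))) := by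
        rw [hF]
        ext i j
        obtain ⟨i', rfl⟩ := e.surjective i
        obtain ⟨j', rfl⟩ := e.surjective j
        simp only [Matrix.map_apply, Matrix.reindex_apply, Matrix.submatrix_apply, e.symm_apply_apply]
        rcases i' with i' | i' <;> rcases j' with j' | j' <;> simp
      rw [this, hL, Matrix.transpose_reindex, Matrix.reindex_apply, Matrix.reindex_apply, Matrix.reindex_apply,
        Matrix.submatrix_mul_equiv, Matrix.submatrix_mul_equiv, Matrix.fromBlocks_transpose, Matrix.fromBlocks_multiply, Matrix.fromBlocks_multiply]
      have := Rm_id g hg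
      rw [← hD4] at this
      simp [this])
    (fun i => Sum.elim ![1,0,0,0] ![1,0,0,0] (e.symm i)) (by
      intro h
      have := congrFun h (e (Sum.inl 0))
      simp at this) (by
      rw [hF]
      simp only [dotProduct, Matrix.mulVec]
      rw [← e.sum_comp]
      simp only [← e.sum_comp, Fintype.sum_sum_type, Matrix.reindex_apply, Matrix.submatrix_apply, e.symm_apply_apply]
      simp [Fin.sum_univ_four, hD4])
  let b : HA ℤ α β := ⟨w (e (.inl 0)), w (e (.inl 1)), w (e (.inl 2)), w (e (.inl 3))⟩
  let a : HA ℤ α β := ⟨w (e (.inr 0)), w (e (.inr 1)), w (e (.inr 2)), w (e (.inr 3))⟩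
  have hab : nrd b = nrd a := by
    rw [hF] at hw
    simp only [dotProduct, Matrix.mulVec] at hw
    rw [← e.sum_comp] at hw
    simp only [← e.sum_comp, Fintype.sum_sum_type, Matrix.reindex_apply, Matrix.submatrix_apply, e.symm_apply_apply] at hw
    simp [Fin.sum_univ_four, hD4] at hw
    simp only [nrd, a, b]
    linarith
  have hLb : ∀ i, (L.mulVec (cst w)) (e (.inl i)) = (w (e (.inl i)) : ℝ) := by
    intro i
    rw [hL]
    simp only [Matrix.mulVec, dotProduct, ← e.sum_comp, Fintype.sum_sum_type, Matrix.reindex_apply, Matrix.submatrix_apply, e.symm_apply_apply]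
    simp [cst, Matrix.one_apply]
  have hLa : ∀ i, (L.mulVec (cst w)) (e (.inr i)) = ((Rm g).mulVec ![(a.re:ℝ), a.imI, a.imJ, a.imK]) i := by
    intro i
    rw [hL]
    simp only [Matrix.mulVec, dotProduct, ← e.sum_comp, Fintype.sum_sum_type, Matrix.reindex_apply, Matrix.submatrix_apply, e.symm_apply_apply]
    simp [cst, a, Fin.sum_univ_four]
  rw [Rm_mulVec] at hLa
  have hC : (2*(3*((8:ℕ):ℝ)*(B:ℝ)^2)^(8-1)+1) = 2*(24*(B:ℝ)^2)^7+1 := by norm_num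
  rw [hC] at hwb
  have hb1 : ∀ i, |w (e (.inl i))| ≤ 2*(24*B^2)^7+1 := by
    intro i
    have := hwb (e (.inl i))
    rw [hLb] at this
    exact_mod_cast this
  have ha1 : ∀ i, |![(toR a * g).re, (toR a * g).imI, (toR a * g).imJ, (toR a * g).imK] i| ≤ 2*(24*(B:ℝ)^2)^7+1 := by
    intro i
    have := hwb (e (.inr i))
    rw [hLa] at this
    exact this
  refine ⟨a, b, hab.symm, ?_, ⟨hb1 0, hb1 1, hb1 2, hb1 3⟩, ⟨ha1 0, ha1 1, ha1 2, ha1 3⟩⟩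
  intro h0
  have ha := han a h0
  have hb := han b (hab.trans h0)
  apply hw0
  funext i
  obtain ⟨i', rfl⟩ := e.surjective i
  rw [QuaternionAlgebra.ext_iff] at ha hb
  simp only [a, b, re_zero, imI_zero, imJ_zero, imK_zero] at ha hb
  rcases i' with i' | i' <;> fin_cases i'
  · exact hb.1
  · exact hb.2.1
  · exact hb.2.2.1
  · exact hb.2.2.2
  · exact ha.1
  · exact ha.2.1
  · exact ha.2.2.1
  · exact ha.2.2.2
theorem sign_choice (p D t : ℤ) : ∃ ε : ℤ, (ε = 1 ∨ ε = -1) ∧ ∀ k : ℕ, p^k ∣ 2*D - ε*t → p^k ∣ 4*D := by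
  by_contra hc
  push Not at hc
  obtain ⟨k1, h1, h1'⟩ := hc 1 (Or.inl rfl)
  obtain ⟨k2, h2, h2'⟩ := hc (-1) (Or.inr rfl)
  rcases le_total k1 k2 with h | h
  · exact h1' ((dvd_add h1 ((pow_dvd_pow p h).trans h2)).trans (dvd_of_eq (by ring)))
  · exact h2' ((dvd_add ((pow_dvd_pow p h).trans h1) h2).trans (dvd_of_eq (by ring)))
theorem int_dvd_of_primes {x y : ℤ} (h : ∀ (p k : ℕ), p.Prime → ((p:ℤ)^k) ∣ x → ((p:ℤ)^k) ∣ y) : x ∣ y := by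
  rw [← Int.natAbs_dvd_natAbs, Nat.dvd_iff_prime_pow_dvd_dvd]
  intro p k hp hd
  have := h p k hp (by
    rw [← Int.natAbs_dvd_natAbs, Int.natAbs_pow, Int.natAbs_natCast]; exact hd)
  rw [← Int.natAbs_dvd_natAbs, Int.natAbs_pow, Int.natAbs_natCast] at this
  exact this
theorem exists_e (N : ℕ) (hN : N ≠ 0) (D t : ℤ) : ∃ e : ℤ, 0 ≤ e ∧ e < N ∧ (N:ℤ) ∣ e^2 - 1 ∧
    ∀ r : ℤ, r ∣ N → r ∣ 2*D - e*t → r ∣ 4*D := by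
  choose ε hε1 hε2 using fun p : ℕ => sign_choice (p:ℤ) D t
  let s : ℕ → ℕ := fun p => p^(N.factorization p)
  let a : ℕ → ℕ := fun p => if ε p = 1 then 1 else s p - 1
  obtain ⟨e0, he0⟩ := Nat.chineseRemainderOfFinset a s N.primeFactors
    (fun p hp => pow_ne_zero _ (Nat.prime_of_mem_primeFactors hp).ne_zero) (by
      intro p hp q hq hpq
      exact Nat.Coprime.pow _ _ ((Nat.coprime_primes (Nat.prime_of_mem_primeFactors hp) (Nat.prime_of_mem_primeFactors hq)).mpr hpq))
  have key : ∀ (p k : ℕ), p.Prime → ((p:ℤ)^k) ∣ N → 0 < k → ((p:ℤ)^k) ∣ (e0:ℤ) % N - ε p := by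
    intro p k hp hd hk
    have hd' : p^k ∣ N := by exact_mod_cast hd
    have hpN : p ∈ N.primeFactors := by
      rw [Nat.mem_primeFactors]; exact ⟨hp, (dvd_pow_self p hk.ne').trans hd', hN⟩
    have h1 : k ≤ N.factorization p := (hp.pow_dvd_iff_le_factorization hN).mp hd'
    have h2 := he0 p hpN
    have h3 : ((s p : ℕ):ℤ) ∣ (a p : ℤ) - e0 := (Nat.modEq_iff_dvd.mp h2)
    have hs1 : 1 ≤ s p := Nat.one_le_iff_ne_zero.mpr (pow_ne_zero _ hp.ne_zero)
    have h4 : ((s p : ℕ):ℤ) ∣ (e0:ℤ) - ε p := by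
      rcases hε1 p with h | h
      · have : (a p : ℤ) = 1 := by simp [a, h]
        rw [h, ← this]; rw [← dvd_neg, neg_sub]; exact h3
      · have : (a p : ℤ) = s p - 1 := by simp [a, h]; omega
        rw [this] at h3
        rw [h]
        exact (dvd_sub (dvd_refl ((s p : ℕ):ℤ)) h3).trans (dvd_of_eq (by ring))
    have h5 : ((p:ℤ)^k) ∣ (s p : ℕ) := by
      simp only [s]; push_cast; exact pow_dvd_pow _ h1
    have h6 : ((p:ℤ)^k) ∣ (e0:ℤ) % N - e0 := hd.trans (by
      rw [Int.emod_def]; exact ⟨-(e0/N), by ring⟩)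
    exact (dvd_add h6 (h5.trans h4)).trans (dvd_of_eq (by ring))
  have hN0 : (0:ℤ) < N := by exact_mod_cast Nat.pos_of_ne_zero hN
  refine ⟨(e0:ℤ) % N, Int.emod_nonneg _ hN0.ne', Int.emod_lt_of_pos _ hN0, ?_, ?_⟩
  · apply int_dvd_of_primes
    intro p k hp hd
    rcases Nat.eq_zero_or_pos k with rfl | hk
    · simp
    have h := key p k hp hd hk
    have : (ε p)^2 = 1 := by rcases hε1 p with h | h <;> rw [h] <;> norm_num
    rw [← this, sq_sub_sq]
    exact h.mul_left _
  · intro r hr hr2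
    apply int_dvd_of_primes
    intro p k hp hd
    rcases Nat.eq_zero_or_pos k with rfl | hk
    · simp
    have h := key p k hp (hd.trans hr) hk
    apply hε2 p k
    exact (dvd_add (hd.trans hr2) (h.mul_right t)).trans (dvd_of_eq (by ring))
theorem hbh {α β : ℤ} (h b : HA ℤ α β) : h * star b * h = (2*(h*star b).re) • h - (nrd h) • b := by
  ext <;> simp only [re_mul, imI_mul, imJ_mul, imK_mul, re_sub, imI_sub, imJ_sub, imK_sub, re_smul, imI_smul, imJ_smul, imK_smul, re_star, imI_star, imJ_star, imK_star, smul_eq_mul, nrd] <;> ring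
theorem re_sum {α β : ℤ} (b a z : HA ℤ α β) (e R : ℤ) : 2*((b - e • a + R • z) * star b).re = (2*nrd b - e*(2*(b.re*a.re - α*b.imI*a.imI-β*b.imJ*a.imJ+α*β*b.imK*a.imK))) + R*(2*(z*star b).re) := by
  simp only [re_mul, re_add, imI_add, imJ_add, imK_add, re_sub, imI_sub, imJ_sub, imK_sub, re_smul, imI_smul, imJ_smul, imK_smul, re_star, imI_star, imJ_star, imK_star, smul_eq_mul, nrd]; ring
theorem nrd_congr {α β n : ℤ} {x y : HA ℤ α β} (h : dv n (x - y)) : n ∣ nrd x - nrd y := by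
  obtain ⟨z, hz⟩ := h
  have : x = y + n • z := by rw [← hz]; abel
  subst this
  refine ⟨2*(y.re*z.re - α*y.imI*z.imI-β*y.imJ*z.imJ+α*β*y.imK*z.imK) + n*nrd z, ?_⟩
  simp [nrd]; ring
theorem H2a {α β D e R : ℤ} {a b h : HA ℤ α β} (ha : nrd a = D) (hb : nrd b = D) (hD : D ≠ 0) (hR : 4*D ∣ R) (hR0 : R ≠ 0)
    (he : R^2 ∣ e^2-1) (heD : ∀ r : ℤ, r ∣ R^2 → r ∣ 2*D - e*(2*(b.re*a.re - α*b.imI*a.imI-β*b.imJ*a.imJ+α*β*b.imK*a.imK)) → r ∣ 4*D)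
    (hh : dv (R^2) (h - (b - e • a))) {M C : ℤ} {B : ℤ} (hB : 1 ≤ B) (hα : |α| ≤ B) (hβ : |β| ≤ B) (hM : bd h M) (hC : bd b C) :
    ∃ (n r : ℤ) (v : HA ℤ α β), nrd h = r*n ∧ r ≠ 0 ∧ IsCoprime n R ∧ nrd v = D*n^2 ∧ dv R (v - (-(e*n)) • a) ∧ bd v (4*B^2*(4*B^2*M*C)*M) := by
  set t := 2*(b.re*a.re - α*b.imI*a.imI-β*b.imJ*a.imJ+α*β*b.imK*a.imK) with ht
  obtain ⟨z, hz⟩ := hh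
  have hh' : h = (b - e • a) + R^2 • z := by rw [← hz]; abel
  have hy : R^2 ∣ nrd h - (2*D - e*t) := by
    have h1 := nrd_congr (α := α) (β := β) ⟨z, hz⟩
    have h2 : nrd (b - e • a) = nrd b + e^2*nrd a - e*t := by
      simp [nrd, ht]; ring
    rw [h2, ha, hb] at h1
    exact (dvd_add h1 (he.mul_left D)).trans (dvd_of_eq (by ring))
  set r : ℤ := (Int.gcd (nrd h) (R^2) : ℤ) with hr
  have hr1 : r ∣ nrd h := Int.gcd_dvd_left ..
  have hr2 : r ∣ R^2 := Int.gcd_dvd_right ..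
  have hr0 : r ≠ 0 := by
    rintro h0; rw [h0, zero_dvd_iff] at hr2; exact hR0 (by simpa using hr2)
  have hr4 : r ∣ 4*D := heD r hr2 ((dvd_sub hr1 (hr2.trans hy)).trans (dvd_of_eq (by ring)))
  obtain ⟨n, hn⟩ := hr1
  obtain ⟨k1, hk1⟩ := hr4.trans hR
  have hco : IsCoprime n R := by
    rw [Int.isCoprime_iff_gcd_eq_one]
    set d : ℤ := (Int.gcd n R : ℤ) with hd
    have h1 : r*d ∣ nrd h := by rw [hn]; exact mul_dvd_mul_left _ (Int.gcd_dvd_left ..)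
    have h2 : r*d ∣ R^2 := by
      rw [sq]; exact mul_dvd_mul (hr4.trans hR) (Int.gcd_dvd_right ..)
    have h3 : r*d ∣ r := Int.dvd_coe_gcd h1 h2
    have h4 : d ∣ 1 := by
      have : r*d ∣ r*1 := by rwa [mul_one]
      exact Int.dvd_of_mul_dvd_mul_left hr0 this
    have h5 : d = 1 := Int.eq_one_of_dvd_one (by rw [hd]; positivity) h4
    rw [hd] at h5; exact_mod_cast h5
  have hτ : R^2 ∣ 2*(h * star b).re - nrd h := by
    have h1 : 2*(h * star b).re = (2*nrd b - e*t) + R^2*(2*(z*star b).re) := by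
      rw [hh', re_sum]
    rw [h1, hb]
    exact (dvd_sub (dvd_mul_right (R^2) (2*(z*star b).re)) hy).trans (dvd_of_eq (by ring))
  obtain ⟨τ, hτ⟩ := hτ
  have hv0 : h * star b * h = (2*(h*star b).re) • h - (nrd h) • b := hbh h b
  have hv1 : h * star b * h = r • ((-(e*n)) • a + R • (k1 • ((nrd h) • z + τ • h))) := by
    rw [hv0, show 2*(h*star b).re = nrd h + R^2*τ by linarith]
    have e1 : (nrd h) • b = (nrd h) • (h + e • a - R^2 • z) := by rw [hh']; congr 1; abel
    rw [e1, hn]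
    have e2 : R^2 = r*(R*k1) := by rw [sq]; nth_rw 2 [hk1]; ring
    rw [e2]
    module
  refine ⟨n, r, _, hn, hr0, hco, ?_, ?_, bd_of_smul hr0 (hv1 ▸ (hM.mul hB hα hβ hC.star).mul hB hα hβ hM)⟩
  · have := congrArg nrd hv1
    rw [nrd_smul, nrd_mul, nrd_mul, nrd_star, hb, hn] at this
    apply mul_left_cancel₀ (pow_ne_zero 2 hr0)
    rw [← hn] at this
    rw [← this, hn]; ring
  · exact ⟨_, by rw [add_sub_cancel_left]⟩
theorem pl_mul {B x y : ℤ} {a b : ℕ} (hB : 2 ≤ B) (hy0 : 0 ≤ y) (hx : x ≤ B^a) (hy : y ≤ B^b) : x*y ≤ B^(a+b) := by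
  rw [pow_add]; exact mul_le_mul hx hy hy0 (pow_nonneg (by omega) _)
theorem pl_add {B x y : ℤ} {a b : ℕ} (hB : 2 ≤ B) (hx : x ≤ B^a) (hy : y ≤ B^b) : x+y ≤ B^(a+b+1) := by
  have h1 : B^a ≤ B^(a+b) := pow_le_pow_right₀ (by omega) (by omega)
  have h2 : B^b ≤ B^(a+b) := pow_le_pow_right₀ (by omega) (by omega)
  have h3 : 0 ≤ B^(a+b) := pow_nonneg (by omega) _
  rw [pow_succ]; nlinarith
theorem pl_pow {B x : ℤ} {a : ℕ} (n : ℕ) (hB : 2 ≤ B) (hx0 : 0 ≤ x) (hx : x ≤ B^a) : x^n ≤ B^(a*n) := by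
  rw [pow_mul]; exact pow_le_pow_left₀ hx0 hx n
theorem pl_two {B : ℤ} (hB : 2 ≤ B) (n : ℕ) : (2:ℤ)^n ≤ B^n := pow_le_pow_left₀ (by norm_num) hB n
theorem pl_self {B x : ℤ} (hx : x ≤ B) : x ≤ B^1 := by rwa [pow_one]
theorem red_mod {α β : ℤ} (a : HA ℤ α β) {N : ℤ} (hN : 0 < N) : ∃ a' : HA ℤ α β, dv N (a' - a) ∧ bd a' N := by
  refine ⟨⟨a.re % N, a.imI % N, a.imJ % N, a.imK % N⟩, ?_, ?_⟩
  · have h : ∀ x : ℤ, x % N - x = N * (-(x/N)) := fun x => by rw [Int.emod_def]; ring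
    exact ⟨⟨-(a.re / N), -(a.imI / N), -(a.imJ / N), -(a.imK / N)⟩, by ext <;> simp only [re_sub, imI_sub, imJ_sub, imK_sub, re_smul, imI_smul, imJ_smul, imK_smul, smul_eq_mul, h]⟩
  · have h : ∀ x : ℤ, |x % N| ≤ N := fun x => by
      rw [abs_of_nonneg (Int.emod_nonneg _ hN.ne')]; exact (Int.emod_lt_of_pos _ hN).le
    exact ⟨h _, h _, h _, h _⟩
theorem H2 : ∃ k : ℕ, ∀ {α β B Q D : ℤ} (hB : 2 ≤ B) (hα1 : 1 ≤ α) (hβ1 : 1 ≤ β) (hα : α ≤ B) (hβ : β ≤ B)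
    (hQ : 1 ≤ Q) (han : Aniso α β) (a b : HA ℤ α β) (ha : nrd a = D) (hb : nrd b = D) (hD : D ≠ 0)
    (hbB : bd b B) (hRB : 96*|D| * Q ≤ B),
    ∃ (v : HA ℤ α β) (μ : ℤ), nrd v = D ∧ dv (96*|D| * Q) (v - μ • a) ∧ bd v (B^k) := by
  obtain ⟨K, hK⟩ := sieve
  obtain ⟨kx, hkx⟩ : ∃ kx : ℕ, kx = 9*260*24 := ⟨_, rfl⟩
  have hE : ∀ x : ℤ, ((x^9)^260)^24 = x^kx := by intro x; rw [hkx, ← pow_mul, ← pow_mul]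
  have hkx1 : 2 ≤ kx := by omega
  clear hkx
  obtain ⟨kd, hkd⟩ : ∃ kd : ℕ, kd = 1206 := ⟨_, rfl⟩
  have desc' := @desc
  rw [← hkd] at desc'
  clear hkd
  obtain ⟨kh, hkh⟩ : ∃ kh : ℕ, kh = 1 + (2+2) + 1 + (2 + kx*2*K) + 1 := ⟨_, rfl⟩
  obtain ⟨ky, hky⟩ : ∃ ky : ℕ, ky = 2+2+kh*2 := ⟨_, rfl⟩
  refine ⟨2+2+(2+2+kh+1)+kh+ky*kd, ?_⟩
  intro α β B Q D hB hα1 hβ1 hα hβ hQ han a b ha hb hD hbB hRB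
  have hD1 : 1 ≤ |D| := Int.one_le_abs hD
  set R := 96*|D| * Q with hR
  have hR1 : 1 ≤ R := by rw [hR]; nlinarith
  have h4D : 4*D ∣ R := by
    rw [hR]
    have : D ∣ |D| := (dvd_abs D D).mpr dvd_rfl
    exact (mul_dvd_mul (show (4:ℤ) ∣ 96 by norm_num) this).mul_right Q
  have h96 : (6:ℤ) ∣ R := by rw [hR, mul_assoc]; exact Dvd.dvd.mul_right (by norm_num) _
  clear_value R
  have hR2 : 0 < R^2 := by positivity
  have hBa : |α| ≤ B := by rw [abs_of_pos (by omega)]; exact hα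
  have hBb : |β| ≤ B := by rw [abs_of_pos (by omega)]; exact hβ
  have hB1 : 1 ≤ B := by omega
  obtain ⟨e, he0, heR, he1, he2⟩ := exists_e ((R^2).toNat) (by omega) D (2*(b.re*a.re - α*b.imI*a.imI-β*b.imJ*a.imJ+α*β*b.imK*a.imK))
  rw [Int.toNat_of_nonneg hR2.le] at heR he1 he2
  obtain ⟨a', ha', ha'b⟩ := red_mod a hR2
  set h0 : HA ℤ α β := b - e • a' with hh0
  have hb0 : bd h0 (B + R^2*R^2) := hbB.sub (ha'b.smul (by rw [abs_of_nonneg he0]; exact heR.le))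
  have hX0 : (((B^kx).toNat : ℕ):ℤ) = B^kx := Int.toNat_of_nonneg (pow_nonneg (by omega) _)
  have hX4 : 4 ≤ (B^kx).toNat := by
    zify; rw [hX0]
    calc (4:ℤ) = 2^2 := by norm_num
      _ ≤ B^2 := pl_two hB 2
      _ ≤ B^kx := pow_le_pow_right₀ hB1 hkx1
  obtain ⟨J, hJ1, hJ2⟩ := two_pow_between _ hX4
  have hK' := hK J
  generalize 2^(2^(J+1)) = X at hJ1 hJ2 hK'
  clear hK
  have hX1 : B^kx ≤ X := by rw [← hX0]; exact_mod_cast hJ1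
  have hX2 : (X:ℤ) ≤ B^(kx*2) := by rw [pow_mul, ← hX0]; exact_mod_cast hJ2
  clear hJ1 hJ2 hX4 hX0
  obtain ⟨s, hs, hsP⟩ := hK' (R^4) (R^2*(2*h0.re)) (nrd h0) ((Finset.range (X+1)).filter (fun p => p.Prime ∧ 4 < p ∧ ¬ (p:ℤ) ∣ R^4)) (by
    intro p hp
    rw [Finset.mem_filter, Finset.mem_range] at hp
    exact ⟨hp.2.1, hp.2.2.1, by omega, hp.2.2.2⟩)
  have hs2 : (s:ℤ) ≤ B^(kx*2*K) := by
    have : (s:ℤ) ≤ (X:ℤ)^K := by exact_mod_cast hs.le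
    exact this.trans (pl_pow K hB (by positivity) hX2)
  set h : HA ℤ α β := h0 + (R^2*s) • 1 with hh
  have hnh : nrd h = qf (R^4) (R^2*(2*h0.re)) (nrd h0) s := by
    rw [hh]; simp only [nrd, qf, re_add, imI_add, imJ_add, imK_add, re_smul, imI_smul, imJ_smul, imK_smul, re_one, imI_one, imJ_one, imK_one, smul_eq_mul]; ring
  have hR2B : R^2 ≤ B^2 := pow_le_pow_left₀ (by omega) hRB 2
  have hbh : bd h (B^kh) := by
    have h1 : bd (1 : HA ℤ α β) 1 := by refine ⟨?_,?_,?_,?_⟩ <;> simp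
    have h2 : bd h (B + R^2*R^2 + R^2*s*1) := hb0.add (h1.smul (by rw [abs_of_nonneg (by positivity)]))
    refine h2.mono ?_
    rw [mul_one, hkh]
    exact pl_add hB (pl_add hB (pl_self le_rfl) (pl_mul hB hR2.le hR2B hR2B)) (pl_mul hB (by positivity) hR2B hs2)
  have hdv : dv (R^2) (h - (b - e • a)) := by
    have : h - (b - e • a) = R^2 • ((s:ℤ) • 1) - e • (a' - a) := by
      rw [hh, hh0, mul_smul]; module
    rw [this]
    exact dv.sub ⟨_, rfl⟩ (ha'.smul e)
  obtain ⟨n, r, v, hn, hr0, hco, hv, hva, hbv⟩ := H2a ha hb hD h4D (by omega) he1 he2 hdv hB1 hBa hBb hbh hbB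
  have hn0 : n ≠ 0 := by
    rintro rfl
    rw [isCoprime_zero_left] at hco
    have := Int.isUnit_iff.mp hco
    omega
  have hbig : ∀ ℓ : ℕ, ℓ.Prime → ℓ ∣ n.natAbs → ((B^9)^260)^24 ≤ (ℓ:ℤ) := by
    intro ℓ hℓ hd
    rw [hE]
    have hd1 : (ℓ:ℤ) ∣ n := Int.natCast_dvd.mpr hd
    have hpr : Prime (ℓ:ℤ) := Nat.prime_iff_prime_int.mp hℓ
    have hnR : ¬ (ℓ:ℤ) ∣ R := fun h => hpr.not_unit (hco.isUnit_of_dvd' hd1 h)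
    by_contra hlt
    have hlt : (ℓ:ℤ) < B^kx := not_le.mp hlt
    have h4 : 4 < ℓ := by
      by_contra h4
      have : ℓ ≤ 4 := not_lt.mp h4
      have h2 := hℓ.two_le
      have hdd : ¬ (ℓ:ℤ) ∣ 6 := fun h => hnR (h.trans h96)
      interval_cases ℓ
      · exact hdd (by norm_num)
      · exact hdd (by norm_num)
      · exact absurd hℓ (by norm_num)
    refine hsP ℓ ?_ (by rw [← hnh, hn]; exact hd1.mul_left r)
    rw [Finset.mem_filter, Finset.mem_range]
    refine ⟨?_, hℓ, h4, fun h => hnR (hpr.dvd_of_dvd_pow h)⟩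
    have : (ℓ:ℤ) < X := hlt.trans_le hX1
    have : ℓ < X := by exact_mod_cast this
    exact Nat.lt_succ_of_lt this
  have hab : ((n.natAbs:ℕ):ℤ)^2 = n^2 := Int.natAbs_sq n
  have hco2 : IsCoprime ((n.natAbs:ℕ):ℤ) R := by
    rw [Int.natCast_natAbs]
    rcases abs_choice n with h | h <;> rw [h]
    · exact hco
    · exact hco.neg_left
  have heco : IsCoprime e R := by
    obtain ⟨c, hc⟩ := he1
    exact ⟨e, -(R*c), by linear_combination hc⟩
  obtain ⟨v', μ', hv', hva', hμ', hbv'⟩ := desc' hB hα1 hβ1 hα hβ hR1 hRB han a n.natAbs (Int.natAbs_pos.mpr hn0) hbig hco2 _ (-(e*n)) v (by rw [hab, hv]) hva (heco.mul_left hco).neg_left hbv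
  refine ⟨v', μ', hv', hva', hbv'.mono ?_⟩
  have hky1 : ((n.natAbs:ℕ):ℤ) ≤ B^ky := by
    rw [Int.natCast_natAbs]
    have h1 := hbh.nrd hB1 hBa hBb
    rw [hn, abs_mul] at h1
    have h2 : |n| ≤ |r| * |n| := le_mul_of_one_le_left (abs_nonneg _) (Int.one_le_abs hr0)
    refine h2.trans (h1.trans ?_)
    rw [hky]
    exact pl_mul hB (pow_nonneg (pow_nonneg (by omega) _) _) (pl_mul hB (by positivity) (pl_two hB 2) le_rfl) (pl_pow 2 hB (pow_nonneg (by omega) _) le_rfl)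
  have hBh : 0 ≤ B^kh := pow_nonneg (by omega) _
  have hB4 : 4*B^2 ≤ B^(2+2) := pl_mul hB (by positivity) (pl_two hB 2) le_rfl
  refine pl_mul hB (by positivity) ?_ (pl_pow kd hB (by positivity) hky1)
  refine pl_mul hB hBh (pl_mul hB (by positivity) hB4 ?_) le_rfl
  refine pl_mul hB (by omega) (pl_mul hB hBh hB4 le_rfl) (pl_self le_rfl)
theorem bdR_of_smul {α β : ℝ} {x : HA ℝ α β} {r M : ℝ} (hr : 1 ≤ |r|) (h : bd (r • x) M) : bd x M := by
  obtain ⟨h1, h2, h3, h4⟩ := h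
  simp only [re_smul, imI_smul, imJ_smul, imK_smul, smul_eq_mul, abs_mul] at h1 h2 h3 h4
  refine ⟨?_, ?_, ?_, ?_⟩
  · nlinarith [abs_nonneg x.re]
  · nlinarith [abs_nonneg x.imI]
  · nlinarith [abs_nonneg x.imJ]
  · nlinarith [abs_nonneg x.imK]
theorem Hthm : ∃ k : ℕ, ∀ {α β B Q : ℤ} (hB : 2 ≤ B) (hα1 : 1 ≤ α) (hβ1 : 1 ≤ β) (hα : α ≤ B) (hβ : β ≤ B)
    (hQ : 1 ≤ Q) (hQB : Q ≤ B) (han : Aniso α β) (g : HA ℝ (α:ℝ) (β:ℝ)) (hg : nrd g = 1),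
    ∃ δ : HA ℤ α β, Gam α β Q δ ∧ bd (toR δ * g) (((B^k : ℤ)) : ℝ) := by
  obtain ⟨k, hk⟩ := H2
  refine ⟨2+2+114*k+51, ?_⟩
  intro α β B Q hB hα1 hβ1 hα hβ hQ hQB han g hg
  obtain ⟨a, b, hab, hD, hbb, hag⟩ := H1 hα1 hβ1 hα hβ han g hg
  have hB1 : 1 ≤ B := by omega
  have hBa : |α| ≤ B := by rw [abs_of_pos (by omega)]; exact hα
  have hBb : |β| ≤ B := by rw [abs_of_pos (by omega)]; exact hβ
  have hC0 : 2*(24*B^2)^7+1 ≤ B^51 := by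
    have h1 : (24*B^2) ≤ B^(5+2) := pl_mul hB (by positivity) (le_trans (by norm_num) (pl_two hB 5)) le_rfl
    have h2 := pl_add hB (pl_mul hB (by positivity) (pl_self hB) (pl_pow 7 hB (by positivity) h1)) (show (1:ℤ) ≤ B^0 by simp)
    exact h2
  generalize hC : 2*(24*B^2)^7+1 = C0 at hC0 hbb
  have hag' : bd (toR a * g) (C0:ℝ) := by rw [← hC]; push_cast; exact hag
  have hDB : |nrd a| ≤ B^106 := by
    rw [hab]
    refine (hbb.nrd hB1 hBa hBb).trans ?_
    exact pl_mul hB (sq_nonneg _) (pl_mul hB (by positivity) (pl_two hB 2) le_rfl) (pl_pow 2 hB hbb.nonneg hC0)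
  have hRB : 96*|nrd a| * Q ≤ B^114 :=
    pl_mul hB (by omega) (pl_mul hB (abs_nonneg _) (show (96:ℤ) ≤ B^7 from le_trans (by norm_num) (pl_two hB 7)) hDB) (pl_self hQB)
  have hBB : B ≤ B^114 := le_self_pow₀ hB1 (by norm_num)
  obtain ⟨v, μ, hv, ⟨z, hz⟩, hbv⟩ := hk (hB.trans hBB) hα1 hβ1 (hα.trans hBB) (hβ.trans hBB) hQ han a b rfl hab.symm hD
    (hbb.mono (hC0.trans (pow_le_pow_right₀ hB1 (by norm_num)))) hRB
  rw [← pow_mul] at hbv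
  generalize 114*k = k' at hbv ⊢
  clear hRB hDB hBB hk
  obtain ⟨R1, hR1, hR1'⟩ : ∃ R1, 96*|nrd a| * Q = nrd a * R1 ∧ Q ∣ R1 := by
    rcases abs_choice (nrd a) with h | h <;> rw [h]
    · exact ⟨96*Q, by ring, ⟨96, by ring⟩⟩
    · exact ⟨-(96*Q), by ring, ⟨-96, by ring⟩⟩
  have ev : v = μ • a + (nrd a * R1) • z := by rw [← hR1, ← hz]; abel
  set δ : HA ℤ α β := μ • 1 + R1 • (star z * a) with hδ
  have e1 : star v * a = (nrd a) • δ := by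
    rw [ev, hδ, star_add, star_smul, star_smul, add_mul, smul_mul_assoc, smul_mul_assoc, star_mul']
    simp only [star_trivial]
    module
  refine ⟨δ, ?_, ?_⟩
  · refine Gam.of_dvd (Q := R1) (gam_iff.mpr ⟨?_, μ, _, hδ⟩) hR1'
    have := congrArg nrd e1
    rw [nrd_mul, nrd_star, hv, nrd_smul] at this
    apply mul_left_cancel₀ (pow_ne_zero 2 hD)
    rw [← this]; ring
  · apply bdR_of_smul (r := ((nrd a:ℤ):ℝ)) (by exact_mod_cast Int.one_le_abs hD)
    rw [← smul_mul_assoc, ← toR_smul, ← e1, toR_mul, mul_assoc]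
    have h1 := (bd_toR hbv.star).mul (B := (B:ℝ)) (by exact_mod_cast hB1) (by exact_mod_cast hBa) (by exact_mod_cast hBb) hag'
    refine h1.mono ?_
    have h2 : 4*B^2*B^k'*C0 ≤ B^(2+2+k'+51) := pl_mul hB hbb.nonneg (pl_mul hB (pow_nonneg (by omega) _) (pl_mul hB (by positivity) (pl_two hB 2) le_rfl) le_rfl) hC0
    exact_mod_cast h2
theorem conj_id {α β c : ℝ} (P : HA ℝ α β) (h0 : P.re = 0) (hc : c^2*(α*β) = nrd P) :
    (P + c • (⟨0,0,0,1⟩ : HA ℝ α β)) * ⟨0,0,0,1⟩ * star (P + c • (⟨0,0,0,1⟩ : HA ℝ α β)) = (2*(c*(α*β) + α*β*P.imK)) • P := by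
  simp only [nrd, h0] at hc
  ext
  · simp [h0]; ring
  · simp [h0]; ring
  · simp [h0]; ring
  · simp [h0]; linear_combination hc
theorem T_real {α β : ℝ} (hα : 1 ≤ α) (hβ : 1 ≤ β) (P : HA ℝ α β) (h0 : P.re = 0) (hN : 0 < nrd P) (hk : 0 < P.imK) {B : ℝ} (hB : 1 ≤ B) (hNB : nrd P ≤ B) :
    ∃ (g : HA ℝ α β) (c : ℝ), nrd g = 1 ∧ |c| ≤ B ∧ P = c • (g * ⟨0,0,0,1⟩ * star g) := by
  have hαβ : 1 ≤ α*β := one_le_mul_of_one_le_of_one_le hα hβ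
  set c := √(nrd P/(α*β)) with hc
  have hc2 : c^2 = nrd P/(α*β) := Real.sq_sqrt (by positivity)
  have hc0 : 0 < c := Real.sqrt_pos.mpr (by positivity)
  have hc3 : c^2*(α*β) = nrd P := by rw [hc2]; field_simp
  set h : HA ℝ α β := P + c • (⟨0,0,0,1⟩ : HA ℝ α β) with hh
  have hY : nrd h = 2*c*(c*(α*β) + α*β*P.imK) := by
    have : nrd h = nrd P + 2*c*(α*β)*P.imK + c^2*(α*β) := by
      simp [hh, nrd, h0]; ring
    rw [this, ← hc3]; ring
  have hY0 : 0 < nrd h := by rw [hY]; positivity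
  set y := √(nrd h) with hy
  have hy0 : 0 < y := Real.sqrt_pos.mpr hY0
  have hy2 : y^2 = nrd h := Real.sq_sqrt hY0.le
  refine ⟨y⁻¹ • h, c, ?_, ?_, ?_⟩
  · rw [nrd_smul, ← hy2]; field_simp
  · rw [abs_of_pos hc0]
    have : c^2 ≤ B^2 := by
      rw [hc2]
      have : nrd P/(α*β) ≤ nrd P := div_le_self hN.le hαβ
      nlinarith
    exact le_of_sq_le_sq this (by linarith)
  · have := conj_id P h0 hc3
    rw [← hh] at this
    rw [show star (y⁻¹ • h) = y⁻¹ • star h by ext <;> simp, smul_mul_assoc, smul_mul_assoc, mul_smul_comm, this, smul_smul, smul_smul, smul_smul]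
    have e : c*(y⁻¹*(y⁻¹*(2*(c*(α*β) + α*β*P.imK)))) = 1 := by
      have : c*(y⁻¹*(y⁻¹*(2*(c*(α*β) + α*β*P.imK)))) = y⁻¹^2*nrd h := by rw [hY]; ring
      rw [this, ← hy2]; field_simp
    have e' : c * (y⁻¹ * y⁻¹ * (2*(c*(α*β) + α*β*P.imK))) = 1 := by rw [← e]; ring
    first
      | rw [e', one_smul]
      | (rw [show c * y⁻¹ * y⁻¹ * (2*(c*(α*β) + α*β*P.imK)) = 1 by rw [← e]; ring, one_smul])
      | rw [e, one_smul]
theorem T_aniso : ∃ k : ℕ, ∀ {α β B Q : ℤ} (hB : 2 ≤ B) (hα1 : 1 ≤ α) (hβ1 : 1 ≤ β) (hα : α ≤ B) (hβ : β ≤ B)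
    (hQ : 1 ≤ Q) (hQB : Q ≤ B) (han : Aniso α β) (π : HA ℤ α β) (h0 : π.re = 0) (hN : 0 < nrd π) (hNB : nrd π ≤ B),
    ∃ δ : HA ℤ α β, Gam α β Q δ ∧ bd (δ * π * star δ) (B^k) := by
  obtain ⟨k, hk⟩ := Hthm
  refine ⟨1 + (2+2+(2+2+k)+k), ?_⟩
  intro α β B Q hB hα1 hβ1 hα hβ hQ hQB han
  have main : ∀ (π : HA ℤ α β) (h0 : π.re = 0) (hN : 0 < nrd π) (hNB : nrd π ≤ B), 0 < π.imK →
      ∃ δ : HA ℤ α β, Gam α β Q δ ∧ bd (δ * π * star δ) (B^(1 + (2+2+(2+2+k)+k))) := by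
    intro π h0 hN hNB hK
    have hB1 : (1:ℝ) ≤ B := by exact_mod_cast (show 1 ≤ B by omega)
    obtain ⟨g, c, hg, hc, hP⟩ := T_real (α := (α:ℝ)) (β := (β:ℝ)) (by exact_mod_cast hα1) (by exact_mod_cast hβ1) (toR π) (by simp [toR, h0])
      (by rw [nrd_toR]; exact_mod_cast hN) (by simp [toR, hK]) hB1 (by rw [nrd_toR]; exact_mod_cast hNB)
    obtain ⟨δ, hδ, hb⟩ := hk hB hα1 hβ1 hα hβ hQ hQB han g hg
    refine ⟨δ, hδ, bd_of_toR ?_⟩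
    have e : toR (δ * π * star δ) = c • ((toR δ * g) * ⟨0,0,0,1⟩ * star (toR δ * g)) := by
      rw [toR_mul, toR_mul, toR_star, hP, star_mul, mul_smul_comm, smul_mul_assoc]
      simp only [mul_assoc]
    rw [e]
    have hBa : |(α:ℝ)| ≤ B := by rw [abs_of_pos (by exact_mod_cast hα1)]; exact_mod_cast hα
    have hBb : |(β:ℝ)| ≤ B := by rw [abs_of_pos (by exact_mod_cast hβ1)]; exact_mod_cast hβ
    have h1 : bd (⟨0,0,0,1⟩ : HA ℝ (α:ℝ) (β:ℝ)) 1 := by refine ⟨?_,?_,?_,?_⟩ <;> simp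
    refine (((hb.mul hB1 hBa hBb h1).mul hB1 hBa hBb hb.star).smul hc).mono ?_
    have hG : 0 ≤ B^k := pow_nonneg (by omega) _
    have h4 : 4*B^2 ≤ B^(2+2) := pl_mul hB (by positivity) (pl_two hB 2) le_rfl
    have : B*(4*B^2*(4*B^2*B^k*1)*B^k) ≤ B^(1 + (2+2+(2+2+k)+k)) := by
      rw [mul_one]
      exact pl_mul hB (by positivity) (pl_self le_rfl) (pl_mul hB hG (pl_mul hB (by positivity) h4 (pl_mul hB hG h4 le_rfl)) le_rfl)
    exact_mod_cast this
  intro π h0 hN hNB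
  rcases lt_trichotomy π.imK 0 with h | h | h
  · have hn : nrd (-π) = nrd π := by simp [nrd]
    obtain ⟨δ, hδ, hb⟩ := main (-π) (by simp [h0]) (by rw [hn]; exact hN) (by rw [hn]; exact hNB) (by simp [h])
    refine ⟨δ, hδ, ?_⟩
    have := hb.neg
    rwa [mul_neg, neg_mul, neg_neg] at this
  · exfalso
    simp only [nrd, h0, h] at hN
    have : 0 ≤ α*π.imI^2 := by positivity
    have : 0 ≤ β*π.imJ^2 := by positivity
    nlinarith
  · exact main π h0 hN hNB h
section
open Matrix
abbrev M2 := Matrix (Fin 2) (Fin 2) ℤ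
def mb (A : M2) (x : ℤ) : Prop := ∀ i j, |A i j| ≤ x
theorem mb.mul {A C : M2} {x y : ℤ} (hA : mb A x) (hC : mb C y) : mb (A*C) (2*x*y) := by
  intro i j
  rw [Matrix.mul_apply, Fin.sum_univ_two]
  have h : ∀ k, |A i k * C k j| ≤ x*y := fun k => by
    rw [abs_mul]; exact mul_le_mul (hA i k) (hC k j) (abs_nonneg _) ((abs_nonneg _).trans (hA i k))
  exact (abs_add_le _ _).trans (by linarith [h 0, h 1])
theorem mb.adj {A : M2} {x : ℤ} (hA : mb A x) : mb A.adjugate x := by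
  intro i j
  rw [Matrix.adjugate_fin_two]
  fin_cases i <;> fin_cases j <;> simp
  · exact hA 1 1
  · exact hA 0 1
  · exact hA 1 0
  · exact hA 0 0
theorem adj_mul_self {A : M2} (h : A.det = 1) : A.adjugate * A = 1 := by
  rw [Matrix.adjugate_mul, h, one_smul]
theorem reduce (n : ℕ) : ∀ (u v w : ℤ), w.natAbs = n → 0 < -u^2 - v*w → ∃ σ : M2, σ.det = 1 ∧
    mb (σ * !![u, v; w, -u] * σ.adjugate) (2*(-u^2-v*w)) := by
  induction n using Nat.strong_induction_on with
  | _ n ih =>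
  intro u v w hw hN
  have hw0 : w ≠ 0 := by rintro rfl; nlinarith [sq_nonneg u]
  obtain ⟨m, hm⟩ : ∃ m : ℤ, 2*|u + m*w| ≤ |w| := by
    refine ⟨-(round ((u:ℚ)/w)), ?_⟩
    have h1 := abs_sub_round ((u:ℚ)/w)
    have hw' : (w:ℚ) ≠ 0 := by exact_mod_cast hw0
    have h2 : |(u:ℚ) - round ((u:ℚ)/w) * w| ≤ 1/2 * |(w:ℚ)| := by
      have : (u:ℚ) - round ((u:ℚ)/w) * w = ((u:ℚ)/w - round ((u:ℚ)/w)) * w := by field_simp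
      rw [this, abs_mul]; exact mul_le_mul_of_nonneg_right h1 (abs_nonneg _)
    have h3 : 2*|(u:ℚ) + (-(round ((u:ℚ)/w)):ℤ) * w| ≤ |(w:ℚ)| := by
      push_cast; rw [neg_mul, ← sub_eq_add_neg]; linarith
    exact_mod_cast h3
  set u1 := u + m*w with hu1
  set v1 := v - 2*m*u - m^2*w with hv1
  have hN1 : -u1^2 - v1*w = -u^2 - v*w := by rw [hu1, hv1]; ring
  have hT : (!![1, m; 0, 1] : M2) * !![u, v; w, -u] * (!![1, m; 0, 1] : M2).adjugate = !![u1, v1; w, -u1] := by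
    rw [Matrix.adjugate_fin_two_of, hu1, hv1]
    ext i j; fin_cases i <;> fin_cases j <;> simp [Matrix.mul_apply, Fin.sum_univ_two] <;> ring
  have hTd : (!![1, m; 0, 1] : M2).det = 1 := by simp [Matrix.det_fin_two_of]
  by_cases hlt : |v1| < |w|
  · have hS : (!![0, 1; -1, 0] : M2) * !![u1, v1; w, -u1] * (!![0, 1; -1, 0] : M2).adjugate = !![-u1, -w; -v1, -(-u1)] := by
      rw [Matrix.adjugate_fin_two_of]
      ext i j; fin_cases i <;> fin_cases j <;> simp [Matrix.mul_apply, Fin.sum_univ_two]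
    have e2 : -(-u1)^2 - (-w)*(-v1) = -u^2 - v*w := by rw [← hN1]; ring
    obtain ⟨σ, hσ, hb⟩ := ih (-v1).natAbs (by rw [← hw]; zify; rwa [abs_neg]) (-u1) (-w) (-v1) rfl (by rw [e2]; exact hN)
    rw [e2, ← hS, ← hT] at hb
    refine ⟨σ * !![0, 1; -1, 0] * !![1, m; 0, 1], ?_, ?_⟩
    · rw [Matrix.det_mul, Matrix.det_mul, hσ, hTd]; simp [Matrix.det_fin_two_of]
    · rw [Matrix.adjugate_mul_distrib, Matrix.adjugate_mul_distrib]
      simpa only [mul_assoc] using hb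
  · have hge : |w| ≤ |v1| := not_lt.mp hlt
    refine ⟨_, hTd, ?_⟩
    rw [hT]
    set N := -u^2 - v*w with hNN
    have hw1 : 1 ≤ |w| := Int.one_le_abs hw0
    have hvw : |v1| * |w| = N + u1^2 := by
      rw [← abs_mul, show v1*w = -(N + u1^2) by rw [← hN1]; ring, abs_neg, abs_of_pos (by positivity)]
    have hu2 : 4*u1^2 ≤ |w|^2 := by
      rw [← sq_abs u1]; nlinarith [abs_nonneg u1]
    have hw2 : 3*|w|^2 ≤ 4*N := by nlinarith
    have b1 : |w| ≤ 2*N := by nlinarith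
    have b2 : |u1| ≤ 2*N := by linarith [abs_nonneg u1]
    have b3 : |v1| ≤ 2*N := by nlinarith [abs_nonneg v1]
    intro i j
    fin_cases i <;> fin_cases j <;> simp <;> assumption
theorem coprime_shift (c d M : ℕ) (hc : 0 < c) (h : ∀ p : ℕ, p.Prime → p ∣ c → p ∣ d → ¬ p ∣ M) : ∃ j < c, Nat.Coprime c (d + j*M) := by
  set P := ∏ p ∈ c.primeFactors.filter (fun p => ¬ p ∣ d), p with hP
  have key : Nat.Coprime c (d + P*M) := by
    apply Nat.Coprime.symm
    apply Nat.Coprime.symm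
    rw [Nat.coprime_iff_gcd_eq_one]
    by_contra hne
    obtain ⟨p, hp, hpd⟩ := Nat.exists_prime_and_dvd hne
    have h1 := hpd.trans (Nat.gcd_dvd_left _ _)
    have h2 := hpd.trans (Nat.gcd_dvd_right _ _)
    by_cases hd : p ∣ d
    · have h3 : p ∣ P*M := (Nat.dvd_add_right hd).mp h2
      rcases hp.dvd_mul.mp h3 with h4 | h4
      · rw [hP, Prime.dvd_finsetProd_iff hp.prime] at h4
        obtain ⟨q, hq, hpq⟩ := h4
        rw [Finset.mem_filter, Nat.mem_primeFactors] at hq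
        have := (Nat.prime_dvd_prime_iff_eq hp hq.1.1).mp hpq
        exact hq.2 (this ▸ hd)
      · exact h p hp h1 hd h4
    · have h4 : p ∣ P := by
        rw [hP]; apply Finset.dvd_prod_of_mem
        rw [Finset.mem_filter, Nat.mem_primeFactors]; exact ⟨⟨hp, h1, hc.ne'⟩, hd⟩
      exact hd ((Nat.dvd_add_left (h4.mul_right M)).mp h2)
  refine ⟨P % c, Nat.mod_lt _ hc, ?_⟩
  have e : d + P*M = (d + (P%c)*M) + c*((P/c)*M) := by
    conv_lhs => rw [← Nat.mod_add_div P c]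
    ring
  rw [e, Nat.coprime_add_mul_left_right] at key
  exact key
set_option maxHeartbeats 1000000 in
theorem lift2 {M : ℤ} (hM : 2 ≤ M) (σ : M2) (hσ : σ.det = 1) : ∃ σ' E : M2, σ'.det = 1 ∧ σ' = σ + M • E ∧ mb σ' (M^5) := by
  rw [Matrix.det_fin_two] at hσ
  set a := σ 0 0; set b := σ 0 1; set c := σ 1 0; set d := σ 1 1
  have hM0 : 0 < M := by omega
  obtain ⟨c', hc1, hcM, ec, hec⟩ : ∃ c' : ℤ, 1 ≤ c' ∧ c' ≤ M ∧ ∃ ec, c' = c + M*ec := by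
    refine ⟨(c-1)%M+1, by have := Int.emod_nonneg (c-1) hM0.ne'; omega, by have := Int.emod_lt_of_pos (c-1) hM0; omega, -((c-1)/M), ?_⟩
    rw [Int.emod_def]; ring
  obtain ⟨d0, hd0, hd0M, ed0, hed0⟩ : ∃ d0 : ℤ, 0 ≤ d0 ∧ d0 + 1 ≤ M ∧ ∃ ed, d0 = d + M*ed :=
    ⟨d%M, Int.emod_nonneg d hM0.ne', Int.emod_lt_of_pos d hM0, -(d/M), by rw [Int.emod_def]; ring⟩
  obtain ⟨j, hj, hjc⟩ := coprime_shift c'.toNat d0.toNat M.toNat (by omega) (by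
    intro p hp h1 h2 h3
    have h1' : (p:ℤ) ∣ c' := by rw [← Int.toNat_of_nonneg (show 0 ≤ c' by omega)]; exact_mod_cast h1
    have h2' : (p:ℤ) ∣ d0 := by rw [← Int.toNat_of_nonneg hd0]; exact_mod_cast h2
    have h3' : (p:ℤ) ∣ M := by rw [← Int.toNat_of_nonneg hM0.le]; exact_mod_cast h3
    have h4 : (p:ℤ) ∣ 1 := by
      rw [← hσ, show a*d - b*c = a*d0 - b*c' + M*(b*ec - a*ed0) by rw [hec, hed0]; ring]
      exact dvd_add (dvd_sub (h2'.mul_left _) (h1'.mul_left _)) (h3'.mul_right _)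
    exact (Nat.prime_iff_prime_int.mp hp).not_dvd_one h4)
  set d' : ℤ := d0 + j*M with hd'
  have hco : IsCoprime c' d' := by
    have := Nat.isCoprime_iff_coprime.mpr hjc
    push_cast at this
    rw [Int.toNat_of_nonneg (show 0 ≤ c' by omega), Int.toNat_of_nonneg hd0, Int.toNat_of_nonneg hM0.le] at this
    exact this
  have hjM : (j:ℤ) + 1 ≤ M := by omega
  have hd'0 : 0 ≤ d' := by positivity
  have hd'M : d' ≤ M^2 := by rw [hd']; nlinarith
  obtain ⟨b1, a1, h1⟩ := hco
  have had : a*d' - b*c' = 1 + M*(a*(ed0+j) - b*ec) := by rw [hd', hed0, hec]; linear_combination hσ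
  set W := a*(ed0+j) - b*ec with hW
  set m := b*a1 + a*b1 with hm
  set a2 := a1 + m*c' with ha2
  set b2 := -b1 + m*d' with hb2
  have e1 : a2 = a + M*(-(W*a1)) := by rw [ha2, hm]; linear_combination a*h1 - a1*had
  have e2 : b2 = b + M*(W*b1) := by rw [hb2, hm]; linear_combination b*h1 + b1*had
  have hMc : 0 < M*c' := by positivity
  set t := a2/(M*c') with ht
  set a' := a2 % (M*c') with ha'
  have ha't : a' = a2 - (M*c')*t := by rw [ha', ht, Int.emod_def]
  set b' := b2 - M*d'*t with hb'
  have hdet : a'*d' - b'*c' = 1 := by rw [ha't, hb', ha2, hb2]; linear_combination h1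
  have ha'0 : 0 ≤ a' := Int.emod_nonneg _ hMc.ne'
  have ha'1 : a' ≤ M*c' := (Int.emod_lt_of_pos _ hMc).le
  have ha'2 : a' ≤ M^2 := by nlinarith
  clear_value a' b' t d'
  have hM2 : 0 < M^2 := by positivity
  have p1 : M ≤ M^5 := le_self_pow₀ (by omega) (by norm_num)
  have p2 : M^2 ≤ M^5 := pow_le_pow_right₀ (by omega) (by norm_num)
  have p4 : M^4 + 1 ≤ M^5 := by
    have : 1 ≤ M^4 := one_le_pow₀ (by omega)
    rw [pow_succ]; nlinarith
  have hbb : |b'| ≤ M^5 := by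
    have q1 : |b'| * c' = |a'*d' - 1| := by
      have : a'*d' - 1 = b'*c' := by linarith
      rw [this, abs_mul, abs_of_pos (a := c') (by omega)]
    have q2 : |a'*d' - 1| ≤ M^4 + 1 := by
      have : a'*d' ≤ M^2*M^2 := mul_le_mul ha'2 hd'M hd'0 hM2.le
      have : 0 ≤ a'*d' := mul_nonneg ha'0 hd'0
      rw [abs_le]; constructor <;> linarith
    have q3 : |b'| ≤ |b'| * c' := le_mul_of_one_le_right (abs_nonneg _) hc1
    linarith
  refine ⟨!![a', b'; c', d'], !![-(W*a1) - c'*t, W*b1 - d'*t; ec, ed0+j], ?_, ?_, ?_⟩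
  · rw [Matrix.det_fin_two_of, hdet]
  · ext i k
    fin_cases i <;> fin_cases k <;> simp
    · change a' = a + _; rw [ha't, e1]; ring
    · change b' = b + _; rw [hb', e2]; ring
    · exact hec
    · change d' = d + _; rw [hd', hed0]; ring
  · intro i k
    fin_cases i <;> fin_cases k <;> simp
    · rw [abs_of_nonneg ha'0]; omega
    · exact hbb
    · rw [abs_of_pos (by omega)]; omega
    · rw [abs_of_nonneg hd'0]; omega
def rho {α b : ℤ} (x : HA ℤ α (b^2)) : M2 := !![x.re + b*x.imJ, α*x.imI - α*b*x.imK; x.imI + b*x.imK, x.re - b*x.imJ]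
theorem rho_mul {α b : ℤ} (x y : HA ℤ α (b^2)) : rho (x*y) = rho x * rho y := by
  ext i j; fin_cases i <;> fin_cases j <;> simp [rho, Matrix.mul_apply, Fin.sum_univ_two] <;> ring
theorem rho_star {α b : ℤ} (x : HA ℤ α (b^2)) : rho (star x) = (rho x).adjugate := by
  rw [rho, rho, Matrix.adjugate_fin_two_of]
  ext i j; fin_cases i <;> fin_cases j <;> simp <;> ring
theorem rho_det {α b : ℤ} (x : HA ℤ α (b^2)) : (rho x).det = nrd x := by
  rw [rho, Matrix.det_fin_two_of, nrd]; ring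
theorem abs_le_of_mul {n x E : ℤ} (hn : 1 ≤ n) (h : |n*x| ≤ n*E) : |x| ≤ E := by
  rw [abs_mul, abs_of_pos (by omega)] at h
  exact le_of_mul_le_mul_left h (by omega)
theorem rho_bd {α b E : ℤ} (hα : 1 ≤ α) (hb : 1 ≤ b) {x : HA ℤ α (b^2)} (h : mb (rho x) E) : bd x E := by
  have h00 := h 0 0
  have h01 := h 0 1
  have h10 := h 1 0
  have h11 := h 1 1
  have hE : 0 ≤ E := (abs_nonneg _).trans h00
  simp [rho] at h00 h01 h10 h11
  rw [abs_le] at h00 h01 h10 h11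
  have k1 : |α*(x.imI - b*x.imK)| ≤ α*E := by
    have : E ≤ α*E := le_mul_of_one_le_left hE hα
    rw [abs_le]; constructor <;> linarith
  have k1 := abs_le_of_mul hα k1
  rw [abs_le] at k1
  have hbE : E ≤ b*E := le_mul_of_one_le_left hE hb
  refine ⟨?_, ?_, ?_, ?_⟩
  · rw [abs_le]; constructor <;> linarith
  · rw [abs_le]; constructor <;> linarith
  · apply abs_le_of_mul hb; rw [abs_le]; constructor <;> linarith
  · apply abs_le_of_mul hb; rw [abs_le]; constructor <;> linarith
theorem T_iso : ∃ k : ℕ, ∀ {α b B Q : ℤ}, 2 ≤ B → 1 ≤ α → 1 ≤ b → α ≤ B → b ≤ B → 1 ≤ Q → Q ≤ B →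
    ∀ (x : HA ℤ α (b^2)), x.re = 0 → 0 < nrd x → nrd x ≤ B →
    ∃ δ, Gam α (b^2) Q δ ∧ bd (δ*x*star δ) (B^k) := by
  refine ⟨44, ?_⟩
  intro α b B Q hB hα hb hαB hbB hQ hQB x h0 hN hNB
  have hX : rho x = !![b*x.imJ, α*x.imI - α*b*x.imK; x.imI + b*x.imK, -(b*x.imJ)] := by
    rw [rho, h0]; simp
  have hNe : nrd x = -(b*x.imJ)^2 - (α*x.imI - α*b*x.imK)*(x.imI + b*x.imK) := by rw [nrd, h0]; ring
  obtain ⟨σ, hσ, hσb⟩ := reduce _ (b*x.imJ) (α*x.imI - α*b*x.imK) (x.imI + b*x.imK) rfl (by rw [← hNe]; exact hN)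
  rw [← hX, ← hNe] at hσb
  set M := 2*α*b*Q with hM
  have hM1 : 1 ≤ α*b*Q := by
    have : 1 ≤ α*b := one_le_mul_of_one_le_of_one_le hα hb
    exact one_le_mul_of_one_le_of_one_le this hQ
  have hM2 : 2 ≤ M := by rw [hM]; linarith
  have hMB : M ≤ B^4 := by
    have h1 : α*b ≤ B*B := mul_le_mul hαB hbB (by omega) (by omega)
    have h2 : (α*b)*Q ≤ (B*B)*B := mul_le_mul h1 hQB (by omega) (by positivity)
    have h3 : 2*((α*b)*Q) ≤ B*((B*B)*B) := mul_le_mul hB h2 (by linarith) (by omega)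
    rw [hM]; linarith [show B*((B*B)*B) = B^4 by ring]
  obtain ⟨τ, E, hτ, hτE, hτb⟩ := lift2 hM2 σ hσ
  set F := -(τ.adjugate * E) with hF
  have hD : τ.adjugate * σ = 1 + M • F := by
    have : σ = τ - M • E := by rw [hτE]; abel
    rw [this, mul_sub, adj_mul_self hτ, hF, Matrix.mul_smul, smul_neg, sub_eq_add_neg]
  let δ : HA ℤ α (b^2) := ⟨1 + α*b*Q*(F 0 0 + F 1 1), Q*(α*b*F 1 0 + b*F 0 1), Q*(α*(F 0 0 - F 1 1)), Q*(α*F 1 0 - F 0 1)⟩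
  have hδ : rho δ = τ.adjugate * σ := by
    have hMF : ∀ i j, (M • F) i j = 2*α*b*Q*F i j := fun i j => by rw [Matrix.smul_apply, smul_eq_mul]
    rw [hD, rho]
    generalize M • F = G at hMF
    ext i j; fin_cases i <;> fin_cases j <;> simp [δ, hMF] <;> ring
  have hn : nrd δ = 1 := by
    rw [← rho_det, hδ, Matrix.det_mul, hσ, Matrix.det_adjugate, hτ]; simp
  refine ⟨δ, ⟨hn, Dvd.intro _ rfl, Dvd.intro _ rfl, Dvd.intro _ rfl⟩, ?_⟩
  apply rho_bd hα hb
  have e : rho (δ*x*star δ) = τ.adjugate * (σ * rho x * σ.adjugate) * τ := by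
    rw [rho_mul, rho_mul, rho_star, hδ, Matrix.adjugate_mul_distrib, Matrix.adjugate_adjugate _ (by simp)]
    simp [mul_assoc]
  rw [e]
  intro i j
  refine ((hτb.adj.mul hσb).mul hτb i j).trans ?_
  have hM5 : M^5 ≤ B^20 := (pow_le_pow_left₀ (by omega) hMB 5).trans (le_of_eq (by ring))
  have hM50 : 0 ≤ M^5 := by positivity
  have k1 : M^5 * M^5 ≤ B^20*B^20 := mul_le_mul hM5 hM5 hM50 (by positivity)
  have k2 : (M^5*M^5)*nrd x ≤ (B^20*B^20)*B := mul_le_mul k1 hNB hN.le (by positivity)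
  have k3 : 2*2*2 ≤ B*B*B := by
    have : 2*2 ≤ B*B := mul_le_mul hB hB (by norm_num) (by omega)
    exact mul_le_mul this hB (by norm_num) (by positivity)
  have k4 : (2*2*2)*((M^5*M^5)*nrd x) ≤ (B*B*B)*((B^20*B^20)*B) := mul_le_mul k3 k2 (by positivity) (by positivity)
  calc _ = (2*2*2)*((M^5*M^5)*nrd x) := by ring
    _ ≤ _ := k4
    _ = B^44 := by ring
end
section
open Matrix
abbrev V3 := Fin 3 → ℤ
abbrev M3 := Matrix (Fin 3) (Fin 3) ℤ
def q (f : M3) (x y : V3) : ℤ := x ⬝ᵥ f *ᵥ y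
def vb (v : V3) (x : ℤ) : Prop := ∀ i, |v i| ≤ x
def mb3 (A : M3) (x : ℤ) : Prop := ∀ i j, |A i j| ≤ x
theorem q_addl (f : M3) (x y z : V3) : q f (x+y) z = q f x z + q f y z := by simp [q]
theorem q_addr (f : M3) (x y z : V3) : q f x (y+z) = q f x y + q f x z := by simp [q, mulVec_add]
theorem q_smull (f : M3) (c : ℤ) (x y : V3) : q f (c • x) y = c * q f x y := by
  rw [q, smul_dotProduct, smul_eq_mul, q]
theorem q_smulr (f : M3) (c : ℤ) (x y : V3) : q f x (c • y) = c * q f x y := by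
  rw [q, mulVec_smul, dotProduct_smul, smul_eq_mul, q]
theorem q_comm {f : M3} (hf : fᵀ = f) (x y : V3) : q f x y = q f y x := by
  rw [q, q, dotProduct_mulVec, ← mulVec_transpose, hf, dotProduct_comm]
theorem q_conj (f A : M3) (x y : V3) : q (Aᵀ * f * A) x y = q f (A *ᵥ x) (A *ᵥ y) := by
  rw [q, q, ← mulVec_mulVec, ← mulVec_mulVec, dotProduct_mulVec, vecMul_transpose]
theorem q_single (f : M3) (i j : Fin 3) : q f (Pi.single i 1) (Pi.single j 1) = f i j := by
  simp [q]
theorem dot_bd {x y : V3} {X Y : ℤ} (hx : vb x X) (hy : vb y Y) : |x ⬝ᵥ y| ≤ 3*X*Y := by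
  have h : ∀ k, |x k * y k| ≤ X*Y := fun k => by
    rw [abs_mul]; exact mul_le_mul (hx k) (hy k) (abs_nonneg _) ((abs_nonneg _).trans (hx k))
  rw [dotProduct, Fin.sum_univ_three]
  have h0 := h 0; have h1 := h 1; have h2 := h 2
  rw [abs_le] at *
  constructor <;> linarith
theorem mv_bd {A : M3} {y : V3} {X Y : ℤ} (hx : mb3 A X) (hy : vb y Y) : vb (A *ᵥ y) (3*X*Y) :=
  fun i => dot_bd (hx i) hy
theorem q_bd {A : M3} {x y : V3} {F X Y : ℤ} (hA : mb3 A F) (hx : vb x X) (hy : vb y Y) : |q A x y| ≤ 9*F*X*Y :=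
  (dot_bd hx (mv_bd hA hy)).trans (le_of_eq (by ring))
theorem adj_bd {A : M3} {X : ℤ} (h : mb3 A X) : mb3 A.adjugate (2*X^2) := by
  have key : ∀ i j k l, |A i j * A k l| ≤ X^2 := fun i j k l => by
    rw [abs_mul, sq]; exact mul_le_mul (h i j) (h k l) (abs_nonneg _) ((abs_nonneg _).trans (h i j))
  have k2 : ∀ i j k l i' j' k' l', |A i j * A k l - A i' j' * A k' l'| ≤ 2*X^2 := fun i j k l i' j' k' l' =>
    (abs_sub _ _).trans (by linarith [key i j k l, key i' j' k' l'])
  intro i j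
  rw [adjugate_fin_three]
  fin_cases i <;> fin_cases j <;> simp [neg_add_eq_sub] <;> apply k2
theorem det_bd {A : M3} {X : ℤ} (h : mb3 A X) : |A.det| ≤ 6*X^3 := by
  have e : A.det = (A * A.adjugate) 0 0 := by rw [mul_adjugate]; simp
  rw [e, mul_apply']
  exact (dot_bd (h 0) (fun i => adj_bd h i 0)).trans (le_of_eq (by ring))
theorem cs_scalar {X Y t : ℤ} (h : ∀ u v : ℤ, 0 ≤ u^2*X + 2*u*v*t + v^2*Y) : t^2 ≤ X*Y := by
  have hY : 0 ≤ Y := by simpa using h 0 1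
  have hX : 0 ≤ X := by simpa using h 1 0
  rcases hY.eq_or_lt with h0 | h0
  · have h1 := h 1 (-(X+1)*t)
    rw [← h0] at h1 ⊢
    have : t^2 ≤ 0 := by
      by_contra hc
      push Not at hc
      nlinarith
    linarith
  · have h1 := h Y (-t)
    have : 0 ≤ Y*(X*Y - t^2) := by linarith [show Y*(X*Y-t^2) = Y^2*X + 2*Y*(-t)*t + (-t)^2*Y by ring]
    linarith [nonneg_of_mul_nonneg_right this h0]
theorem rcs {a b c x y z u v w : ℤ} (ha : 0 < a) (hb : 0 < b) (hc : c < 0) (hn : a*u^2+b*v^2+c*w^2 < 0) :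
    0 ≤ (a*u*x+b*v*y+c*w*z)^2 - (a*u^2+b*v^2+c*w^2)*(a*x^2+b*y^2+c*z^2) := by
  set r := u*y - v*x
  set s := u*z - w*x
  set t := v*z - w*y
  have e : (a*u*x+b*v*y+c*w*z)^2 - (a*u^2+b*v^2+c*w^2)*(a*x^2+b*y^2+c*z^2) = -(a*b*r^2 + a*c*s^2+b*c*t^2) := by
    simp only [r,s,t]; ring
  rw [e]
  have hrel : w*r = v*s - u*t := by simp only [r,s,t]; ring
  have hw : 0 < w^2 := by
    rcases eq_or_ne w 0 with rfl | h
    · nlinarith [sq_nonneg u, sq_nonneg v]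
    · positivity
  have k : (w*r)^2 * (a*b) ≤ (b*t^2 + a*s^2)*(a*u^2+b*v^2) := by
    rw [hrel]; nlinarith [sq_nonneg (a*u*s + b*v*t)]
  have k2 : (b*t^2 + a*s^2)*(a*u^2+b*v^2) ≤ (b*t^2 + a*s^2)*(-c*w^2) :=
    mul_le_mul_of_nonneg_left (by linarith) (by positivity)
  have k3 : w^2*(a*b*r^2) ≤ w^2*(-c*(b*t^2 + a*s^2)) := by linarith [show w^2*(a*b*r^2) = (w*r)^2 * (a*b) by ring, show w^2*(-c*(b*t^2 + a*s^2)) = (b*t^2 + a*s^2)*(-c*w^2) by ring]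
  have k4 := le_of_mul_le_mul_left k3 hw
  linarith
structure Frame (f : M3) (x y z : V3) : Prop where
  xy : q f x y = 0
  xz : q f x z = 0
  yz : q f y z = 0
  x0 : 0 < q f x x
  y0 : 0 < q f y y
  z0 : q f z z < 0
def fm (x y z : V3) : M3 := (of ![x,y,z])ᵀ
theorem fm_mulVec (x y z v : V3) : fm x y z *ᵥ v = v 0 • x + v 1 • y + v 2 • z := by
  ext i; simp [fm, mulVec, dotProduct, Fin.sum_univ_three]; ring
theorem orth_conj {f : M3} {x y z : V3} (hf : fᵀ = f) (h1 : q f x y = 0) (h2 : q f x z = 0) (h3 : q f y z = 0) :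
    (fm x y z)ᵀ * f * fm x y z = diagonal ![q f x x, q f y y, q f z z] := by
  have hc : ∀ i, fm x y z *ᵥ Pi.single i 1 = ![x,y,z] i := by
    intro i; rw [fm_mulVec]; fin_cases i <;> simp
  have h1' := h1; have h2' := h2; have h3' := h3
  rw [q_comm hf] at h1' h2' h3'
  ext i j
  rw [← q_single ((fm x y z)ᵀ * f * fm x y z), q_conj, hc, hc]
  fin_cases i <;> fin_cases j <;> simp [*]
def Good (α β : ℤ) : Prop := Aniso α β ∨ ∃ b, 1 ≤ b ∧ β = b^2
theorem aniso_of_diag {a b c : ℤ} (ha : 0 < a) (hb : 0 < b) (hc : c < 0)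
    (h : ∀ x y z : ℤ, a*x^2+b*y^2+c*z^2 = 0 → x = 0 ∧ y = 0 ∧ z = 0) : Aniso (-b*c) (-a*c) := by
  obtain ⟨α, hα⟩ : ∃ α, α = -b*c := ⟨_, rfl⟩
  obtain ⟨β, hβ⟩ : ∃ β, β = -a*c := ⟨_, rfl⟩
  rw [← hα, ← hβ]
  have hα0 : 0 < α := by nlinarith
  have hβ0 : 0 < β := by nlinarith
  have pure : ∀ z : HA ℤ α β, z.re = 0 → nrd z = 0 → z = 0 := by
    intro z h0 hz
    have e : c*(b*z.imI^2 + a*z.imJ^2 + a*b*c*z.imK^2) = 0 := by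
      rw [nrd, h0] at hz
      linear_combination hz + hα*(z.imI^2 - β*z.imK^2) + hβ*(z.imJ^2 + b*c*z.imK^2)
    have e := (mul_eq_zero.mp e).resolve_left hc.ne
    obtain ⟨h1,h2,h3⟩ := h (b*z.imI) (a*z.imJ) (a*b*z.imK) (by linear_combination a*b*e)
    exact QuaternionAlgebra.ext h0 ((mul_eq_zero.mp h1).resolve_left hb.ne') ((mul_eq_zero.mp h2).resolve_left ha.ne')
      ((mul_eq_zero.mp h3).resolve_left (by positivity))
  intro x hx
  let l : HA ℤ α β := ⟨0, β*x.imJ, -(α*x.imI), 0⟩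
  have hl : l * x = 0 := by
    apply pure
    · simp only [re_mul, l]; ring
    · rw [nrd_mul, hx, mul_zero]
  have h2 : nrd l • x = 0 := by
    have : star l * (l * x) = 0 := by rw [hl, mul_zero]
    rwa [← mul_assoc, star_mul', smul_mul_assoc, one_mul] at this
  by_cases hn : nrd l = 0
  · have hn : α*β*(β*x.imJ^2 + α*x.imI^2) = 0 := by
      rw [nrd] at hn; simp only [l] at hn; linear_combination -hn
    have hn := (mul_eq_zero.mp hn).resolve_left (by positivity)
    have j0 : x.imJ = 0 := by
      by_contra hh; have : 0 < x.imJ^2 := by positivity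
      nlinarith [sq_nonneg x.imI]
    have i0 : x.imI = 0 := by
      by_contra hh; have : 0 < x.imI^2 := by positivity
      nlinarith [sq_nonneg x.imJ]
    rw [nrd, i0, j0] at hx
    have hab : 0 < α*β := by positivity
    have k0 : x.imK = 0 := by
      by_contra hh; have : 0 < x.imK^2 := by positivity
      nlinarith [sq_nonneg x.re]
    have r0 : x.re = 0 := by
      rw [k0] at hx; simpa using hx
    exact QuaternionAlgebra.ext r0 i0 j0 k0
  · exact (smul_eq_zero.mp h2).resolve_left hn
end
section
open Matrix
theorem orth_det {f : M3} {x y z : V3} (hf : fᵀ = f) (h1 : q f x y = 0) (h2 : q f x z = 0) (h3 : q f y z = 0) :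
    (fm x y z).det^2 * f.det = q f x x * q f y y * q f z z := by
  have h := congrArg Matrix.det (orth_conj hf h1 h2 h3)
  rw [det_mul, det_mul, det_transpose, det_diagonal, Fin.prod_univ_three] at h
  simp at h
  linarith
theorem orth_expand {f : M3} {x y z : V3} (hf : fᵀ = f) (h1 : q f x y = 0) (h2 : q f x z = 0) (h3 : q f y z = 0) (c v : V3) :
    q f (fm x y z *ᵥ c) (fm x y z *ᵥ v) = q f x x * c 0 * v 0 + q f y y * c 1 * v 1 + q f z z * c 2 * v 2 := by
  rw [← q_conj, orth_conj hf h1 h2 h3, q]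
  simp [mulVec_diagonal, dotProduct, Fin.sum_univ_three]; ring
theorem fm_adj (x y z v : V3) : fm x y z *ᵥ ((fm x y z).adjugate *ᵥ v) = (fm x y z).det • v := by
  rw [mulVec_mulVec, mul_adjugate, smul_mulVec, one_mulVec]
theorem frame_of_orth {f : M3} {x y z : V3} (hf : fᵀ = f) (h1 : q f x y = 0) (h2 : q f x z = 0) (h3 : q f y z = 0)
    (hx : q f x x ≠ 0) (hy : q f y y ≠ 0) (hz : q f z z ≠ 0) (hd : f.det < 0) (hp : ∃ v, 0 < q f v v) :
    Frame f x y z ∨ Frame f x z y ∨ Frame f y z x := by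
  have hD := orth_det hf h1 h2 h3
  have hs : (fm x y z).det ≠ 0 := by
    intro h; rw [h] at hD
    have : q f x x * q f y y * q f z z ≠ 0 := by positivity
    apply this; rw [← hD]; ring
  have hs2 : 0 < (fm x y z).det^2 := by positivity
  have hneg : q f x x * q f y y * q f z z < 0 := by rw [← hD]; exact mul_neg_of_pos_of_neg hs2 hd
  obtain ⟨v, hv⟩ := hp
  have he := orth_expand hf h1 h2 h3 ((fm x y z).adjugate *ᵥ v) ((fm x y z).adjugate *ᵥ v)
  rw [fm_adj, q_smull, q_smulr] at he
  set c := (fm x y z).adjugate *ᵥ v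
  have hpos : 0 < q f x x * c 0 * c 0 + q f y y * c 1 * c 1 + q f z z * c 2 * c 2 := by
    rw [← he, ← mul_assoc, ← sq]; positivity
  have h1' := h1; have h2' := h2; have h3' := h3
  rw [q_comm hf] at h1' h2' h3'
  rcases hx.lt_or_gt with hx | hx <;> rcases hy.lt_or_gt with hy | hy <;> rcases hz.lt_or_gt with hz | hz
  · exfalso
    nlinarith [mul_self_nonneg (c 0), mul_self_nonneg (c 1), mul_self_nonneg (c 2)]
  · exact absurd hneg (not_lt.mpr (mul_pos (mul_pos_of_neg_of_neg hx hy) hz).le)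
  · exact absurd hneg (not_lt.mpr (mul_pos_of_neg_of_neg (mul_neg_of_neg_of_pos hx hy) hz).le)
  · exact Or.inr (Or.inr ⟨h3, h1', h2', hy, hz, hx⟩)
  · exact absurd hneg (not_lt.mpr (mul_pos_of_neg_of_neg (mul_neg_of_pos_of_neg hx hy) hz).le)
  · exact Or.inr (Or.inl ⟨h2, h1, h3', hx, hz, hy⟩)
  · exact Or.inl ⟨h1, h2, h3, hx, hy, hz⟩
  · exact absurd hneg (not_lt.mpr (by positivity))
theorem good_aniso {f : M3} {x y z : V3} (hf : fᵀ = f) (h : Frame f x y z) (han : ∀ v, q f v v = 0 → v = 0) :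
    Good (-q f y y * q f z z) (-q f x x * q f z z) := by
  left
  apply aniso_of_diag h.x0 h.y0 h.z0
  intro X Y Z hq
  have e := orth_expand hf h.xy h.xz h.yz
  have h0 : fm x y z *ᵥ ![X,Y,Z] = 0 := by
    apply han; rw [e]; simp; linarith
  have k : ∀ c : V3, q f x x * X * c 0 + q f y y * Y * c 1 + q f z z * Z * c 2 = 0 := by
    intro c
    have := e ![X,Y,Z] c
    rw [h0, show q f 0 (fm x y z *ᵥ c) = 0 by simp [q]] at this; simp at this; linarith
  have k0 := k ![1,0,0]; have k1 := k ![0,1,0]; have k2 := k ![0,0,1]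
  simp at k0 k1 k2
  exact ⟨k0.resolve_left h.x0.ne', k1.resolve_left h.y0.ne', k2.resolve_left h.z0.ne⟩
theorem frame_aniso {f : M3} {B : ℤ} (hB : 2 ≤ B) (hb : mb3 f B) (hf : fᵀ = f) (hd : f.det < 0) (hp : ∃ v, 0 < q f v v)
    (han : ∀ v, q f v v = 0 → v = 0) : ∃ x y z, Frame f x y z ∧ vb x (B^34) ∧ vb y (B^34) ∧ vb z (B^34) ∧
      Good (-q f y y * q f z z) (-q f x x * q f z z) := by
  have hs : ∀ i j, f i j = f j i := fun i j => by conv_lhs => rw [← hf, transpose_apply]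
  set u : V3 := Pi.single 0 1 with hu
  set v : V3 := ![-(f 0 1), f 0 0, 0] with hv
  set w : V3 := f.adjugate *ᵥ Pi.single 2 1 with hw
  have hfw : f *ᵥ w = f.det • Pi.single 2 1 := by
    rw [hw, mulVec_mulVec, mul_adjugate, smul_mulVec, one_mulVec]
  have huu : q f u u = f 0 0 := q_single f 0 0
  have hu0 : q f u u ≠ 0 := fun h => by
    have := congrFun (han u h) 0; simp [hu] at this
  rw [huu] at hu0
  have huv : q f u v = 0 := by simp [q, hu, hv, mulVec, dotProduct, Fin.sum_univ_three]; ring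
  have hvv : q f v v = f 0 0 * (f 0 0 * f 1 1 - f 0 1 * f 1 0) := by
    simp [q, hv, mulVec, dotProduct, Fin.sum_univ_three, hs 1 0]; ring
  have hv0 : q f v v ≠ 0 := fun h => by
    have := congrFun (han v h) 1; simp [hv] at this; exact hu0 this
  have huw : q f u w = 0 := by rw [q, hfw, dotProduct_smul, dotProduct_single]; simp [hu]
  have hvw : q f v w = 0 := by rw [q, hfw, dotProduct_smul, dotProduct_single]; simp [hv]
  have hw2 : w 2 = f 0 0 * f 1 1 - f 0 1 * f 1 0 := by
    rw [hw, adjugate_fin_three]; simp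
  have hww : q f w w ≠ 0 := by
    rw [q, hfw, dotProduct_smul, dotProduct_single, hw2]
    rw [hvv] at hv0
    have := right_ne_zero_of_mul hv0
    simp [hd.ne, this]
  have hB1 : 1 ≤ B := by omega
  have hB34 : B ≤ B^34 := le_self_pow₀ hB1 (by norm_num)
  have bu : vb u (B^34) := by
    intro i
    have : |u i| ≤ 1 := by rw [hu]; fin_cases i <;> simp
    linarith
  have bv : vb v (B^34) := by
    intro i
    refine le_trans ?_ hB34
    fin_cases i <;> simp [hv]
    · exact hb 0 1
    · exact hb 0 0
    · omega
  have bw : vb w (B^34) := by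
    intro i
    have : w i = f.adjugate i 2 := by rw [hw]; simp
    rw [this]
    refine (adj_bd hb i 2).trans ?_
    calc 2*B^2 ≤ B*B^2 := by gcongr
      _ = B^3 := by ring
      _ ≤ B^34 := pow_le_pow_right₀ hB1 (by norm_num)
  rcases frame_of_orth hf huv huw hvw (by rw [huu]; exact hu0) hv0 hww hd hp with h | h | h
  · exact ⟨_, _, _, h, bu, bv, bw, good_aniso hf h han⟩
  · exact ⟨_, _, _, h, bu, bw, bv, good_aniso hf h han⟩
  · exact ⟨_, _, _, h, bv, bw, bu, good_aniso hf h han⟩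
theorem cross_bd {x y : V3} {X Y : ℤ} (hx : vb x X) (hy : vb y Y) : vb (crossProduct x y) (2*X*Y) := by
  have key : ∀ i j, |x i * y j| ≤ X*Y := fun i j => by
    rw [abs_mul]; exact mul_le_mul (hx i) (hy j) (abs_nonneg _) ((abs_nonneg _).trans (hx i))
  have k2 : ∀ i j k l, |x i * y j - x k * y l| ≤ 2*X*Y := fun i j k l =>
    (abs_sub _ _).trans (by linarith [key i j, key k l])
  intro i
  rw [cross_apply]
  fin_cases i <;> simp <;> apply k2
theorem mul_cross (f : M3) (x y : V3) : fᵀ *ᵥ crossProduct (f *ᵥ x) (f *ᵥ y) = f.det • crossProduct x y := by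
  rw [det_fin_three, cross_apply, cross_apply]
  ext i
  fin_cases i <;> simp [mulVec, dotProduct, Fin.sum_univ_three] <;> ring
theorem small_iso {f : M3} {B : ℤ} (hB : 2 ≤ B) (hb : mb3 f B) (hf : fᵀ = f) (hd : f.det ≠ 0) {v : V3} (hv : v ≠ 0)
    (hv0 : q f v v = 0) : ∃ e, e ≠ 0 ∧ q f e e = 0 ∧ vb e (B^11) := by
  obtain ⟨w, hw, hw0, hwb⟩ := cassels' (n := 3) (by norm_num) f 1 (B := (B:ℝ)) (by exact_mod_cast (by omega : (1:ℤ) ≤ B))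
    (fun i j => by exact_mod_cast hb i j) hf hd (by simp) v hv hv0
  refine ⟨w, hw, hw0, fun i => ?_⟩
  have h1 := hwb i
  rw [one_mulVec] at h1
  have h2 : |w i| ≤ 2*(3*3*B)^2+1 := by
    have : |(w i : ℝ)| ≤ 2*(3*3*B)^2+1 := by simpa [cst] using h1
    exact_mod_cast this
  refine h2.trans ?_
  have hB1 : 1 ≤ B := by omega
  calc 2*(3*3*B)^2+1 = 162*B^2+1 := by ring
    _ ≤ 162*B^2+B^2 := by have : 1 ≤ B^2 := one_le_pow₀ hB1; omega
    _ ≤ 2^8*B^2 := by nlinarith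
    _ ≤ B^8*B^2 := by gcongr
    _ ≤ B^11 := by rw [← pow_add]; exact pow_le_pow_right₀ hB1 (by norm_num)
theorem frame_iso {f : M3} {B : ℤ} (hB : 2 ≤ B) (hb : mb3 f B) (hf : fᵀ = f) (hd : f.det < 0)
    {v : V3} (hv : v ≠ 0) (hv0 : q f v v = 0) : ∃ x y z, Frame f x y z ∧ vb x (B^34) ∧ vb y (B^34) ∧ vb z (B^34) ∧
      Good (-q f y y * q f z z) (-q f x x * q f z z) := by
  have hB1 : 1 ≤ B := by omega
  obtain ⟨e, he, hee, heb⟩ := small_iso hB hb hf hd.ne hv hv0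
  obtain ⟨i, hi⟩ : ∃ i, (f *ᵥ e) i ≠ 0 := by
    by_contra hc
    push Not at hc
    exact he (eq_zero_of_mulVec_eq_zero hd.ne (funext hc))
  set ν := (f *ᵥ e) i with hν
  have hνe : q f (Pi.single i 1) e = ν := by simp [q, hν]
  have hνe' : q f e (Pi.single i 1) = ν := by rw [q_comm hf, hνe]
  obtain ⟨d, hdd⟩ : ∃ d : V3, d = (2*ν) • (Pi.single i 1 : V3) + (-(f i i)) • e := ⟨_, rfl⟩
  have hed : q f e d = 2*ν^2 := by
    rw [hdd, q_addr, q_smulr, q_smulr, hee, hνe']; ring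
  have hde : q f d e = 2*ν^2 := by rw [q_comm hf, hed]
  have hddq : q f d d = 0 := by
    have : q f d d = 2*ν*q f (Pi.single i 1) d + -(f i i)*q f e d := by
      conv_lhs => enter [2]; rw [hdd]
      rw [q_addl, q_smull, q_smull]
    rw [this, hed, hdd, q_addr, q_smulr, q_smulr, hνe, q_single]; ring
  set y := crossProduct (f *ᵥ e) (f *ᵥ d) with hy
  have hfy : f *ᵥ y = f.det • crossProduct e d := by
    have := mul_cross f e d
    rwa [hf] at this
  have hey : q f e y = 0 := by rw [q, hfy, dotProduct_smul, dot_self_cross, smul_zero]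
  have hdy : q f d y = 0 := by rw [q, hfy, dotProduct_smul, dot_cross_self, smul_zero]
  have hye : q f y e = 0 := by rw [q_comm hf, hey]
  have hyd : q f y d = 0 := by rw [q_comm hf, hdy]
  have hyy : q f y y = -f.det * (2*ν^2)^2 := by
    have c1 : (f *ᵥ e) ⬝ᵥ e = 0 := by rw [dotProduct_comm]; exact hee
    have c2 : (f *ᵥ e) ⬝ᵥ d = 2*ν^2 := by rw [dotProduct_comm]; exact hde
    have c3 : (f *ᵥ d) ⬝ᵥ e = 2*ν^2 := by rw [dotProduct_comm]; exact hed
    rw [q, hfy, dotProduct_smul, hy, cross_dot_cross, c1, c2, c3, smul_eq_mul]; ring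
  have hν2 : 0 < ν^2 := by positivity
  have hxx : q f (e + d) (e + d) = 4*ν^2 := by
    rw [q_addl, q_addr, q_addr, hee, hed, hde, hddq]; ring
  have hzz : q f (e + (-1:ℤ) • d) (e + (-1:ℤ) • d) = -(4*ν^2) := by
    simp only [q_addl, q_addr, q_smull, q_smulr, hee, hed, hde, hddq]; ring
  have fr : Frame f (e + d) y (e + (-1:ℤ) • d) := by
    refine ⟨?_, ?_, ?_, ?_, ?_, ?_⟩
    · rw [q_addl, hey, hdy]; rfl
    · simp only [q_addl, q_addr, q_smulr, hee, hed, hde, hddq]; ring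
    · rw [q_addr, q_smulr, hye, hyd]; rfl
    · rw [hxx]; linarith
    · rw [hyy]; nlinarith [sq_nonneg ν, mul_pos (neg_pos.mpr hd) (show 0 < (2*ν^2)^2 by positivity)]
    · rw [hzz]; linarith
  have mvb : ∀ {t : V3} {a : ℕ}, vb t (B^a) → vb (f *ᵥ t) (B^(a+3)) := fun ht i =>
    (mv_bd hb ht i).trans (by
      rename_i t a
      calc 3*B*B^a ≤ B^2*B*B^a := by gcongr; nlinarith
        _ = B^(a+3) := by ring)
  have bν : |ν| ≤ B^14 := mvb heb i
  have bd' : vb d (B^16) := by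
    intro j
    have s1 : |(Pi.single i 1 : V3) j| ≤ 1 := by
      by_cases h : j = i
      · subst h; simp
      · simp [h]
    have : d j = 2*ν*(Pi.single i 1 : V3) j + (-(f i i))*e j := by rw [hdd]; simp
    rw [this]
    refine (abs_add_le _ _).trans ?_
    rw [abs_mul, abs_mul, abs_mul, abs_neg]
    have h1 : |(2:ℤ)| * |ν| * |(Pi.single i 1 : V3) j| ≤ 2*B^14*1 := by
      rw [abs_two]; gcongr
    have h2 : |f i i| * |e j| ≤ B*B^11 := mul_le_mul (hb i i) (heb j) (abs_nonneg _) (by omega)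
    have h3 : B*B^11 ≤ B^14 := by rw [← pow_succ']; exact pow_le_pow_right₀ hB1 (by norm_num)
    have h4 : 4*B^14 ≤ B^16 := by
      rw [show B^16 = B^2*B^14 by ring]; gcongr; nlinarith
    have h5 : 0 ≤ B^14 := by positivity
    linarith
  have hsum : B^11 + B^16 ≤ B^34 := by
    have : B^11 ≤ B^16 := pow_le_pow_right₀ hB1 (by norm_num)
    have h17 : 2*B^16 ≤ B^17 := by rw [show B^17 = B*B^16 by ring]; gcongr
    have : B^17 ≤ B^34 := pow_le_pow_right₀ hB1 (by norm_num)
    linarith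
  refine ⟨_, _, _, fr, ?_, ?_, ?_, Or.inr ⟨4*ν^2, by omega, ?_⟩⟩
  · intro j
    exact (abs_add_le _ _).trans ((add_le_add (heb j) (bd' j)).trans hsum)
  · intro j
    refine (cross_bd (mvb heb) (mvb bd') j).trans ?_
    calc 2*B^14*B^19 ≤ B*B^14*B^19 := by gcongr
      _ = B^34 := by ring
  · intro j
    refine (abs_add_le _ _).trans ((add_le_add (heb j) ?_).trans hsum)
    simpa using bd' j
  · rw [hxx, hzz]; ring
theorem frame_exists {f : M3} {B : ℤ} (hB : 2 ≤ B) (hb : mb3 f B) (hf : fᵀ = f) (hd : f.det < 0)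
    (hp : ∃ v, 0 < q f v v) : ∃ x y z, Frame f x y z ∧ vb x (B^34) ∧ vb y (B^34) ∧ vb z (B^34) ∧
      Good (-q f y y * q f z z) (-q f x x * q f z z) := by
  by_cases h : ∀ v, q f v v = 0 → v = 0
  · exact frame_aniso hB hb hf hd hp h
  · push Not at h
    obtain ⟨v, h0, hv⟩ := h
    exact frame_iso hB hb hf hd hv h0
end
section
open Matrix
theorem T_good : ∃ k : ℕ, ∀ {α β B Q : ℤ}, 2 ≤ B → 1 ≤ α → 1 ≤ β → α ≤ B → β ≤ B → 1 ≤ Q → Q ≤ B → Good α β →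
    ∀ (x : HA ℤ α β), x.re = 0 → 0 < nrd x → nrd x ≤ B → ∃ δ, Gam α β Q δ ∧ bd (δ*x*star δ) (B^k) := by
  obtain ⟨k1, h1⟩ := T_aniso
  obtain ⟨k2, h2⟩ := T_iso
  refine ⟨max k1 k2, ?_⟩
  intro α β B Q hB hα hβ hαB hβB hQ hQB hG x h0 hN hNB
  rcases hG with hG | ⟨b, hb, rfl⟩
  · obtain ⟨δ, hδ, hbd⟩ := h1 hB hα hβ hαB hβB hQ hQB hG x h0 hN hNB
    exact ⟨δ, hδ, hbd.mono (pow_le_pow_right₀ (by omega) (le_max_left _ _))⟩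
  · obtain ⟨δ, hδ, hbd⟩ := h2 hB hα hb hαB (by nlinarith) hQ hQB x h0 hN hNB
    exact ⟨δ, hδ, hbd.mono (pow_le_pow_right₀ (by omega) (le_max_right _ _))⟩
def pq {α β : ℤ} (v : V3) : HA ℤ α β := ⟨0, v 0, v 1, v 2⟩
def pqi {α β : ℤ} (x : HA ℤ α β) : V3 := ![x.imI, x.imJ, x.imK]
def Rp (α β a D m1 m2 m3 : ℤ) : M3 :=
  !![2*(D*(α*m1^2+β*m2^2-α*β*m3^2) - D*m1*α*m1), 2*(a*β*m3 - D*m1*β*m2), 2*(-a*β*m2 + D*m1*α*β*m3);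
     2*(-a*α*m3 - D*m2*α*m1), 2*(D*(α*m1^2+β*m2^2-α*β*m3^2) - D*m2*β*m2), 2*(a*α*m1 + D*m2*α*β*m3);
     2*(-a*m2 - D*m3*α*m1), 2*(a*m1 - D*m3*β*m2), 2*(D*(α*m1^2+β*m2^2-α*β*m3^2) + D*m3*α*β*m3)]
theorem Rp_spec {α β a D m1 m2 m3 : ℤ} (hn : nrd (⟨a, D*m1, D*m2, D*m3⟩ : HA ℤ α β) = 1) (v : V3) :
    (⟨a, D*m1, D*m2, D*m3⟩ : HA ℤ α β) * pq v * star (⟨a, D*m1, D*m2, D*m3⟩ : HA ℤ α β) = pq (v + D • (Rp α β a D m1 m2 m3 *ᵥ v)) := by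
  simp only [nrd] at hn
  have h0 : (Rp α β a D m1 m2 m3 *ᵥ v) 0 = 2*(D*(α*m1^2+β*m2^2-α*β*m3^2) - D*m1*α*m1) * v 0 + 2*(a*β*m3 - D*m1*β*m2) * v 1 + 2*(-a*β*m2 + D*m1*α*β*m3) * v 2 := by
    simp [Rp, mulVec, dotProduct, Fin.sum_univ_three]
  have h1 : (Rp α β a D m1 m2 m3 *ᵥ v) 1 = 2*(-a*α*m3 - D*m2*α*m1) * v 0 + 2*(D*(α*m1^2+β*m2^2-α*β*m3^2) - D*m2*β*m2) * v 1 + 2*(a*α*m1 + D*m2*α*β*m3) * v 2 := by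
    simp [Rp, mulVec, dotProduct, Fin.sum_univ_three]
  have h2 : (Rp α β a D m1 m2 m3 *ᵥ v) 2 = 2*(-a*m2 - D*m3*α*m1) * v 0 + 2*(a*m1 - D*m3*β*m2) * v 1 + 2*(D*(α*m1^2+β*m2^2-α*β*m3^2) + D*m3*α*β*m3) * v 2 := by
    simp [Rp, mulVec, dotProduct, Fin.sum_univ_three]
  generalize Rp α β a D m1 m2 m3 *ᵥ v = r at h0 h1 h2
  have hv : ∀ i, (v + D • r) i = v i + D * r i := fun i => by rw [Pi.add_apply, Pi.smul_apply, smul_eq_mul]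
  simp only [pq, hv, h0, h1, h2]
  generalize v 0 = x
  generalize v 1 = y
  generalize v 2 = z
  ext
  · simp only [re_mul, imI_mul, imJ_mul, imK_mul, re_star, imI_star, imJ_star, imK_star]
    ring
  · simp only [re_mul, imI_mul, imJ_mul, imK_mul, re_star, imI_star, imJ_star, imK_star]
    linear_combination x*hn
  · simp only [re_mul, imI_mul, imJ_mul, imK_mul, re_star, imI_star, imJ_star, imK_star]
    linear_combination y*hn
  · simp only [re_mul, imI_mul, imJ_mul, imK_mul, re_star, imI_star, imJ_star, imK_star]
    linear_combination z*hn
theorem eq_of_q {f g : M3} (hf : fᵀ = f) (hg : gᵀ = g) (h : ∀ x, q f x x = q g x x) : f = g := by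
  ext i j
  have h1 := h (Pi.single i 1 + Pi.single j 1)
  have h2 := h (Pi.single i 1)
  have h3 := h (Pi.single j 1)
  simp only [q_addl, q_addr, q_single] at h1 h2 h3
  have h4 : f i j = f j i := by conv_lhs => rw [← hf, transpose_apply]
  have h5 : g i j = g j i := by conv_lhs => rw [← hg, transpose_apply]
  linarith
theorem conj_symm {f : M3} (hf : fᵀ = f) (A : M3) : (Aᵀ * f * A)ᵀ = Aᵀ * f * A := by
  rw [transpose_mul, transpose_mul, transpose_transpose, hf, mul_assoc]
def Em (f : M3) (x y z : V3) : M3 := diagonal ![q f x x, q f y y, 1] * (fm x y z).adjugate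
theorem Em_mulVec (f : M3) (x y z v : V3) (i : Fin 3) :
    (Em f x y z *ᵥ v) i = ![q f x x, q f y y, 1] i * ((fm x y z).adjugate *ᵥ v) i := by
  rw [Em, ← mulVec_mulVec, mulVec_diagonal]
theorem nrd_Em {f : M3} {x y z : V3} (hf : fᵀ = f) (h : Frame f x y z) (v : V3) :
    nrd (pq (Em f x y z *ᵥ v) : HA ℤ (-q f y y * q f z z) (-q f x x * q f z z)) =
      q f x x * q f y y * q f z z * (fm x y z).det^2 * q f v v := by
  have he := orth_expand hf h.xy h.xz h.yz ((fm x y z).adjugate *ᵥ v) ((fm x y z).adjugate *ᵥ v)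
  rw [fm_adj, q_smull, q_smulr] at he
  have e0 := Em_mulVec f x y z v 0
  have e1 := Em_mulVec f x y z v 1
  have e2 := Em_mulVec f x y z v 2
  simp only [cons_val] at e0 e1 e2
  simp only [nrd, pq, e0, e1, e2]
  linear_combination -(q f x x * q f y y * q f z z)*he
theorem U_exists {f : M3} {x y z : V3} (hf : fᵀ = f) (hd : f.det ≠ 0) (h : Frame f x y z)
    (δ : HA ℤ (-q f y y * q f z z) (-q f x x * q f z z)) (hδ : Gam _ _ |(Em f x y z).det| δ) :
    ∃ U : M3, Uᵀ * f * U = f ∧ ∀ v, (Em f x y z).det • (U *ᵥ v) = (Em f x y z).adjugate *ᵥ pqi (δ * pq (Em f x y z *ᵥ v) * star δ) := by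
  obtain ⟨E, hE⟩ : ∃ E, E = Em f x y z := ⟨_, rfl⟩
  have hnE := nrd_Em hf h
  have hD := orth_det hf h.xy h.xz h.yz
  have hk : q f x x * q f y y * q f z z * (fm x y z).det^2 ≠ 0 := by
    have h1 : q f x x * q f y y * q f z z ≠ 0 := mul_ne_zero (mul_ne_zero h.x0.ne' h.y0.ne') h.z0.ne
    refine mul_ne_zero h1 ?_
    intro h0; rw [h0, zero_mul] at hD; exact h1 hD.symm
  generalize q f x x * q f y y * q f z z * (fm x y z).det^2 = κ at hk hnE
  rw [← hE] at hδ hnE ⊢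
  clear hD hE h
  generalize -q f y y * q f z z = α at *
  generalize -q f x x * q f z z = β at *
  obtain ⟨hn, ⟨m1, e1⟩, ⟨m2, e2⟩, ⟨m3, e3⟩⟩ := ((⟨hδ.1, (abs_dvd _ _).mp hδ.2.1, (abs_dvd _ _).mp hδ.2.2.1, (abs_dvd _ _).mp hδ.2.2.2⟩) : Gam α β E.det δ)
  have hδe : δ = ⟨δ.re, E.det*m1, E.det*m2, E.det*m3⟩ := QuaternionAlgebra.ext rfl e1 e2 e3
  obtain ⟨R, hR⟩ : ∃ R, R = Rp α β δ.re E.det m1 m2 m3 := ⟨_, rfl⟩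
  have hspec : ∀ v, δ * pq v * star δ = pq (v + E.det • (R *ᵥ v)) := by
    intro v
    have := Rp_spec (a := δ.re) (by rw [← hδe]; exact hn) v
    rwa [← hδe, ← hR] at this
  have hEU : ∀ v, E *ᵥ ((1 + E.adjugate * R * E) *ᵥ v) = E *ᵥ v + E.det • (R *ᵥ (E *ᵥ v)) := by
    intro v
    rw [mulVec_mulVec, mul_add, mul_one, ← mul_assoc, ← mul_assoc, mul_adjugate, add_mulVec, mulVec_mulVec, smul_mul_assoc, smul_mul_assoc, one_mul, smul_mulVec]
  refine ⟨1 + E.adjugate * R * E, ?_, ?_⟩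
  · apply eq_of_q (conj_symm hf _) hf
    intro v
    rw [q_conj]
    have k1 := hnE ((1 + E.adjugate * R * E) *ᵥ v)
    rw [hEU, ← hspec, nrd_mul, nrd_mul, nrd_star, hn, hnE, one_mul, mul_one] at k1
    exact (mul_left_cancel₀ hk k1).symm
  · intro v
    rw [hspec, ← hEU]
    have : ∀ w : V3, pqi (pq w : HA ℤ α β) = w := fun w => by
      ext i; fin_cases i <;> rfl
    rw [this, mulVec_mulVec _ E.adjugate, adjugate_mul, smul_mulVec, one_mulVec]
theorem move : ∃ k : ℕ, ∀ {f : M3} {B : ℤ} (hB : 2 ≤ B) (hb : mb3 f B) (hf : fᵀ = f) (hd : f.det < 0)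
    {x y z : V3} (h : Frame f x y z) (bx : vb x (B^34)) (hby : vb y (B^34)) (bz : vb z (B^34))
    (hG : Good (-q f y y * q f z z) (-q f x x * q f z z)) (p : V3) (hp : q f p p < 0) (hpB : |q f p p| ≤ B^73),
    ∃ U : M3, Uᵀ * f * U = f ∧ vb (U *ᵥ p) (B^k) := by
  obtain ⟨k, hk⟩ := T_good
  refine ⟨287 + 502*k, ?_⟩
  intro f B hB hb hf hd x y z h bx hby bz hG p hp hpB
  have hB1 : 1 ≤ B := by omega
  have h6 : 6 ≤ B^3 := by
    have := pl_two hB 3; omega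
  have h9 : 9 ≤ B^4 := by
    have := pl_two hB 4; omega
  have qb : ∀ {u : V3}, vb u (B^34) → |q f u u| ≤ B^73 := fun hu => by
    refine (q_bd hb hu hu).trans ?_
    calc 9*B*B^34*B^34 ≤ B^4*B*B^34*B^34 := by gcongr
      _ = B^73 := by ring
  have qx := qb bx
  have qy := qb hby
  have qz := qb bz
  have hx0 := h.x0; have hy0 := h.y0; have hz0 := h.z0
  have hSb : mb3 (fm x y z) (B^34) := by
    intro i j
    rw [fm, transpose_apply]
    fin_cases j
    · exact bx i
    · exact hby i
    · exact bz i
  have hsb : |(fm x y z).det| ≤ B^105 := by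
    refine (det_bd hSb).trans ?_
    calc 6*(B^34)^3 ≤ B^3*(B^34)^3 := by gcongr
      _ = B^105 := by ring
  have hEb : mb3 (Em f x y z) (B^142) := by
    intro i j
    have e : Em f x y z i j = ![q f x x, q f y y, 1] i * (fm x y z).adjugate i j := by
      rw [Em, diagonal_mul]
    have h1 : |(![q f x x, q f y y, 1] : V3) i| ≤ B^73 := by
      fin_cases i
      · exact qx
      · exact qy
      · simpa using one_le_pow₀ hB1
    have h2 : |(fm x y z).adjugate i j| ≤ B^69 := (adj_bd hSb i j).trans (by
      calc 2*(B^34)^2 ≤ B*(B^34)^2 := by gcongr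
        _ = B^69 := by ring)
    rw [e, abs_mul, show B^142 = B^73*B^69 by ring]
    exact mul_le_mul h1 h2 (abs_nonneg _) (by positivity)
  have hDb : |(Em f x y z).det| ≤ B^429 := by
    refine (det_bd hEb).trans ?_
    calc 6*(B^142)^3 ≤ B^3*(B^142)^3 := by gcongr
      _ = B^429 := by ring
  have hD := orth_det hf h.xy h.xz h.yz
  have hs : (fm x y z).det ≠ 0 := by
    intro h0; rw [h0] at hD
    have : q f x x * q f y y * q f z z ≠ 0 := mul_ne_zero (mul_ne_zero h.x0.ne' h.y0.ne') h.z0.ne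
    apply this; rw [← hD]; ring
  have hD0 : (Em f x y z).det ≠ 0 := by
    rw [Em, det_mul, det_diagonal, Fin.prod_univ_three, det_adjugate]
    simp [hs, hx0.ne', hy0.ne']
  have hn := nrd_Em hf h p
  have hneg : q f x x * q f y y * q f z z < 0 := mul_neg_of_pos_of_neg (mul_pos hx0 hy0) hz0
  have hs2 : 0 < (fm x y z).det^2 := by positivity
  have hnpos : 0 < nrd (pq (Em f x y z *ᵥ p) : HA ℤ (-q f y y * q f z z) (-q f x x * q f z z)) := by
    rw [hn]; exact mul_pos_of_neg_of_neg (mul_neg_of_neg_of_pos hneg hs2) hp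
  have up : ∀ {a : ℕ} {t : ℤ}, t ≤ B^a → a ≤ 502 → t ≤ B^502 := fun h h2 => h.trans (pow_le_pow_right₀ hB1 h2)
  have hnb : nrd (pq (Em f x y z *ᵥ p) : HA ℤ (-q f y y * q f z z) (-q f x x * q f z z)) ≤ B^502 := by
    rw [hn]
    refine (le_abs_self _).trans ?_
    rw [abs_mul, abs_mul, abs_mul, abs_mul, abs_pow]
    calc _ ≤ B^73 * B^73 * B^73 * (B^105)^2 * B^73 := by gcongr
      _ = B^502 := by ring
  have ab : ∀ {s t : ℤ}, |s| ≤ B^73 → |t| ≤ B^73 → -s*t ≤ B^502 := fun {s t} h1 h2 => by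
    refine up (a := 146) ?_ (by norm_num)
    calc -s*t ≤ |s| * |t| := by rw [← abs_neg s, ← abs_mul]; exact le_abs_self _
      _ ≤ B^73*B^73 := by gcongr
      _ = B^146 := by ring
  obtain ⟨δ, hδ, hbd⟩ := hk (B := B^502) (Q := |(Em f x y z).det|) (hB.trans (le_self_pow₀ hB1 (by norm_num)))
    (by nlinarith) (by nlinarith) (ab qy qz) (ab qx qz) (Int.one_le_abs hD0) (up hDb (by norm_num)) hG (pq (Em f x y z *ᵥ p)) rfl hnpos hnb
  obtain ⟨U, hU, hUv⟩ := U_exists hf hd.ne h δ hδ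
  refine ⟨U, hU, fun i => ?_⟩
  have h1 := congrFun (hUv p) i
  rw [Pi.smul_apply, smul_eq_mul] at h1
  have h2 : |(Em f x y z).det * (U *ᵥ p) i| ≤ 3*(2*(B^142)^2)*(B^502)^k := by
    rw [h1]
    apply mv_bd (adj_bd hEb)
    intro j
    fin_cases j
    · exact hbd.2.1
    · exact hbd.2.2.1
    · exact hbd.2.2.2
  rw [abs_mul] at h2
  calc |(U *ᵥ p) i| ≤ |(Em f x y z).det| * |(U *ᵥ p) i| := le_mul_of_one_le_left (abs_nonneg _) (Int.one_le_abs hD0)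
    _ ≤ _ := h2
    _ = 6*(B^284*(B^502)^k) := by ring
    _ ≤ B^3*(B^284*(B^502)^k) := by gcongr
    _ = B^(287+502*k) := by rw [pow_add, ← pow_mul]; ring
end
section
open Matrix
theorem abs_le_sq' (t : ℤ) : |t| ≤ t^2 := by
  rcases eq_or_ne t 0 with h | h
  · subst h; simp
  · have := Int.one_le_abs h
    rw [← sq_abs]; nlinarith
theorem pdb {X c D t : ℤ} (hD : 1 ≤ D) (h : ∀ u v : ℤ, 0 ≤ u^2*X + 2*u*v*(D*t) + v^2*(D*c)) : t^2 ≤ X*c := by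
  have h1 := cs_scalar h
  have h2 : D*(D*t^2) ≤ D*(X*c) := by linarith [show D*(D*t^2) = (D*t)^2 by ring, show D*(X*c) = X*(D*c) by ring]
  have h3 := le_of_mul_le_mul_left h2 (by omega)
  have h4 : t^2 ≤ D*t^2 := le_mul_of_one_le_left (sq_nonneg _) hD
  linarith
theorem q_adj (f : M3) (x : V3) (j : Fin 3) : q f x (f.adjugate *ᵥ Pi.single j 1) = f.det * x j := by
  rw [q, mulVec_mulVec, mul_adjugate, smul_mulVec, one_mulVec, dotProduct_smul, dotProduct_single, mul_one, smul_eq_mul]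
theorem adj_col (f : M3) (i j : Fin 3) : (f.adjugate *ᵥ Pi.single j 1) i = f.adjugate i j := by simp
theorem def_bd {f g P : M3} {B : ℤ} (hB : 2 ≤ B) (hbf : mb3 f B) (hbg : mb3 g B) (hf : fᵀ = f) (hd : 0 < f.det)
    (hp : ∀ v, 0 ≤ q f v v) (hP : Pᵀ * f * P = g) : mb3 P (B^4) := by
  intro j i
  have e : P j i = (P *ᵥ Pi.single i 1) j := by simp
  have hqx : q f (P *ᵥ Pi.single i 1) (P *ᵥ Pi.single i 1) = g i i := by rw [← q_conj, hP, q_single]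
  rw [e]
  generalize P *ᵥ Pi.single i 1 = x at *
  have key := pdb (X := q f x x) (c := (f.adjugate *ᵥ Pi.single j 1) j) (D := f.det) (t := x j) (by omega) (by
    intro u v
    have := hp (u • x + v • (f.adjugate *ᵥ Pi.single j 1))
    simp only [q_addl, q_addr, q_smull, q_smulr] at this
    rw [q_comm hf (f.adjugate *ᵥ Pi.single j 1) x, q_adj, q_adj] at this
    linarith)
  rw [hqx, adj_col] at key
  have h1 : |g i i * f.adjugate j j| ≤ B*(2*B^2) := by
    rw [abs_mul]; exact mul_le_mul (hbg i i) (adj_bd hbf j j) (abs_nonneg _) (by omega)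
  have h2 : B*(2*B^2) ≤ B^4 := by
    calc B*(2*B^2) ≤ B*(B*B^2) := by gcongr
      _ = B^4 := by ring
  have h3 : |x j| ≤ x j^2 := abs_le_sq' _
  linarith [le_abs_self (g i i * f.adjugate j j)]
theorem frame_rcs {f : M3} {x y z : V3} (hf : fᵀ = f) (h : Frame f x y z) {p : V3} (hp : q f p p < 0) (v : V3) :
    0 ≤ (q f v p)^2 - q f p p * q f v v := by
  have he := orth_expand hf h.xy h.xz h.yz
  have hD := orth_det hf h.xy h.xz h.yz
  have hs : (fm x y z).det ≠ 0 := by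
    intro h0; rw [h0] at hD
    have : q f x x * q f y y * q f z z ≠ 0 := mul_ne_zero (mul_ne_zero h.x0.ne' h.y0.ne') h.z0.ne
    apply this; rw [← hD]; ring
  have k1 := he ((fm x y z).adjugate *ᵥ p) ((fm x y z).adjugate *ᵥ p)
  have k2 := he ((fm x y z).adjugate *ᵥ v) ((fm x y z).adjugate *ᵥ v)
  have k3 := he ((fm x y z).adjugate *ᵥ v) ((fm x y z).adjugate *ᵥ p)
  rw [fm_adj, q_smull, q_smulr] at k1 k2
  rw [fm_adj, fm_adj, q_smull, q_smulr] at k3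
  generalize (fm x y z).adjugate *ᵥ p = P at *
  generalize (fm x y z).adjugate *ᵥ v = V at *
  generalize (fm x y z).det = s at *
  have hs2 : 0 < s*s := mul_self_pos.mpr hs
  have hneg : q f x x * P 0^2 + q f y y * P 1^2 + q f z z * P 2^2 < 0 := by
    have : s*s*q f p p < 0 := mul_neg_of_pos_of_neg hs2 hp
    linarith
  have r := rcs (x := V 0) (y := V 1) (z := V 2) h.x0 h.y0 h.z0 hneg
  have e : (s*s)*(s*s)*((q f v p)^2 - q f p p * q f v v) = (s*(s*q f v p))^2 - (s*(s*q f p p))*(s*(s*q f v v)) := by ring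
  rw [k1, k2, k3] at e
  refine nonneg_of_mul_nonneg_right (a := (s*s)*(s*s)) ?_ (by positivity)
  rw [e]
  linarith
theorem maj_bd {f : M3} {x y z : V3} (hf : fᵀ = f) (hd : f.det < 0) (h : Frame f x y z) {p : V3} (hp : q f p p < 0) (v : V3) (j : Fin 3) :
    (v j)^2 ≤ (2*(q f v p)^2 - q f p p * q f v v) * (q f p p * f.adjugate j j - 2*f.det*p j*p j) := by
  obtain ⟨c, hc⟩ : ∃ c : V3, c = (q f p p) • (f.adjugate *ᵥ Pi.single j 1) + (-(2*f.det*p j)) • p := ⟨_, rfl⟩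
  have qvc : ∀ v, q f v c = q f p p * (f.det * v j) - 2*f.det*p j*q f v p := fun v => by
    rw [hc, q_addr, q_smulr, q_smulr, q_adj]; ring
  have hcj : c j = q f p p * f.adjugate j j - 2*f.det*p j*p j := by
    rw [hc, Pi.add_apply, Pi.smul_apply, Pi.smul_apply, adj_col, smul_eq_mul, smul_eq_mul]; ring
  have qcp : q f c p = -(q f p p*f.det*p j) := by rw [q_comm hf, qvc]; ring
  rw [← hcj]
  apply pdb (D := -(q f p p)^2*f.det)
  · have h2 : 0 < (q f p p)^2 := by have := hp.ne; positivity
    have : 0 < (q f p p)^2 * (-f.det) := mul_pos h2 (by omega)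
    linarith
  · intro u t
    have r := frame_rcs hf h hp (u • v + t • c)
    have r2 : 0 ≤ 2*(q f (u • v + t • c) p)^2 - q f p p * q f (u • v + t • c) (u • v + t • c) := by
      nlinarith [sq_nonneg (q f (u • v + t • c) p)]
    simp only [q_addl, q_addr, q_smull, q_smulr] at r2
    rw [q_comm hf c v, qcp, qvc c, qvc v, qcp] at r2
    refine r2.trans (le_of_eq ?_)
    ring
theorem indef : ∃ k : ℕ, ∀ {f g P : M3} {B : ℤ}, 2 ≤ B → mb3 f B → mb3 g B → fᵀ = f → gᵀ = g → f.det < 0 →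
    (∃ v, 0 < q f v v) → IsUnit P.det → Pᵀ * f * P = g → ∃ A : M3, IsUnit A.det ∧ Aᵀ * f * A = g ∧ mb3 A (B^k) := by
  obtain ⟨k, hk⟩ := move
  refine ⟨80 + (79 + 2*k), ?_⟩
  intro f g P B hB hbf hbg hf hg hd hpos hPu hP
  have hB1 : 1 ≤ B := by omega
  have hP2 : P.det*P.det = 1 := by
    rcases Int.isUnit_iff.mp hPu with h | h <;> rw [h] <;> norm_num
  have hdg : g.det = f.det := by
    rw [← hP, det_mul, det_mul, det_transpose]; linear_combination f.det*hP2
  have hposg : ∃ v, 0 < q g v v := by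
    obtain ⟨v, hv⟩ := hpos
    refine ⟨P.adjugate *ᵥ v, ?_⟩
    rw [← hP, q_conj, mulVec_mulVec, mul_adjugate, smul_mulVec, one_mulVec, q_smull, q_smulr, ← mul_assoc, hP2, one_mul]
    exact hv
  obtain ⟨x, y, z, hF, bx, hby, bz, hG⟩ := frame_exists hB hbf hf hd hpos
  obtain ⟨_, _, w, hFg, -, -, bw, -⟩ := frame_exists hB hbg hg (by rw [hdg]; exact hd) hposg
  have hw := hFg.z0
  have h9 : 9 ≤ B^4 := by
    have := pl_two hB 4; omega
  have hwB : |q g w w| ≤ B^73 := by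
    refine (q_bd hbg bw bw).trans ?_
    calc 9*B*B^34*B^34 ≤ B^4*B*B^34*B^34 := by gcongr
      _ = B^73 := by ring
  have hpw : q f (P *ᵥ w) (P *ᵥ w) = q g w w := by rw [← q_conj, hP]
  obtain ⟨U, hU, hUb⟩ := hk hB hbf hf hd hF bx hby bz hG (P *ᵥ w) (by rw [hpw]; exact hw) (by rw [hpw]; exact hwB)
  have hUd : U.det*U.det = 1 := by
    have := congrArg Matrix.det hU
    rw [det_mul, det_mul, det_transpose] at this
    have h2 : f.det*(U.det*U.det) = f.det*1 := by linarith
    exact mul_left_cancel₀ hd.ne h2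
  have hA : (U*P)ᵀ * f * (U*P) = g := by
    rw [transpose_mul, ← hP]
    conv_rhs => rw [← hU]
    simp only [mul_assoc]
  refine ⟨U*P, ?_, hA, ?_⟩
  · rw [det_mul]; exact (IsUnit.of_mul_eq_one _ hUd).mul hPu
  rw [mulVec_mulVec] at hUb
  generalize U*P = A at *
  obtain ⟨p, hp⟩ : ∃ p, p = A *ᵥ w := ⟨_, rfl⟩
  have hpp : q f p p = q g w w := by rw [hp, ← q_conj, hA]
  intro j i
  have e : A j i = (A *ᵥ Pi.single i 1) j := by simp
  have key := maj_bd hf hd hF (p := p) (by rw [hpp]; exact hw) (A *ᵥ Pi.single i 1) j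
  have h1 : q f (A *ᵥ Pi.single i 1) p = q g (Pi.single i 1) w := by rw [hp, ← q_conj, hA]
  have h2 : q f (A *ᵥ Pi.single i 1) (A *ᵥ Pi.single i 1) = g i i := by rw [← q_conj, hA, q_single]
  rw [h1, h2, ← e, hpp] at key
  rw [← hp] at hUb
  have hs1 : vb (Pi.single i 1) 1 := by
    intro l
    by_cases h : l = i
    · subst h; simp
    · simp [h]
  have b1 : |q g (Pi.single i 1) w| ≤ B^39 := by
    refine (q_bd hbg hs1 bw).trans ?_
    calc 9*B*1*B^34 ≤ B^4*B*1*B^34 := by gcongr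
      _ = B^39 := by ring
  have b2 : |2*(q g (Pi.single i 1) w)^2 - q g w w * g i i| ≤ B^80 := by
    refine (abs_sub _ _).trans ?_
    rw [abs_mul, abs_mul, abs_pow, abs_two]
    calc _ ≤ 2*(B^39)^2 + B^73*B := by gcongr; exact hbg i i
      _ = 2*B^78 + B^74 := by ring
      _ ≤ 2*B^78 + B^78 := by gcongr <;> norm_num
      _ ≤ 2^2*B^78 := by have : 0 ≤ B^78 := by positivity
                         linarith
      _ ≤ B^2*B^78 := by gcongr
      _ = B^80 := by ring
  have b3 : |q g w w * f.adjugate j j - 2*f.det*p j*p j| ≤ B^(79+2*k) := by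
    refine (abs_sub _ _).trans ?_
    rw [abs_mul, abs_mul, abs_mul, abs_mul, abs_two]
    have c0 : 1 ≤ B^(2*k) := one_le_pow₀ hB1
    calc _ ≤ B^73*(2*B^2) + 2*(6*B^3)*B^k*B^k := by
            gcongr
            · exact adj_bd hbf j j
            · exact det_bd hbf
            · exact hUb j
            · exact hUb j
      _ = 2*B^75*1 + 12*B^3*B^(2*k) := by ring
      _ ≤ 2*B^75*B^(2*k) + 12*B^75*B^(2*k) := by gcongr <;> norm_num
      _ ≤ 2^4*B^75*B^(2*k) := by have : 0 ≤ B^75*B^(2*k) := by positivity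
                                 linarith
      _ ≤ B^4*B^75*B^(2*k) := by gcongr
      _ = B^(79+2*k) := by rw [pow_add]; ring
  calc |A j i| ≤ (A j i)^2 := abs_le_sq' _
    _ ≤ _ := key
    _ ≤ _ := le_abs_self _
    _ ≤ B^80*B^(79+2*k) := by rw [abs_mul]; gcongr
    _ = _ := by rw [← pow_add]
theorem q_neg (f : M3) (x y : V3) : q (-f) x y = -q f x y := by simp [q, neg_mulVec]
theorem mb3.neg {f : M3} {B : ℤ} (h : mb3 f B) : mb3 (-f) B := fun i j => by simpa using h i j
theorem det_neg3 (f : M3) : (-f).det = -f.det := by rw [Matrix.det_neg]; simp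
theorem core : ∃ k : ℕ, ∀ {f g P : M3} {B : ℤ}, 2 ≤ B → mb3 f B → mb3 g B → fᵀ = f → gᵀ = g → f.det ≠ 0 →
    IsUnit P.det → Pᵀ * f * P = g → ∃ A : M3, IsUnit A.det ∧ Aᵀ * f * A = g ∧ mb3 A (B^k) := by
  obtain ⟨k, hk⟩ := indef
  refine ⟨max k 4, ?_⟩
  intro f g P B hB hbf hbg hf hg hd hPu hP
  have mono : ∀ {A : M3} {a : ℕ}, mb3 A (B^a) → a ≤ max k 4 → mb3 A (B^max k 4) := fun h h2 i j =>
    (h i j).trans (pow_le_pow_right₀ (by omega) h2)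
  have hf' : (-f)ᵀ = -f := by rw [transpose_neg, hf]
  have hg' : (-g)ᵀ = -g := by rw [transpose_neg, hg]
  have hP' : Pᵀ * (-f) * P = -g := by rw [mul_neg, neg_mul, hP]
  rcases hd.lt_or_gt with hd | hd
  · by_cases hp : ∃ v, 0 < q f v v
    · obtain ⟨A, h1, h2, h3⟩ := hk hB hbf hbg hf hg hd hp hPu hP
      exact ⟨A, h1, h2, mono h3 (le_max_left _ _)⟩
    · push Not at hp
      refine ⟨P, hPu, hP, mono (def_bd hB hbf.neg hbg.neg hf' (by rw [det_neg3]; omega) (fun v => ?_) hP') (le_max_right _ _)⟩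
      rw [q_neg]; linarith [hp v]
  · by_cases hp : ∃ v, q f v v < 0
    · obtain ⟨v, hv⟩ := hp
      obtain ⟨A, h1, h2, h3⟩ := hk hB hbf.neg hbg.neg hf' hg' (by rw [det_neg3]; omega) ⟨v, by rw [q_neg]; omega⟩ hPu hP'
      refine ⟨A, h1, ?_, mono h3 (le_max_left _ _)⟩
      rwa [mul_neg, neg_mul, neg_inj] at h2
    · push Not at hp
      exact ⟨P, hPu, hP, mono (def_bd hB hbf hbg hf hd hp hP) (le_max_right _ _)⟩
theorem sum_eq_q (f : Fin 3 → Fin 3 → ℤ) (x : V3) : ∑ i, ∑ j, f i j * x i * x j = q (of f) x x := by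
  simp only [q, dotProduct, mulVec, Finset.mul_sum, of_apply]
  exact Finset.sum_congr rfl fun i _ => Finset.sum_congr rfl fun j _ => by ring
end
end Masser
theorem masser_conjecture_ternary :
    ∃ C p : ℝ, 0 < C ∧ 0 < p ∧
      ∀ (f g : Fin 3 → Fin 3 → ℤ),
      (∀ i j, f i j = f j i) → (∀ i j, g i j = g j i) →
      (Matrix.of f).det ≠ 0 → (Matrix.of g).det ≠ 0 →
      (∃ A : Matrix (Fin 3) (Fin 3) ℤ, IsUnit A.det ∧
        ∀ X : Fin 3 → ℤ,
          ∑ i, ∑ j, f i j * A.mulVec X i * A.mulVec X j = ∑ i, ∑ j, g i j * X i * X j) →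
      ∃ A : Matrix (Fin 3) (Fin 3) ℤ, IsUnit A.det ∧
        (∀ X : Fin 3 → ℤ,
          ∑ i, ∑ j, f i j * A.mulVec X i * A.mulVec X j = ∑ i, ∑ j, g i j * X i * X j) ∧
        ((Finset.univ.sup fun q : Fin 3 × Fin 3 => (A q.1 q.2).natAbs : ℕ) : ℝ) ≤
          C * (((Finset.univ.sup fun q : Fin 3 × Fin 3 => (f q.1 q.2).natAbs : ℕ) : ℝ) +
              ((Finset.univ.sup fun q : Fin 3 × Fin 3 => (g q.1 q.2).natAbs : ℕ) : ℝ)) ^ p := by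
  obtain ⟨k, hk⟩ := Masser.core
  refine ⟨1, (k+1 : ℕ), one_pos, by positivity, ?_⟩
  rintro f g hf hg hdf hdg ⟨P, hPu, hP⟩
  have hF : ∀ (h : Fin 3 → Fin 3 → ℤ) i j, (h i j).natAbs ≤ Finset.univ.sup fun q : Fin 3 × Fin 3 => (h q.1 q.2).natAbs :=
    fun h i j => Finset.le_sup (f := fun q : Fin 3 × Fin 3 => (h q.1 q.2).natAbs) (Finset.mem_univ (i, j))
  have hpos : ∀ (h : Fin 3 → Fin 3 → ℤ), (Matrix.of h).det ≠ 0 → 1 ≤ Finset.univ.sup fun q : Fin 3 × Fin 3 => (h q.1 q.2).natAbs := by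
    intro h hd
    by_contra hc
    apply hd
    have : Matrix.of h = 0 := by
      ext i j
      have := hF h i j
      simp only [Matrix.of_apply, Matrix.zero_apply]
      omega
    rw [this]; simp
  have h1 := hpos f hdf
  have h2 := hpos g hdg
  have b1 := hF f
  have b2 := hF g
  generalize (Finset.univ.sup fun q : Fin 3 × Fin 3 => (f q.1 q.2).natAbs) = nf at *
  generalize (Finset.univ.sup fun q : Fin 3 × Fin 3 => (g q.1 q.2).natAbs) = ng at *
  have sf : (Matrix.of f).transpose = Matrix.of f := by ext i j; exact hf j i
  have sg : (Matrix.of g).transpose = Matrix.of g := by ext i j; exact hg j i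
  have hPg : P.transpose * Matrix.of f * P = Matrix.of g := by
    apply Masser.eq_of_q (Masser.conj_symm sf P) sg
    intro X
    rw [Masser.q_conj, ← Masser.sum_eq_q, ← Masser.sum_eq_q]
    exact hP X
  obtain ⟨A, hA, hAg, hAb⟩ := hk (f := Matrix.of f) (g := Matrix.of g) (P := P) (B := ((nf + ng : ℕ) : ℤ)) (by omega)
    (fun i j => by have := b1 i j; rw [Matrix.of_apply, Int.abs_eq_natAbs]; omega)
    (fun i j => by have := b2 i j; rw [Matrix.of_apply, Int.abs_eq_natAbs]; omega) sf sg hdf hPu hPg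
  refine ⟨A, hA, fun X => ?_, ?_⟩
  · rw [Masser.sum_eq_q, Masser.sum_eq_q, ← Masser.q_conj, hAg]
  · rw [one_mul, Real.rpow_natCast]
    have : (Finset.univ.sup fun q : Fin 3 × Fin 3 => (A q.1 q.2).natAbs) ≤ (nf+ng)^(k+1) := by
      apply Finset.sup_le
      intro q _
      have h3 := hAb q.1 q.2
      have h4 : (A q.1 q.2).natAbs ≤ (nf+ng)^k := by zify; exact_mod_cast h3
      exact h4.trans (Nat.pow_le_pow_right (by omega) (by omega))
    exact_mod_cast this
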